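/- arXiv:1906.11808 — 3 statements merged into one kernel-verified Lean document; each statement's English description precedes it below -/
import Mathlib

section
/- With high probability, χ(G(n,1/2)) = f(n) + o(n/(log n)²). Precisely: for every ε > 0, P( |χ(G(n,1/2)) − f(n)| ≤ ε·n/(log n)² ) → 1 as n → ∞. -/
open Filter

/-- The chromatic number of a graph on `Fin n`, as a natural number. -/
noncomputable def chi (n : ℕ) (G : SimpleGraph (Fin n)) : ℕ := G.chromaticNumber.toNat

/-- Probability of an event under `G(n,1/2)`, i.e. the uniform measure on all
simple graphs on `{1,…,n}` (each edge present independently with probability 1/2). -/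
noncomputable def Pr (n : ℕ) (B : SimpleGraph (Fin n) → Prop) : ℝ :=
  (Nat.card {G : SimpleGraph (Fin n) // B G} : ℝ) / (Nat.card (SimpleGraph (Fin n)) : ℝ)

/-- `f(n) = n / (2 log₂ n − 2 log₂ log₂ n − 2)`. -/
noncomputable def f (n : ℕ) : ℝ :=
  n / (2 * Real.logb 2 n - 2 * Real.logb 2 (Real.logb 2 n) - 2)

section model

abbrev Mat (n : ℕ) := Fin n → Fin n → Bool

def gr {n : ℕ} (x : Mat n) : SimpleGraph (Fin n) where
  Adj v u := (u < v ∧ x v u = true) ∨ (v < u ∧ x u v = true)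
  symm := ⟨fun v u h => h.symm⟩
  loopless := ⟨fun v h => by simp at h⟩

noncomputable def grEquiv (n : ℕ) :
    Mat n ≃ SimpleGraph (Fin n) × ({p : Fin n × Fin n // ¬ p.2 < p.1} → Bool) := by
  classical
  exact
  { toFun := fun x => (gr x, fun p => x p.1.1 p.1.2)
    invFun := fun y v u => if h : u < v then decide (y.1.Adj v u) else y.2 ⟨(v, u), h⟩
    left_inv := by
      intro x
      funext v u
      by_cases h : u < v
      · simp [h, gr, h.not_gt]
      · simp [h]
    right_inv := by
      rintro ⟨G, y⟩
      refine Prod.ext ?_ ?_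
      · ext v u
        rcases lt_trichotomy u v with h | h | h
        · simp [gr, h, h.not_gt]
        · subst h; simp [gr]
        · simp [gr, h, h.not_gt, G.adj_comm]
      · funext p
        simp [p.2] }

lemma Pr_eq (n : ℕ) (B : SimpleGraph (Fin n) → Prop) :
    Pr n B = (Nat.card {x : Mat n // B (gr x)} : ℝ) / (Nat.card (Mat n) : ℝ) := by
  have h1 : Nat.card (Mat n) = Nat.card (SimpleGraph (Fin n)) *
      Nat.card ({p : Fin n × Fin n // ¬ p.2 < p.1} → Bool) := by
    rw [Nat.card_congr (grEquiv n), Nat.card_prod]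
  have h2 : Nat.card {x : Mat n // B (gr x)} = Nat.card {G : SimpleGraph (Fin n) // B G} *
      Nat.card ({p : Fin n × Fin n // ¬ p.2 < p.1} → Bool) := by
    rw [← Nat.card_prod]
    refine Nat.card_congr ?_
    refine ((grEquiv n).subtypeEquiv (q := fun y => B y.1) (fun x => ?_)).trans ?_
    · simp [grEquiv]
    · exact
      { toFun := fun y => (⟨y.1.1, y.2⟩, y.1.2)
        invFun := fun y => ⟨(y.1.1, y.2), y.1.2⟩
        left_inv := fun y => rfl
        right_inv := fun y => rfl }
  have h3 : (Nat.card ({p : Fin n × Fin n // ¬ p.2 < p.1} → Bool) : ℝ) ≠ 0 := by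
    have : 0 < Nat.card ({p : Fin n × Fin n // ¬ p.2 < p.1} → Bool) := Nat.card_pos
    positivity
  unfold Pr
  rw [h1, h2]
  push_cast
  rw [mul_div_mul_right _ _ h3]

open Classical in
lemma Pr_eq' (n : ℕ) (B : SimpleGraph (Fin n) → Prop) :
    Pr n B = ((Finset.univ.filter fun x : Mat n => B (gr x)).card : ℝ) / (Fintype.card (Mat n) : ℝ) := by
  rw [Pr_eq, Nat.card_eq_fintype_card, Nat.card_eq_fintype_card, Fintype.card_subtype]

lemma count_avoid {n : ℕ} (E : Finset (Fin n × Fin n)) :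
    ((Finset.univ.filter fun x : Mat n => ∀ e ∈ E, x e.1 e.2 = false).card : ℝ) * 2 ^ E.card
      = Fintype.card (Mat n) := by
  classical
  have h1 : (Finset.univ.filter fun x : Mat n => ∀ e ∈ E, x e.1 e.2 = false).card =
      (Fintype.piFinset fun e : Fin n × Fin n => if e ∈ E then ({false} : Finset Bool) else Finset.univ).card := by
    refine Finset.card_equiv (Equiv.curry _ _ _).symm ?_
    intro x
    simp only [Finset.mem_filter, Finset.mem_univ, true_and, Fintype.mem_piFinset]
    refine forall_congr' fun e => ?_
    by_cases h : e ∈ E <;> simp [h, Function.uncurry]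
  have h2 : Fintype.card (Mat n) = 2 ^ (Fintype.card (Fin n × Fin n)) := by
    rw [← Fintype.card_congr (Equiv.curry (Fin n) (Fin n) Bool)]
    simp
  rw [h1, h2, Fintype.card_piFinset]
  have h3 : ∀ e : Fin n × Fin n, (if e ∈ E then ({false} : Finset Bool) else Finset.univ).card = if e ∈ E then 1 else 2 := by
    intro e; split_ifs <;> simp
  simp_rw [h3]
  rw [Finset.prod_ite, Finset.prod_const_one, one_mul, Finset.prod_const]
  have h4 : (Finset.univ.filter fun e => e ∉ E) = Eᶜ := by ext; simp
  rw [h4]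
  push_cast
  rw [← pow_add, Finset.card_compl_add_card]

/-- monochromatic pairs -/
def mono {n : ℕ} {κ : Type*} [DecidableEq κ] (c : Fin n → κ) : Finset (Fin n × Fin n) :=
  Finset.univ.filter fun e => e.2 < e.1 ∧ c e.1 = c e.2

lemma proper_iff {n : ℕ} {κ : Type*} [DecidableEq κ] (c : Fin n → κ) (x : Mat n) :
    (∀ v u, (gr x).Adj v u → c v ≠ c u) ↔ ∀ e ∈ mono c, x e.1 e.2 = false := by
  constructor
  · intro h e he
    simp only [mono, Finset.mem_filter, Finset.mem_univ, true_and] at he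
    by_contra hx
    exact h e.1 e.2 (Or.inl ⟨he.1, by simpa using hx⟩) he.2
  · intro h v u hadj hc
    rcases hadj with ⟨h1, h2⟩ | ⟨h1, h2⟩
    · have := h (v, u) (by simp [mono, h1, hc])
      simp_all
    · have := h (u, v) (by simp [mono, h1, hc])
      simp_all

lemma pairs_symm {n : ℕ} (r : Fin n → Fin n → Prop) [DecidableRel r] (hr : ∀ v u, r v u → r u v)
    (hrefl : ∀ v, r v v) :
    2 * (Finset.univ.filter fun e : Fin n × Fin n => e.2 < e.1 ∧ r e.1 e.2).card + n =
      (Finset.univ.filter fun e : Fin n × Fin n => r e.1 e.2).card := by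
  classical
  have h1 : (Finset.univ.filter fun e : Fin n × Fin n => e.1 < e.2 ∧ r e.1 e.2).card =
      (Finset.univ.filter fun e : Fin n × Fin n => e.2 < e.1 ∧ r e.1 e.2).card := by
    refine Finset.card_equiv (Equiv.prodComm _ _) ?_
    rintro ⟨v, u⟩
    simp only [Finset.mem_filter, Finset.mem_univ, true_and, Equiv.prodComm_apply, Prod.swap]
    exact ⟨fun h => ⟨h.1, hr _ _ h.2⟩, fun h => ⟨h.1, hr _ _ h.2⟩⟩
  have h2 : (Finset.univ.filter fun e : Fin n × Fin n => e.1 = e.2).card = n := by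
    have : (Finset.univ.filter fun e : Fin n × Fin n => e.1 = e.2) = Finset.univ.image (fun v => (v, v)) := by
      ext ⟨a, b⟩; simp [eq_comm]
    rw [this, Finset.card_image_of_injective _ (fun a b h => (Prod.ext_iff.1 h).1)]
    simp
  have h3 : (Finset.univ.filter fun e : Fin n × Fin n => r e.1 e.2) =
     ((Finset.univ.filter fun e : Fin n × Fin n => e.2 < e.1 ∧ r e.1 e.2) ∪
      (Finset.univ.filter fun e : Fin n × Fin n => e.1 < e.2 ∧ r e.1 e.2)) ∪
      (Finset.univ.filter fun e : Fin n × Fin n => e.1 = e.2) := by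
    ext ⟨v, u⟩
    simp only [Finset.mem_filter, Finset.mem_univ, true_and, Finset.mem_union]
    constructor
    · intro h
      rcases lt_trichotomy v u with h' | h' | h' <;> simp [h, h']
    · rintro ((h | h) | h)
      · exact h.2
      · exact h.2
      · rw [h]; exact hrefl u
  rw [h3, Finset.card_union_of_disjoint, Finset.card_union_of_disjoint, h1, h2]
  · ring
  · rw [Finset.disjoint_left]; rintro ⟨v, u⟩; simp; intro h _ h'; exact absurd h h'.not_gt
  · rw [Finset.disjoint_left]; rintro ⟨v, u⟩; simp; rintro (⟨h, _⟩ | ⟨h, _⟩)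
    · exact h.ne'
    · exact h.ne

lemma sum_sq_classes {n : ℕ} {κ : Type*} [Fintype κ] [DecidableEq κ] (c : Fin n → κ) :
    (Finset.univ.filter fun e : Fin n × Fin n => c e.1 = c e.2).card =
      ∑ a, (Finset.univ.filter fun v => c v = a).card ^ 2 := by
  rw [Finset.card_eq_sum_card_fiberwise (f := fun e => c e.1) (t := Finset.univ) (by simp)]
  refine Finset.sum_congr rfl fun a _ => ?_
  rw [sq, ← Finset.card_product]
  congr 1
  ext ⟨v, u⟩
  simp
  constructor
  · rintro ⟨h1, h2⟩; exact ⟨h2, h1 ▸ h2⟩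
  · rintro ⟨h1, h2⟩; exact ⟨h1.trans h2.symm, h1⟩

lemma mono_card {n : ℕ} {κ : Type*} [Fintype κ] [DecidableEq κ] (c : Fin n → κ) :
    2 * (mono c).card + n = ∑ a, (Finset.univ.filter fun v => c v = a).card ^ 2 := by
  rw [← sum_sq_classes]
  exact pairs_symm (fun v u => c v = c u) (fun _ _ h => h.symm) (fun _ => rfl)

/-- first moment bound -/
lemma first_moment {n k : ℕ} (hk : 0 < k) (hkn : k ≤ n) :
    Pr n (fun G => G.Colorable k) ≤ (k : ℝ) ^ n / k.factorial * (2:ℝ) ^ (-(((n:ℝ) ^ 2 / k - n) / 2)) := by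
  classical
  rw [Pr_eq']
  have hM : (0 : ℝ) < Fintype.card (Mat n) := by
    have : 0 < Fintype.card (Mat n) := Fintype.card_pos
    exact_mod_cast this
  have hf : (0 : ℝ) < k.factorial := by positivity
  rw [div_le_iff₀ hM]
  -- double counting
  set S := Finset.univ.filter fun x : Mat n => (gr x).Colorable k
  let good : Mat n → (Fin n → Fin k) → Prop := fun x c => ∀ e ∈ mono c, x e.1 e.2 = false
  have key : (S.card : ℝ) * k.factorial ≤ ∑ x : Mat n, ((Finset.univ.filter fun c => good x c).card : ℝ) := by
    have : (S.card : ℝ) * k.factorial ≤ ∑ x ∈ S, ((Finset.univ.filter fun c => good x c).card : ℝ) := by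
      rw [← nsmul_eq_mul]
      refine Finset.card_nsmul_le_sum _ _ _ fun x hx => ?_
      have hcol : (gr x).Colorable k := by simpa [S] using hx
      -- surjective colouring
      obtain ⟨c, hc, hs⟩ : ∃ c : Fin n → Fin k, good x c ∧ Function.Surjective c := by
        obtain ⟨C⟩ := hcol
        have hne : (Finset.univ.filter fun c : Fin n → Fin k => good x c).Nonempty :=
          ⟨C, by
            simp only [Finset.mem_filter, Finset.mem_univ, true_and]
            exact (proper_iff _ x).1 fun v u h => C.valid h⟩
        obtain ⟨c, hc, hmax⟩ := Finset.exists_max_image _ (fun c : Fin n → Fin k => (Finset.univ.image c).card) hne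
        simp only [Finset.mem_filter, Finset.mem_univ, true_and] at hc hmax
        refine ⟨c, hc, ?_⟩
        by_contra hns
        have hns' := hns
        rw [Function.Surjective] at hns'
        push Not at hns'
        obtain ⟨b, hb⟩ := hns'
        have hni : ¬ Function.Injective c := by
          intro hinj
          have := Fintype.card_le_of_injective c hinj
          simp only [Fintype.card_fin] at this
          have hcard : n = k := le_antisymm this hkn
          subst hcard
          exact hns (Finite.injective_iff_surjective.1 hinj)
        rw [Function.Injective] at hni
        push Not at hni
        obtain ⟨v, u, hvu, hne'⟩ := hni
        have hgood : good x (Function.update c v b) := by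
          replace hc := (proper_iff c x).2 hc
          refine (proper_iff _ x).1 ?_
          intro y z hyz
          have hyz' := hyz.ne
          by_cases h1 : y = v
          · subst h1
            rw [Function.update_self, Function.update_of_ne hyz'.symm]
            exact (hb z).symm
          · by_cases h2 : z = v
            · subst h2
              rw [Function.update_self, Function.update_of_ne h1]
              exact hb y
            · rw [Function.update_of_ne h1, Function.update_of_ne h2]
              exact hc y z hyz
        have h1 := hmax _ hgood
        have h2 : insert b (Finset.univ.image c) ⊆ Finset.univ.image (Function.update c v b) := by
          intro d hd
          rw [Finset.mem_insert] at hd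
          rcases hd with rfl | hd
          · exact Finset.mem_image.2 ⟨v, Finset.mem_univ _, Function.update_self ..⟩
          · obtain ⟨w, -, rfl⟩ := Finset.mem_image.1 hd
            by_cases hw : w = v
            · exact Finset.mem_image.2 ⟨u, Finset.mem_univ _, by
                rw [Function.update_of_ne hne'.symm, hw, hvu]⟩
            · exact Finset.mem_image.2 ⟨w, Finset.mem_univ _, Function.update_of_ne hw ..⟩
        have h3 := Finset.card_le_card h2
        rw [Finset.card_insert_of_notMem (by simp [hb])] at h3
        omega
      have : (k.factorial : ℝ) = ((Finset.univ : Finset (Equiv.Perm (Fin k))).card : ℝ) := by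
        rw [Finset.card_univ, Fintype.card_perm, Fintype.card_fin]
      rw [this]
      norm_cast
      refine Finset.card_le_card_of_injOn (fun p => p ∘ c) ?_ ?_
      · intro p _
        simp only [Finset.coe_filter, Finset.mem_univ, true_and, Set.mem_ofPred_eq]
        intro e he
        apply hc
        simpa [mono] using he
      · intro p _ q _ hpq
        ext a
        obtain ⟨v, rfl⟩ := hs a
        exact congrArg Fin.val (congrFun hpq v)
    exact this.trans (Finset.sum_le_sum_of_subset_of_nonneg (Finset.subset_univ _) (fun _ _ _ => by positivity))
  have swap : ∑ x : Mat n, ((Finset.univ.filter fun c => good x c).card : ℝ) =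
      ∑ c : Fin n → Fin k, ((Finset.univ.filter fun x => good x c).card : ℝ) := by
    norm_cast
    simp only [Finset.card_filter]
    rw [Finset.sum_comm]
  have each : ∀ c : Fin n → Fin k, ((Finset.univ.filter fun x => good x c).card : ℝ) ≤
      Fintype.card (Mat n) * (2:ℝ) ^ (-(((n:ℝ) ^ 2 / k - n) / 2)) := by
    intro c
    have h1 := count_avoid (mono c)
    have h2 : ((n:ℝ) ^ 2 / k - n) / 2 ≤ ((mono c).card : ℝ) := by
      have h3 := mono_card c
      have h4 : ((∑ a, ((Finset.univ.filter fun v => c v = a).card : ℝ))) ^ 2 ≤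
        k * ∑ a, ((Finset.univ.filter fun v => c v = a).card : ℝ) ^ 2 := by
        have := @sq_sum_le_card_mul_sum_sq (Fin k) ℝ _ _ _ _ Finset.univ (fun a => ((Finset.univ.filter fun v => c v = a).card : ℝ))
        simpa using this
      have h5 : (∑ a, ((Finset.univ.filter fun v => c v = a).card : ℝ)) = n := by
        norm_cast
        rw [← Finset.card_eq_sum_card_fiberwise (by simp)]
        simp
      have h6 : 2 * ((mono c).card : ℝ) + n = ∑ a, ((Finset.univ.filter fun v => c v = a).card : ℝ) ^ 2 := by
        exact_mod_cast h3
      rw [h5, ← h6] at h4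
      have : (n:ℝ)^2 / k ≤ 2 * ((mono c).card : ℝ) + n := by
        rw [div_le_iff₀ (by positivity)]; linarith
      linarith
    rw [← h1, mul_assoc, ← Real.rpow_natCast, ← Real.rpow_add (by norm_num)]
    refine le_mul_of_one_le_right (by positivity) ?_
    apply Real.one_le_rpow (by norm_num)
    linarith
  have tot := Finset.sum_le_sum (fun c (_ : c ∈ Finset.univ) => each c)
  rw [← swap] at tot
  rw [Finset.sum_const, Finset.card_univ, nsmul_eq_mul,
    show Fintype.card (Fin n → Fin k) = k ^ n by simp] at tot
  have := key.trans tot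
  rw [← le_div_iff₀ hf] at this
  refine this.trans (le_of_eq ?_)
  push_cast
  ring

end model

open Filter

section concentration

/-- average over a finite type -/
noncomputable def avg {α : Type*} [Fintype α] (F : α → ℝ) : ℝ := (∑ x, F x) / Fintype.card α

lemma avg_mono {α : Type*} [Fintype α] {F H : α → ℝ} (h : ∀ x, F x ≤ H x) : avg F ≤ avg H := by
  unfold avg
  gcongr with x
  exact h x

lemma avg_const {α : Type*} [Fintype α] [Nonempty α] (r : ℝ) : avg (fun _ : α => r) = r := by
  unfold avg
  have : (Fintype.card α : ℝ) ≠ 0 := by exact_mod_cast Fintype.card_ne_zero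
  simp [this]

lemma avg_add {α : Type*} [Fintype α] (F H : α → ℝ) : avg (fun x => F x + H x) = avg F + avg H := by
  unfold avg
  rw [Finset.sum_add_distrib, add_div]

lemma avg_mul {α : Type*} [Fintype α] (r : ℝ) (F : α → ℝ) : avg (fun x => r * F x) = r * avg F := by
  unfold avg
  rw [← Finset.mul_sum, mul_div_assoc]

lemma avg_cons {α : Type*} [Fintype α] (m : ℕ) (F : (Fin (m+1) → α) → ℝ) :
    avg F = avg (fun a : α => avg (fun x : Fin m → α => F (Fin.cons a x))) := by
  unfold avg
  rw [← (Fin.consEquiv (fun _ => α)).sum_comp]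
  rw [Fintype.sum_prod_type]
  simp only [Fintype.card_fun, Fintype.card_fin]
  rw [← Finset.sum_div, div_div]
  congr 1
  push_cast
  ring

lemma hoeff1 {α : Type*} [Fintype α] [Nonempty α] (g : α → ℝ) (hg : ∀ a b, |g a - g b| ≤ 1) (t : ℝ)
    (ht : |t| ≤ 1) : avg (fun a => Real.exp (t * (g a - avg g))) ≤ Real.exp (t ^ 2) := by
  have h0 : ∀ a, |g a - avg g| ≤ 1 := by
    intro a
    rw [abs_le]
    constructor
    · have : avg g ≤ avg (fun _ : α => g a + 1) := avg_mono fun b => by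
        have := (abs_le.1 (hg b a)).2; linarith
      rw [avg_const] at this; linarith
    · have : avg (fun _ : α => g a - 1) ≤ avg g := avg_mono fun b => by
        have := (abs_le.1 (hg b a)).1; linarith
      rw [avg_const] at this; linarith
  have h1 : ∀ a, Real.exp (t * (g a - avg g)) ≤ (1 + t ^ 2) + t * (g a - avg g) := by
    intro a
    have hb : |t * (g a - avg g)| ≤ 1 := by
      rw [abs_mul]
      exact mul_le_one₀ ht (abs_nonneg _) (h0 a)
    have := (abs_le.1 (Real.abs_exp_sub_one_sub_id_le hb)).2
    have h2 : (t * (g a - avg g)) ^ 2 ≤ t ^ 2 := by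
      rw [mul_pow]
      have : (g a - avg g) ^ 2 ≤ 1 := by
        rw [← sq_abs]; exact pow_le_one₀ (abs_nonneg _) (h0 a)
      nlinarith [sq_nonneg t]
    linarith
  refine (avg_mono h1).trans ?_
  rw [avg_add, avg_const, avg_mul]
  have : avg (fun a => g a - avg g) = 0 := by
    have := avg_add g (fun _ => - avg g)
    rw [avg_const] at this
    simp only [← sub_eq_add_neg] at this
    rw [this]; ring
  rw [this, mul_zero, add_zero, add_comm]
  exact Real.add_one_le_exp _

lemma mcdiarmid {α : Type*} [Fintype α] [Nonempty α] (t : ℝ) (ht : |t| ≤ 1) (m : ℕ) :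
    ∀ F : (Fin m → α) → ℝ, (∀ x i a, |F (Function.update x i a) - F x| ≤ 1) →
    avg (fun x => Real.exp (t * (F x - avg F))) ≤ Real.exp (m * t ^ 2) := by
  induction m with
  | zero =>
    intro F _
    have : ∀ x, F x = avg F := by
      intro x
      have : F = fun _ => F x := by funext y; congr 1; exact Subsingleton.elim _ _
      conv_rhs => rw [this]
      rw [avg_const]
    have e : (fun x => Real.exp (t * (F x - avg F))) = fun _ => 1 := by
      funext x; rw [← this x]; simp
    rw [e, avg_const]; simp
  | succ m ih =>
    intro F hF
    set g : α → ℝ := fun a => avg (fun x : Fin m → α => F (Fin.cons a x)) with hg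
    have havg : avg F = avg g := avg_cons m F
    rw [avg_cons, havg]
    have hstep : ∀ a, avg (fun x : Fin m → α => Real.exp (t * (F (Fin.cons a x) - avg g))) ≤
        Real.exp (m * t ^ 2) * Real.exp (t * (g a - avg g)) := by
      intro a
      have h := ih (fun x => F (Fin.cons a x)) (by
        intro x i b
        have := hF (Fin.cons a x) i.succ b
        rwa [← Fin.cons_update] at this)
      have e : ∀ x : Fin m → α, Real.exp (t * (F (Fin.cons a x) - avg g)) =
          Real.exp (t * (g a - avg g)) * Real.exp (t * (F (Fin.cons a x) - g a)) := by
        intro x; rw [← Real.exp_add]; congr 1; ring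
      simp_rw [e]
      rw [avg_mul, mul_comm]
      gcongr
    refine (avg_mono hstep).trans ?_
    rw [avg_mul]
    have h1 := hoeff1 g (by
      intro a b
      have e : g a - g b = avg (fun x : Fin m → α => F (Fin.cons a x) - F (Fin.cons b x)) := by
        have := avg_add (fun x : Fin m → α => F (Fin.cons a x)) (fun x => (-1) * F (Fin.cons b x))
        rw [avg_mul] at this
        simp only [hg]
        rw [show (fun x : Fin m → α => F (Fin.cons a x) - F (Fin.cons b x)) =
          (fun x => F (Fin.cons a x) + (-1) * F (Fin.cons b x)) by funext x; ring, this]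
        ring
      have hd : ∀ x : Fin m → α, |F (Fin.cons a x) - F (Fin.cons b x)| ≤ 1 := by
        intro x
        have := hF (Fin.cons b x) 0 a
        rwa [Fin.update_cons_zero] at this
      rw [e, abs_le]
      constructor
      · have : avg (fun _ : Fin m → α => (-1 : ℝ)) ≤ _ := avg_mono fun x => (abs_le.1 (hd x)).1
        rwa [avg_const] at this
      · have := avg_mono fun x => (abs_le.1 (hd x)).2
        rwa [avg_const] at this) t ht
    calc _ ≤ Real.exp (m * t ^ 2) * Real.exp (t ^ 2) := by gcongr
      _ = _ := by rw [← Real.exp_add]; congr 1; push_cast; ring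

lemma avg_indicator {α : Type*} [Fintype α] [Nonempty α] (p : α → Prop) [DecidablePred p] (H : α → ℝ) (r : ℝ)
    (hH : ∀ x, 0 ≤ H x) (hp : ∀ x, p x → r ≤ H x) :
    ((Finset.univ.filter p).card : ℝ) / Fintype.card α * r ≤ avg H := by
  unfold avg
  rw [div_mul_eq_mul_div]
  gcongr
  calc _ = ∑ x ∈ Finset.univ.filter p, r := by simp
    _ ≤ ∑ x ∈ Finset.univ.filter p, H x := Finset.sum_le_sum fun x hx => hp x (by simpa using hx)
    _ ≤ _ := Finset.sum_le_sum_of_subset_of_nonneg (Finset.subset_univ _) (fun x _ _ => hH x)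

/-- if `F = m` has probability at least `exp (-m t²)` then `F ≥ m - 4 m t` whp. -/
lemma conc {α : Type*} [Fintype α] [Nonempty α] (t : ℝ) (ht0 : 0 < t) (ht : t ≤ 1) (m : ℕ)
    (F : (Fin m → α) → ℝ) (hF : ∀ x i a, |F (Function.update x i a) - F x| ≤ 1)
    (p q : (Fin m → α) → Prop) [DecidablePred p] [DecidablePred q]
    (hp : ∀ x, p x → F x = m) (hq : ∀ x, q x → F x ≤ m - 4 * m * t)
    (hP : Real.exp (-(m * t ^ 2)) ≤ ((Finset.univ.filter p).card : ℝ) / Fintype.card (Fin m → α)) :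
    ((Finset.univ.filter q).card : ℝ) / Fintype.card (Fin m → α) ≤ Real.exp (- (m * t ^ 2)) := by
  have h1 := mcdiarmid t (by rw [abs_of_pos ht0]; exact ht) m F hF
  have h2 := mcdiarmid (-t) (by rw [abs_neg, abs_of_pos ht0]; exact ht) m F hF
  have h3 := avg_indicator p _ (Real.exp (t * (m - avg F))) (fun x => (Real.exp_pos (t * (F x - avg F))).le)
    (fun x hx => by rw [hp x hx])
  have h4 : m - avg F ≤ 2 * m * t := by
    have : Real.exp (-(m * t ^ 2)) * Real.exp (t * (m - avg F)) ≤ Real.exp (m * t ^ 2) :=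
      le_trans (by gcongr) (h3.trans h1)
    rw [← Real.exp_add, Real.exp_le_exp] at this
    by_contra hcon
    push Not at hcon
    nlinarith
  have h5 := avg_indicator q _ (Real.exp (2 * (m * t ^ 2))) (fun x => (Real.exp_pos (-t * (F x - avg F))).le)
    (fun x hx => by
      rw [Real.exp_le_exp]
      have := hq x hx
      have h6 : avg F - F x ≥ 2 * m * t := by linarith
      nlinarith)
  have h7 := h5.trans h2
  rw [← le_div_iff₀ (Real.exp_pos _), ← Real.exp_sub] at h7
  refine h7.trans (le_of_eq ?_)
  congr 1; ring

/-- max number of vertices in a `k`-colourable induced subgraph -/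
noncomputable def covered {n : ℕ} (k : ℕ) (G : SimpleGraph (Fin n)) : ℕ := by
  classical
  exact (Finset.univ.filter fun S : Finset (Fin n) =>
    ∃ c : Fin n → Fin k, ∀ v ∈ S, ∀ u ∈ S, G.Adj v u → c v ≠ c u).sup Finset.card

lemma le_covered {n k : ℕ} (G : SimpleGraph (Fin n)) (S : Finset (Fin n)) (c : Fin n → Fin k)
    (h : ∀ v ∈ S, ∀ u ∈ S, G.Adj v u → c v ≠ c u) : S.card ≤ covered k G := by
  classical
  unfold covered
  exact Finset.le_sup (f := Finset.card) (by simp; exact ⟨c, h⟩)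

lemma covered_spec {n k : ℕ} (hk : 0 < k) (G : SimpleGraph (Fin n)) : ∃ S : Finset (Fin n), S.card = covered k G ∧
    ∃ c : Fin n → Fin k, ∀ v ∈ S, ∀ u ∈ S, G.Adj v u → c v ≠ c u := by
  classical
  have hne : (Finset.univ.filter fun S : Finset (Fin n) =>
    ∃ c : Fin n → Fin k, ∀ v ∈ S, ∀ u ∈ S, G.Adj v u → c v ≠ c u).Nonempty :=
    ⟨∅, Finset.mem_filter.2 ⟨Finset.mem_univ _, fun _ => ⟨0, hk⟩, by simp⟩⟩
  obtain ⟨S, hS, h⟩ := Finset.exists_mem_eq_sup _ hne Finset.card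
  simp only [Finset.mem_filter, Finset.mem_univ, true_and] at hS
  exact ⟨S, by unfold covered; rw [h], hS⟩

lemma covered_le {n k : ℕ} (G : SimpleGraph (Fin n)) : covered k G ≤ n := by
  classical
  unfold covered
  refine Finset.sup_le fun S _ => ?_
  simpa using S.card_le_univ

lemma covered_colorable {n k : ℕ} (G : SimpleGraph (Fin n)) (h : G.Colorable k) : covered k G = n := by
  refine le_antisymm (covered_le G) ?_
  obtain ⟨C⟩ := h
  have := le_covered G Finset.univ C (fun v _ u _ h => C.valid h)
  simpa using this

lemma covered_lip1 {n k : ℕ} (hk : 0 < k) (x : Mat n) (i : Fin n) (a : Fin n → Bool) :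
    covered k (gr x) ≤ covered k (gr (Function.update x i a)) + 1 := by
  classical
  obtain ⟨S, hS, c, hc⟩ := covered_spec hk (gr x)
  have h1 : (S.erase i).card ≤ covered k (gr (Function.update x i a)) := by
    refine le_covered _ _ c fun v hv u hu hadj => ?_
    have hv' := Finset.mem_erase.1 hv
    have hu' := Finset.mem_erase.1 hu
    refine hc v hv'.2 u hu'.2 ?_
    simpa [gr, Function.update_of_ne hv'.1, Function.update_of_ne hu'.1] using hadj
  have h2 := Finset.pred_card_le_card_erase (s := S) (a := i)
  omega

lemma covered_lip {n k : ℕ} (hk : 0 < k) (x : Mat n) (i : Fin n) (a : Fin n → Bool) :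
    |(covered k (gr (Function.update x i a)) : ℝ) - covered k (gr x)| ≤ 1 := by
  have h1 := covered_lip1 hk x i a
  have h2 := covered_lip1 hk (Function.update x i a) i (x i)
  rw [Function.update_idem, Function.update_eq_self] at h2
  have h1' : (covered k (gr x) : ℝ) ≤ covered k (gr (Function.update x i a)) + 1 := by exact_mod_cast h1
  have h2' : (covered k (gr (Function.update x i a)) : ℝ) ≤ covered k (gr x) + 1 := by exact_mod_cast h2
  rw [abs_le]; constructor <;> linarith

lemma colorable_of_covered {n k : ℕ} (hk : 0 < k) (G : SimpleGraph (Fin n)) :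
    G.Colorable (k + (n - covered k G)) := by
  classical
  obtain ⟨S, hS, c, hc⟩ := covered_spec hk G
  have e : Fintype.card (Fin k ⊕ {v // v ∉ S}) = k + (n - covered k G) := by
    rw [Fintype.card_sum, Fintype.card_fin, Fintype.card_subtype_compl, ← hS]
    simp
  rw [← e]
  refine SimpleGraph.Coloring.colorable (SimpleGraph.Coloring.mk
    (fun v => if h : v ∈ S then Sum.inl (c v) else Sum.inr ⟨v, h⟩) ?_)
  intro v u hadj
  by_cases hv : v ∈ S <;> by_cases hu : u ∈ S
  · simpa [hv, hu] using hc v hv u hu hadj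
  · simp [hv, hu]
  · simp [hv, hu]
  · simpa [hv, hu] using hadj.ne

/-- boosting -/
lemma boost {n k : ℕ} (hk : 0 < k) (t : ℝ) (ht0 : 0 < t) (ht : t ≤ 1)
    (h : Real.exp (-(n * t ^ 2)) ≤ Pr n (fun G => G.Colorable k)) :
    Pr n (fun G => ¬ ((chi n G : ℝ) ≤ k + 4 * n * t)) ≤ Real.exp (-(n * t ^ 2)) := by
  classical
  rw [Pr_eq'] at h ⊢
  have key := conc t ht0 ht n (fun x => (covered k (gr x) : ℝ)) (fun x i a => covered_lip hk x i a)
    (fun x => (gr x).Colorable k) (fun x => ¬ ((chi n (gr x) : ℝ) ≤ k + 4 * n * t)) ?_ ?_ h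
  · convert key
  · intro x hx
    rw [covered_colorable _ hx]
  · intro x hx
    have h1 := colorable_of_covered hk (gr x)
    have h2 : chi n (gr x) ≤ k + (n - covered k (gr x)) := by
      have := h1.chromaticNumber_le
      unfold chi
      exact ENat.toNat_le_of_le_natCast this
    have h3 : (chi n (gr x) : ℝ) ≤ k + (n - covered k (gr x)) := by
      have := covered_le (k := k) (gr x)
      calc (chi n (gr x) : ℝ) ≤ ((k + (n - covered k (gr x)) : ℕ) : ℝ) := by exact_mod_cast h2
        _ = _ := by push_cast [this]; ring
    push Not at hx
    linarith

end concentration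

open Filter

section secondmoment

/-- overlap sizes -/
def ov {n k : ℕ} (c : Fin n → Fin k) (π : Equiv.Perm (Fin n)) (a b : Fin k) : ℕ :=
  (Finset.univ.filter fun u => c u = a ∧ c (π u) = b).card

lemma mono_perm {n k : ℕ} (c : Fin n → Fin k) (σ : Equiv.Perm (Fin n)) :
    (mono (c ∘ σ)).card = (mono c).card := by
  have h1 := mono_card (c ∘ σ)
  have h2 := mono_card c
  have h3 : ∀ a, (Finset.univ.filter fun v => (c ∘ σ) v = a).card = (Finset.univ.filter fun v => c v = a).card := by
    intro a
    refine Finset.card_equiv σ ?_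
    simp
  simp_rw [h3] at h1
  omega

lemma mono_inter {n k : ℕ} (c : Fin n → Fin k) (σ τ : Equiv.Perm (Fin n)) :
    (mono (c ∘ σ) ∩ mono (c ∘ τ)).card = ∑ a, ∑ b, (ov c (τ * σ⁻¹) a b).choose 2 := by
  have h0 : mono (c ∘ σ) ∩ mono (c ∘ τ) = mono (fun v => (c (σ v), c (τ v))) := by
    ext e
    simp [mono]
    tauto
  have h1 := mono_card (fun v => (c (σ v), c (τ v)))
  have h3 : ∀ a b, (Finset.univ.filter fun v => (c (σ v), c (τ v)) = (a, b)).card = ov c (τ * σ⁻¹) a b := by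
    intro a b
    unfold ov
    refine Finset.card_equiv σ ?_
    intro i
    rw [Finset.mem_filter, Finset.mem_filter]
    simp
  rw [Fintype.sum_prod_type] at h1
  simp_rw [h3] at h1
  have h4 : ∑ a, ∑ b, ov c (τ * σ⁻¹) a b = n := by
    simp_rw [← h3]
    rw [← Fintype.sum_prod_type (fun p : Fin k × Fin k => (Finset.univ.filter fun v => (c (σ v), c (τ v)) = p).card),
      ← Finset.card_eq_sum_card_fiberwise (by simp)]
    simp
  have h5 : ∀ m : ℕ, m ^ 2 = 2 * m.choose 2 + m := by
    intro m
    rw [Nat.choose_two_right, Nat.mul_div_cancel' (Nat.even_mul_pred_self m).two_dvd]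
    cases m with
    | zero => rfl
    | succ m => simp; ring
  simp_rw [h5, Finset.sum_add_distrib] at h1
  rw [h4, ← h0] at h1
  simp_rw [← Finset.mul_sum] at h1
  omega

lemma second_moment {n k : ℕ} (c : Fin n → Fin k) :
    (n.factorial : ℝ) ≤ Pr n (fun G => G.Colorable k) *
      ∑ π : Equiv.Perm (Fin n), (2:ℝ) ^ (∑ a, ∑ b, (ov c π a b).choose 2) := by
  classical
  rw [Pr_eq']
  set M : ℝ := (Fintype.card (Mat n) : ℝ) with hM
  have hM0 : 0 < M := by
    have : 0 < Fintype.card (Mat n) := Fintype.card_pos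
    rw [hM]; exact_mod_cast this
  set N := (mono c).card with hN
  let good : Mat n → Equiv.Perm (Fin n) → Prop := fun x σ => ∀ e ∈ mono (c ∘ σ), x e.1 e.2 = false
  let X : Mat n → ℝ := fun x => ∑ σ, if good x σ then 1 else 0
  set R : ℝ := ∑ π : Equiv.Perm (Fin n), (2:ℝ) ^ (∑ a, ∑ b, (ov c π a b).choose 2) with hR
  have cnt : ∀ E : Finset (Fin n × Fin n), (∑ x : Mat n, if (∀ e ∈ E, x e.1 e.2 = false) then (1:ℝ) else 0) = M / 2 ^ E.card := by
    intro E
    rw [eq_div_iff (by positivity), hM, ← count_avoid E]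
    simp
  have h1 : ∑ x, X x = n.factorial * (M / 2 ^ N) := by
    simp only [X]
    rw [Finset.sum_comm]
    have : ∀ σ : Equiv.Perm (Fin n), (∑ x, if good x σ then (1:ℝ) else 0) = M / 2 ^ N := by
      intro σ
      rw [hN, ← mono_perm c σ]
      exact cnt _
    simp_rw [this]
    simp [Fintype.card_perm]
  have h2 : ∑ x, X x ^ 2 = n.factorial * (M / 2 ^ (2 * N)) * R := by
    have e1 : ∀ x, X x ^ 2 = ∑ σ : Equiv.Perm (Fin n), ∑ τ : Equiv.Perm (Fin n), if (∀ e ∈ mono (c ∘ σ) ∪ mono (c ∘ τ), x e.1 e.2 = false) then (1:ℝ) else 0 := by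
      intro x
      simp only [X]
      rw [sq, Finset.sum_mul_sum]
      refine Finset.sum_congr rfl fun σ _ => Finset.sum_congr rfl fun τ _ => ?_
      rw [ite_zero_mul_ite_zero, one_mul]
      congr 1
      simp only [good, Finset.mem_union, eq_iff_iff]
      constructor
      · rintro ⟨h1, h2⟩ e (he | he)
        · exact h1 e he
        · exact h2 e he
      · intro h
        exact ⟨fun e he => h e (Or.inl he), fun e he => h e (Or.inr he)⟩
    simp_rw [e1]
    rw [Finset.sum_comm]
    have e2 : ∀ σ : Equiv.Perm (Fin n), ∑ x : Mat n, ∑ τ : Equiv.Perm (Fin n),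
        (if (∀ e ∈ mono (c ∘ σ) ∪ mono (c ∘ τ), x e.1 e.2 = false) then (1:ℝ) else 0) = (M / 2 ^ (2 * N)) * R := by
      intro σ
      rw [Finset.sum_comm, hR, Finset.mul_sum]
      rw [← Equiv.sum_comp (Equiv.mulRight σ⁻¹) (fun π : Equiv.Perm (Fin n) => M / 2 ^ (2 * N) * (2:ℝ) ^ (∑ a, ∑ b, (ov c π a b).choose 2))]
      refine Finset.sum_congr rfl fun τ _ => ?_
      rw [cnt, Equiv.coe_mulRight, ← mono_inter]
      have := Finset.card_union_add_card_inter (mono (c ∘ σ)) (mono (c ∘ τ))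
      rw [mono_perm, mono_perm] at this
      have h : (2:ℝ) ^ (2 * N) = 2 ^ (mono (c ∘ σ) ∪ mono (c ∘ τ)).card * 2 ^ (mono (c ∘ σ) ∩ mono (c ∘ τ)).card := by
        rw [← pow_add, this]; congr 1; ring
      rw [h]
      field_simp
    simp_rw [e2]
    simp [Fintype.card_perm]
    ring
  have h3 : (∑ x, X x) ^ 2 ≤ ((Finset.univ.filter fun x : Mat n => (gr x).Colorable k).card : ℝ) * ∑ x, X x ^ 2 := by
    have e : ∑ x, X x = ∑ x ∈ Finset.univ.filter (fun x : Mat n => (gr x).Colorable k), X x := by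
      symm
      refine Finset.sum_subset (Finset.subset_univ _) fun x _ hx => ?_
      simp only [X]
      refine Finset.sum_eq_zero fun σ _ => ?_
      rw [if_neg]
      intro hg
      apply hx
      simp only [Finset.mem_filter, Finset.mem_univ, true_and]
      exact ⟨SimpleGraph.Coloring.mk (c ∘ σ) (fun {v u} h => (proper_iff (c ∘ σ) x).2 hg v u h)⟩
    rw [e]
    refine (sq_sum_le_card_mul_sum_sq).trans ?_
    gcongr
    · exact Finset.subset_univ _
  rw [h1, h2] at h3
  have hf : (0:ℝ) < n.factorial := by positivity
  rw [div_mul_eq_mul_div, le_div_iff₀ hM0]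
  set Cc : ℝ := ((Finset.univ.filter fun x : Mat n => (gr x).Colorable k).card : ℝ)
  have e3 : (2:ℝ) ^ (2 * N) = (2 ^ N) ^ 2 := by rw [mul_comm, pow_mul]
  rw [e3] at h3
  have hp : (0:ℝ) < 2 ^ N := by positivity
  have h4 : (n.factorial * M) * (n.factorial * M / (2 ^ N) ^ 2) ≤ (Cc * R) * (n.factorial * M / (2 ^ N) ^ 2) := by
    calc _ = (n.factorial * (M / 2 ^ N)) ^ 2 := by field_simp
      _ ≤ _ := h3
      _ = _ := by ring
  exact le_of_mul_le_mul_right h4 (by positivity)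

end secondmoment

open Filter

section overlap

lemma perm_count {n : ℕ} (S : Finset (Fin n × Fin n)) (π₀ : Equiv.Perm (Fin n))
    (h₀ : ∀ e ∈ S, π₀ e.1 = e.2) :
    S.card ≤ n ∧ (Finset.univ.filter fun π : Equiv.Perm (Fin n) => ∀ e ∈ S, π e.1 = e.2).card
      ≤ (n - S.card).factorial := by
  classical
  set U := S.image Prod.fst with hU
  have hUc : U.card = S.card := by
    apply Finset.card_image_of_injOn
    intro x hx y hy hxy
    have h1 := h₀ x hx
    have h2 := h₀ y hy
    refine Prod.ext hxy ?_
    rw [← h1, ← h2, hxy]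
  constructor
  · rw [← hUc]
    simpa using Finset.card_le_univ U
  · have e1 : Fintype.card {f : Equiv.Perm (Fin n) // ∀ a, ¬ (a ∉ U) → f a = a} = (n - S.card).factorial := by
      rw [← Fintype.card_congr (Equiv.Perm.subtypeEquivSubtypePerm (fun a => a ∉ U)), Fintype.card_perm]
      congr 1
      rw [Fintype.card_subtype_compl]
      simp [hUc]
    rw [← e1, ← Fintype.card_coe]
    refine Fintype.card_le_of_injective (fun π => ⟨π₀⁻¹ * π.1, ?_⟩) ?_
    · intro a ha
      push Not at ha
      rw [hU, Finset.mem_image] at ha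
      obtain ⟨e, he, rfl⟩ := ha
      have h1 := h₀ e he
      have h2 := (Finset.mem_filter.1 π.2).2 e he
      rw [Equiv.Perm.mul_apply, h2, ← h1]
      simp
    · intro x y h
      simp only [Subtype.mk.injEq, mul_right_inj] at h
      exact Subtype.ext h

lemma fact_upper (m : ℕ) (hm : 0 < m) : (m.factorial : ℝ) ≤ Real.exp 1 * m * (m / Real.exp 1) ^ m := by
  induction m, hm using Nat.le_induction with
  | base => simp
  | succ m hm ih =>
    have hm0 : (0:ℝ) < m := by exact_mod_cast hm
    rw [Nat.factorial_succ]
    push_cast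
    have key : Real.exp 1 * (m:ℝ) ^ (m+1) ≤ (m+1:ℝ) ^ (m+1) := by
      have h1 : Real.exp (1/(m+1)) ≤ (m+1)/m := by
        have := Real.add_one_le_exp (-(1/((m:ℝ)+1)))
        have h2 : -(1/((m:ℝ)+1)) + 1 = m/(m+1) := by field_simp; ring
        rw [h2, Real.exp_neg] at this
        rw [le_div_iff₀ hm0]
        rw [div_le_iff₀ (by positivity)] at this
        have hp := Real.exp_pos (1/((m:ℝ)+1))
        calc _ ≤ Real.exp (1/((m:ℝ)+1)) * ((Real.exp (1/((m:ℝ)+1)))⁻¹ * (m+1)) := by gcongr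
          _ = _ := by field_simp
      have h3 : Real.exp 1 ≤ ((m+1)/m : ℝ)^(m+1) := by
        calc Real.exp 1 = Real.exp (1/(m+1)) ^ (m+1) := by
              rw [← Real.exp_nat_mul]; congr 1; push_cast; field_simp
          _ ≤ _ := by gcongr
      rw [div_pow, le_div_iff₀ (by positivity)] at h3
      exact h3
    calc ((m:ℝ)+1) * m.factorial ≤ (m+1) * (Real.exp 1 * m * (m / Real.exp 1) ^ m) := by gcongr
      _ = (m+1) * (Real.exp 1 * m^(m+1)) / Real.exp 1 ^ m := by
          rw [div_pow]; field_simp; ring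
      _ ≤ (m+1) * ((m+1)^(m+1)) / Real.exp 1 ^ m := by gcongr
      _ = _ := by
          rw [div_pow]; field_simp; ring

lemma fact_lower (m : ℕ) : ((m:ℝ) / Real.exp 1) ^ m ≤ m.factorial := by
  have h := Real.pow_div_factorial_le_exp (m:ℝ) (by positivity) m
  rw [div_le_iff₀ (by positivity)] at h
  rw [div_pow, div_le_iff₀ (by positivity), ← Real.exp_nat_mul, mul_one, mul_comm]
  exact h

lemma fact_ratio (n M : ℕ) (hn : 0 < n) (hM : M ≤ n) :
    ((n - M).factorial : ℝ) ≤ n.factorial * (Real.exp 1 * n) * (1 / (n:ℝ)) ^ M * Real.exp ((M:ℝ)^2/n) := by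
  have hn0 : (0:ℝ) < n := by exact_mod_cast hn
  have hn1 : (1:ℝ) ≤ n := by exact_mod_cast hn
  obtain ⟨m, rfl⟩ : ∃ m, n = m + M := ⟨n - M, by omega⟩
  rw [Nat.add_sub_cancel]
  set N : ℝ := ((m + M : ℕ):ℝ) with hN
  have hlow := fact_lower (m + M)
  rw [← hN] at hlow
  have hup : (m.factorial : ℝ) ≤ Real.exp 1 * N * (m / Real.exp 1) ^ m := by
    rcases Nat.eq_zero_or_pos m with h | h
    · subst h
      have := Real.add_one_le_exp (1:ℝ)
      simp only [Nat.factorial_zero, Nat.cast_one, pow_zero, mul_one]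
      nlinarith
    · refine (fact_upper m h).trans ?_
      gcongr
      rw [hN]; push_cast; linarith [Nat.cast_nonneg (α := ℝ) M]
  refine hup.trans ?_
  have hmN : (m:ℝ) = N - M := by rw [hN]; push_cast; ring
  -- m^m ≤ N^m exp (m(m/N-1))
  have h1 : (m:ℝ)^m ≤ N^m * Real.exp (-(m * (M/N))) := by
    have h2 : (m:ℝ)/N ≤ Real.exp (-(M/N)) := by
      have := Real.add_one_le_exp (-((M:ℝ)/N))
      refine le_trans (le_of_eq ?_) this
      rw [hmN]; field_simp; ring
    calc (m:ℝ)^m = N^m * ((m:ℝ)/N)^m := by rw [div_pow]; field_simp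
      _ ≤ N^m * (Real.exp (-(M/N)))^m := by gcongr
      _ = _ := by rw [← Real.exp_nat_mul]; congr 2; ring
  calc Real.exp 1 * N * (m / Real.exp 1) ^ m 
      = Real.exp 1 * N * (m^m / Real.exp m) := by rw [div_pow, ← Real.exp_nat_mul, mul_one]
    _ ≤ Real.exp 1 * N * ((N^m * Real.exp (-(m * (M/N)))) / Real.exp m) := by gcongr
    _ = (N / Real.exp 1)^(m+M) * (Real.exp 1 * N) * (1/N)^M * Real.exp ((M:ℝ)^2/N) := by
        have e1 : Real.exp (-(m * (M/N))) / Real.exp m = Real.exp ((M:ℝ)^2/N) / Real.exp 1 ^ (m+M) := by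
          rw [← Real.exp_nat_mul, ← Real.exp_sub, ← Real.exp_sub]
          congr 1
          push_cast
          rw [hmN]; field_simp; ring
        rw [mul_div_assoc, e1, div_pow, pow_add N, div_pow 1 N, one_pow]
        field_simp
    _ ≤ _ := by gcongr

variable {n k : ℕ}

def cls (c : Fin n → Fin k) (a : Fin k) : Finset (Fin n) := Finset.univ.filter fun u => c u = a

open Classical in
noncomputable def Fam (c : Fin n → Fin k) (i : Fin k × Fin k) (o : ℕ) : Finset (Finset (Fin n × Fin n)) :=
  ((Finset.powersetCard o (cls c i.1)).sigma (fun U => (Finset.univ : Finset (U ↪ cls c i.2)))).image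
    (fun x => (Finset.univ : Finset x.1).image (fun u => (u.1, (x.2 u).1)))

lemma Fam_card (c : Fin n → Fin k) (i : Fin k × Fin k) (o : ℕ) :
    (Fam c i o).card ≤ (cls c i.1).card.choose o * (cls c i.2).card.descFactorial o := by
  classical
  refine Finset.card_image_le.trans ?_
  rw [Finset.card_sigma, Finset.sum_const_nat (m := (cls c i.2).card.descFactorial o)]
  · rw [Finset.card_powersetCard]
  · intro U hU
    rw [Finset.card_univ, Fintype.card_embedding_eq]
    simp [(Finset.mem_powersetCard.1 hU).2]

lemma Fam_mem (c : Fin n → Fin k) (i : Fin k × Fin k) (o : ℕ) (P) (hP : P ∈ Fam c i o) :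
    P.card = o ∧ ∀ e ∈ P, c e.1 = i.1 ∧ c e.2 = i.2 := by
  classical
  obtain ⟨⟨U, g⟩, hx, rfl⟩ := Finset.mem_image.1 hP
  rw [Finset.mem_sigma, Finset.mem_powersetCard] at hx
  constructor
  · rw [Finset.card_image_of_injective]
    · simpa using hx.1.2
    · intro u v h
      exact Subtype.ext (Prod.mk.inj h).1
  · intro e he
    obtain ⟨u, _, rfl⟩ := Finset.mem_image.1 he
    have h1 := hx.1.1 u.2
    have h2 := (g u).2
    simp only [cls, Finset.mem_filter, Finset.mem_univ, true_and] at h1 h2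
    exact ⟨h1, h2⟩

open Classical in
noncomputable def pset (c : Fin n → Fin k) (π : Equiv.Perm (Fin n)) (i : Fin k × Fin k) : Finset (Fin n × Fin n) :=
  (Finset.univ.filter fun u => c u = i.1 ∧ c (π u) = i.2).image (fun u => (u, π u))

lemma pset_mem (c : Fin n → Fin k) (π : Equiv.Perm (Fin n)) (i : Fin k × Fin k) :
    pset c π i ∈ Fam c i (ov c π i.1 i.2) := by
  classical
  refine Finset.mem_image.2 ⟨⟨Finset.univ.filter fun u => c u = i.1 ∧ c (π u) = i.2,
    ⟨fun u => ⟨π u.1, ?_⟩, ?_⟩⟩, ?_, ?_⟩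
  · exact Finset.mem_filter.2 ⟨Finset.mem_univ _, (Finset.mem_filter.1 u.2).2.2⟩
  · intro u v h
    exact Subtype.ext (π.injective (Subtype.mk.inj h))
  · refine Finset.mem_sigma.2 ⟨Finset.mem_powersetCard.2 ⟨?_, rfl⟩, Finset.mem_univ _⟩
    intro u hu
    exact Finset.mem_filter.2 ⟨Finset.mem_univ _, (Finset.mem_filter.1 hu).2.1⟩
  · ext e
    unfold pset
    rw [Finset.mem_image, Finset.mem_image]
    constructor
    · rintro ⟨u, _, rfl⟩; exact ⟨u.1, u.2, rfl⟩
    · rintro ⟨u, hu, rfl⟩; exact ⟨⟨u, hu⟩, Finset.mem_univ _, rfl⟩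

def Allowed (T J : ℕ) (q : Fin k → Option (Fin k)) (i : Fin k × Fin k) : Finset ℕ :=
  if q i.1 = some i.2 then Finset.Icc T J else insert 0 (Finset.Ico 2 T)

noncomputable def Wt (c : Fin n → Fin k) (T J : ℕ) (q : Fin k → Option (Fin k)) (i : Fin k × Fin k) : ℝ :=
  ∑ o ∈ Allowed T J q i, ((cls c i.1).card.choose o : ℝ) * ((cls c i.2).card.descFactorial o : ℝ) *
    (2 ^ (o.choose 2) * (if q i.1 = some i.2 then 1 / (n:ℝ) else Real.exp 2 / n) ^ o)

def ell (q : Fin k → Option (Fin k)) : ℕ := (Finset.univ.filter fun a => q a ≠ none).card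

lemma exp_split (n M Mn Mr x : ℝ) (hn0 : 0 < n) (h1 : M = Mn + Mr) (h2 : Mn ≤ x) (h3 : M ≤ n) (h4 : 0 ≤ Mn)
    (h5 : 0 ≤ Mr) : M^2/n ≤ x^2/n + Mr * 2 := by
  have h6 : M^2 ≤ x^2 + 2 * n * Mr := by
    have : Mn^2 ≤ x^2 := by gcongr
    have h7 : Mr * M ≤ Mr * n := by gcongr
    nlinarith [mul_nonneg h5 h5, mul_nonneg h4 h5]
  calc M^2/n ≤ (x^2 + 2 * n * Mr)/n := by gcongr
    _ = _ := by field_simp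

set_option maxHeartbeats 800000 in
lemma overlap_q (c : Fin n → Fin k) (hn : 0 < n) (T J : ℕ) (q : Fin k → Option (Fin k)) :
    ∑ π ∈ (Finset.univ.filter fun π : Equiv.Perm (Fin n) => ∀ i : Fin k × Fin k, 
        ∃ o ∈ Allowed T J q i, o = ov c π i.1 i.2 ∨ (o = 0 ∧ ov c π i.1 i.2 = 1)),
        (2:ℝ) ^ (∑ a, ∑ b, (ov c π a b).choose 2)
      ≤ n.factorial * (Real.exp 1 * n) * (Real.exp ((ell q * J : ℝ)^2/n) * ∏ i, Wt c T J q i) := by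
  classical
  set S := (Finset.univ.filter fun π : Equiv.Perm (Fin n) => ∀ i : Fin k × Fin k, 
        ∃ o ∈ Allowed T J q i, o = ov c π i.1 i.2 ∨ (o = 0 ∧ ov c π i.1 i.2 = 1)) with hS
  let near : Fin k × Fin k → Prop := fun i => q i.1 = some i.2
  let p : Equiv.Perm (Fin n) → Fin k × Fin k → Finset (Fin n × Fin n) := fun π i =>
    if ov c π i.1 i.2 = 1 ∧ 0 ∈ Allowed T J q i then ∅ else pset c π i
  let PP : Fin k × Fin k → Finset (Finset (Fin n × Fin n)) := fun i =>
    (Allowed T J q i).biUnion (Fam c i)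
  have hempty : ∀ i, ∅ ∈ Fam c i 0 := by
    intro i
    have : IsEmpty (↥(∅ : Finset (Fin n))) := ⟨fun u => Finset.notMem_empty u.1 u.2⟩
    refine Finset.mem_image.2 ⟨⟨∅, Function.Embedding.ofIsEmpty⟩, ?_, ?_⟩
    · exact Finset.mem_sigma.2 ⟨by simp, Finset.mem_univ _⟩
    · rw [Finset.image_eq_empty]
      exact Finset.univ_eq_empty
  have hp1 : ∀ π ∈ S, ∀ i, p π i ∈ PP i := by
    intro π hπ i
    obtain ⟨o, ho, h⟩ := (Finset.mem_filter.1 hπ).2 i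
    simp only [PP, Finset.mem_biUnion, p]
    split_ifs with hc
    · exact ⟨0, hc.2, hempty i⟩
    · rcases h with h | ⟨h0, h1⟩
      · exact ⟨o, ho, h ▸ pset_mem c π i⟩
      · subst h0; exact absurd ⟨h1, ho⟩ hc
  have hp2 : ∀ π i, (p π i).card.choose 2 = (ov c π i.1 i.2).choose 2 := by
    intro π i
    simp only [p]
    split_ifs with hc
    · simp [hc.1]
    · rw [(Fam_mem c i _ _ (pset_mem c π i)).1]
  have hp3 : ∀ π i, ∀ e ∈ p π i, π e.1 = e.2 := by
    intro π i e he
    simp only [p] at he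
    split_ifs at he with hc
    · simp at he
    · simp only [pset, Finset.mem_image] at he
      obtain ⟨u, _, rfl⟩ := he
      rfl
  have hPP : ∀ i, ∀ P ∈ PP i, ∀ e ∈ P, c e.1 = i.1 ∧ c e.2 = i.2 := by
    intro i P hP
    obtain ⟨o, _, h⟩ := Finset.mem_biUnion.1 hP
    exact (Fam_mem c i o P h).2
  have hPPJ : ∀ i, near i → ∀ P ∈ PP i, P.card ≤ J := by
    intro i hi P hP
    obtain ⟨o, ho, h⟩ := Finset.mem_biUnion.1 hP
    rw [(Fam_mem c i o P h).1]
    simp only [Allowed] at ho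
    rw [if_pos hi] at ho
    exact (Finset.mem_Icc.1 ho).2
  have hnear : (Finset.univ.filter near).card ≤ ell q := by
    unfold ell
    refine Finset.card_le_card_of_injOn Prod.fst ?_ ?_
    · intro i hi
      simp only [near, Finset.coe_filter, Set.mem_ofPred_eq, Finset.mem_univ, true_and] at hi ⊢
      rw [hi]; simp
    · intro i hi j hj hij
      simp only [near, Finset.coe_filter, Set.mem_ofPred_eq, Finset.mem_univ, true_and] at hi hj
      refine Prod.ext hij ?_
      rw [hij, hj] at hi
      exact (Option.some.inj hi).symm
  let g : (Fin k × Fin k → Finset (Fin n × Fin n)) → ℝ := fun P => ∏ i, (2:ℝ) ^ ((P i).card.choose 2)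
  let w : Fin k × Fin k → ℕ → ℝ := fun i o => 
    (2 ^ (o.choose 2) * (if q i.1 = some i.2 then 1 / (n:ℝ) else Real.exp 2 / n) ^ o)
  have hn0 : (0:ℝ) < n := by exact_mod_cast hn
  set E : ℝ := Real.exp ((ell q * J : ℝ)^2/n) with hE
  have step1 : ∑ π ∈ S, (2:ℝ) ^ (∑ a, ∑ b, (ov c π a b).choose 2) = ∑ π ∈ S, g (p π) := by
    refine Finset.sum_congr rfl fun π _ => ?_
    simp only [g]
    rw [Finset.prod_pow_eq_pow_sum, Fintype.sum_prod_type]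
    simp_rw [hp2]
  have step2 : ∑ π ∈ S, g (p π) = ∑ P ∈ Fintype.piFinset PP, ∑ π ∈ S.filter (fun π => p π = P), g P := by
    rw [← Finset.sum_fiberwise_of_maps_to (s := S) (t := Fintype.piFinset PP) (g := p)]
    · refine Finset.sum_congr rfl fun P _ => Finset.sum_congr rfl fun π hπ => ?_
      rw [(Finset.mem_filter.1 hπ).2]
    · intro π hπ
      exact Fintype.mem_piFinset.2 (hp1 π hπ)
  have step3 : ∀ P ∈ Fintype.piFinset PP, ∑ π ∈ S.filter (fun π => p π = P), g P ≤
      n.factorial * (Real.exp 1 * n) * (E * ∏ i, w i (P i).card) := by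
    intro P hP
    rw [Fintype.mem_piFinset] at hP
    have hw0 : 0 ≤ ∏ i, w i (P i).card := by
      refine Finset.prod_nonneg fun i _ => ?_
      simp only [w]
      split_ifs <;> positivity
    rcases (S.filter (fun π => p π = P)).eq_empty_or_nonempty with h | ⟨π₀, hπ₀⟩
    · rw [h, Finset.sum_empty]
      positivity
    · have hP0 : p π₀ = P := (Finset.mem_filter.1 hπ₀).2
      set B := Finset.univ.biUnion P with hB
      have hBc : B.card = ∑ i, (P i).card := by
        rw [hB, Finset.card_biUnion]
        intro i _ j _ hij
        refine Finset.disjoint_left.2 ?_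
        intro e he he'
        have h1 := hPP i _ (hP i) e he
        have h2 := hPP j _ (hP j) e he'
        exact hij (Prod.ext (h1.1.symm.trans h2.1) (h1.2.symm.trans h2.2))
      have hB0 : ∀ π, p π = P → ∀ e ∈ B, π e.1 = e.2 := by
        intro π hπ e he
        obtain ⟨i, _, hi⟩ := Finset.mem_biUnion.1 he
        rw [← hπ] at hi
        exact hp3 π i e hi
      obtain ⟨hMn, hcount⟩ := perm_count B π₀ (hB0 π₀ hP0)
      have hc2 : (S.filter (fun π => p π = P)).card ≤ (n - B.card).factorial := by
        refine le_trans (Finset.card_le_card ?_) hcount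
        intro π hπ
        exact Finset.mem_filter.2 ⟨Finset.mem_univ _, hB0 π (Finset.mem_filter.1 hπ).2⟩
      rw [Finset.sum_const, nsmul_eq_mul]
      have hr := fact_ratio n B.card hn hMn
      set M := B.card with hM
      set Mn := ∑ i ∈ Finset.univ.filter near, (P i).card with hMnear
      set Mr := ∑ i ∈ Finset.univ.filter (fun i => ¬ near i), (P i).card with hMrest
      have hsplit : Mn + Mr = M := by
        rw [hBc, hMnear, hMrest, Finset.sum_filter_add_sum_filter_not]
      have hMnJ : Mn ≤ ell q * J := by
        calc Mn ≤ (Finset.univ.filter near).card • J := by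
              refine Finset.sum_le_card_nsmul _ _ _ fun i hi => ?_
              exact hPPJ i (Finset.mem_filter.1 hi).2 _ (hP i)
          _ ≤ _ := by
              rw [smul_eq_mul]; gcongr
      clear_value M Mn Mr
      have hexp : Real.exp ((M:ℝ)^2/n) ≤ E * Real.exp 2 ^ Mr := by
        rw [hE, ← Real.exp_nat_mul, ← Real.exp_add]
        apply Real.exp_le_exp.2
        have h1 : (M:ℝ) = Mn + Mr := by exact_mod_cast hsplit.symm
        have h2 : (Mn:ℝ) ≤ ell q * J := by exact_mod_cast hMnJ
        have h3 : (M:ℝ) ≤ n := by exact_mod_cast hMn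
        have h4 : (0:ℝ) ≤ Mn := by positivity
        have h5 : (0:ℝ) ≤ Mr := by positivity
        exact exp_split _ _ _ _ _ hn0 h1 h2 h3 h4 h5
      have hprod : ∏ i, w i (P i).card = g P * ((1/(n:ℝ))^M * Real.exp 2 ^ Mr) := by
        simp only [w, g]
        rw [Finset.prod_mul_distrib]
        congr 1
        rw [← Finset.prod_filter_mul_prod_filter_not Finset.univ near]
        have e1 : ∏ i ∈ Finset.univ.filter near, (if q i.1 = some i.2 then 1 / (n:ℝ) else Real.exp 2 / n) ^ (P i).card = (1/(n:ℝ))^Mn := by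
          rw [hMnear, ← Finset.prod_pow_eq_pow_sum]
          refine Finset.prod_congr rfl fun i hi => ?_
          rw [if_pos (Finset.mem_filter.1 hi).2]
        have e2 : ∏ i ∈ Finset.univ.filter (fun i => ¬ near i), (if q i.1 = some i.2 then 1 / (n:ℝ) else Real.exp 2 / n) ^ (P i).card = (Real.exp 2/(n:ℝ))^Mr := by
          rw [hMrest, ← Finset.prod_pow_eq_pow_sum]
          refine Finset.prod_congr rfl fun i hi => ?_
          rw [if_neg (Finset.mem_filter.1 hi).2]
        rw [e1, e2, ← hsplit, pow_add, div_pow (Real.exp 2)]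
        rw [div_pow 1 (n:ℝ) Mr, one_pow]
        ring
      have hg0 : 0 ≤ g P := Finset.prod_nonneg fun i _ => by positivity
      rw [hprod]
      calc _ ≤ ((n - M).factorial : ℝ) * g P := by gcongr
        _ ≤ (n.factorial * (Real.exp 1 * n) * (1 / (n:ℝ)) ^ M * Real.exp ((M:ℝ)^2/n)) * g P := by gcongr
        _ ≤ (n.factorial * (Real.exp 1 * n) * (1 / (n:ℝ)) ^ M * (E * Real.exp 2 ^ Mr)) * g P := by gcongr
        _ = _ := by ring
  rw [step1, step2]
  refine (Finset.sum_le_sum step3).trans ?_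
  rw [← Finset.mul_sum, ← Finset.mul_sum, ← Finset.prod_univ_sum PP (fun i P => w i P.card)]
  have hw0 : ∀ i o, 0 ≤ w i o := by
    intro i o
    simp only [w]
    split_ifs <;> positivity
  refine mul_le_mul_of_nonneg_left (mul_le_mul_of_nonneg_left 
    (Finset.prod_le_prod (fun i _ => Finset.sum_nonneg fun P _ => hw0 i _) fun i _ => ?_) (Real.exp_pos _).le) (by positivity)
  · simp only [PP, Wt]
    rw [Finset.sum_biUnion]
    · refine Finset.sum_le_sum fun o _ => ?_
      calc ∑ P ∈ Fam c i o, w i P.card = ∑ P ∈ Fam c i o, w i o := by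
            refine Finset.sum_congr rfl fun P hP => ?_
            rw [(Fam_mem c i o P hP).1]
        _ = (Fam c i o).card * w i o := by rw [Finset.sum_const, nsmul_eq_mul]
        _ ≤ _ := by
            refine mul_le_mul_of_nonneg_right ?_ (hw0 i o)
            exact_mod_cast Fam_card c i o
    · intro o _ o' _ hoo
      simp only [Function.onFun]
      rw [Finset.disjoint_left]
      intro P h1 h2
      exact hoo ((Fam_mem c i o P h1).1.symm.trans (Fam_mem c i o' P h2).1)

lemma overlap_total (c : Fin n → Fin k) (hn : 0 < n) (T J : ℕ) (hTJ : J < 2 * T)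
    (hJ : ∀ a, (cls c a).card ≤ J) :
    ∑ π : Equiv.Perm (Fin n), (2:ℝ) ^ (∑ a, ∑ b, (ov c π a b).choose 2)
      ≤ n.factorial * (Real.exp 1 * n) * 
        ∑ q : Fin k → Option (Fin k), (Real.exp ((ell q * J : ℝ)^2/n) * ∏ i, Wt c T J q i) := by
  classical
  have hrow : ∀ π a, ∑ b, ov c π a b = (cls c a).card := by
    intro π a
    rw [Finset.card_eq_sum_card_fiberwise (f := fun u => c (π u)) (t := Finset.univ) (by simp)]
    refine Finset.sum_congr rfl fun b _ => ?_
    simp [ov, cls, Finset.filter_filter]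
  have huniq : ∀ π a b b', T ≤ ov c π a b → T ≤ ov c π a b' → b = b' := by
    intro π a b b' h1 h2
    by_contra hne
    have : ov c π a b + ov c π a b' ≤ ∑ b, ov c π a b := by
      rw [← Finset.sum_pair hne]
      exact Finset.sum_le_sum_of_subset (Finset.subset_univ _)
    rw [hrow] at this
    have := hJ a
    omega
  have hle : ∀ π a b, ov c π a b ≤ J := by
    intro π a b
    refine le_trans ?_ (hJ a)
    rw [← hrow π a]
    exact Finset.single_le_sum (f := fun b => ov c π a b) (fun _ _ => Nat.zero_le _) (Finset.mem_univ b)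
  rw [Finset.mul_sum]
  refine le_trans ?_ (Finset.sum_le_sum fun q _ => overlap_q c hn T J q)
  let Q : Equiv.Perm (Fin n) → Fin k → Option (Fin k) := fun π a =>
    if h : ∃ b, T ≤ ov c π a b then some h.choose else none
  rw [← Finset.sum_fiberwise_of_maps_to (s := Finset.univ) (t := Finset.univ) (g := Q) (fun _ _ => Finset.mem_univ _)]
  refine Finset.sum_le_sum fun q _ => ?_
  refine Finset.sum_le_sum_of_subset_of_nonneg ?_ (fun _ _ _ => by positivity)
  intro π hπ
  have hq : Q π = q := (Finset.mem_filter.1 hπ).2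
  refine Finset.mem_filter.2 ⟨Finset.mem_univ _, fun i => ?_⟩
  have hkey : q i.1 = some i.2 ↔ T ≤ ov c π i.1 i.2 := by
    rw [← hq]
    simp only [Q]
    split_ifs with h
    · rw [Option.some.injEq]
      constructor
      · intro h'; rw [← h']; exact h.choose_spec
      · intro h'; exact huniq π i.1 _ _ h.choose_spec h'
    · simp only [reduceCtorEq, false_iff]
      exact fun h' => h ⟨_, h'⟩
  unfold Allowed
  split_ifs with h
  · exact ⟨_, Finset.mem_Icc.2 ⟨hkey.1 h, hle _ _ _⟩, Or.inl rfl⟩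
  · have h' : ov c π i.1 i.2 < T := by
      by_contra h2
      exact h (hkey.2 (not_lt.1 h2))
    by_cases h0 : ov c π i.1 i.2 = 0
    · exact ⟨0, by simp, Or.inl h0.symm⟩
    by_cases h1 : ov c π i.1 i.2 = 1
    · exact ⟨0, by simp, Or.inr ⟨rfl, h1⟩⟩
    · exact ⟨_, Finset.mem_insert_of_mem (Finset.mem_Ico.2 ⟨by omega, h'⟩), Or.inl rfl⟩

end overlap

open Filter

section assemble
variable {n k : ℕ}

lemma qsum (c : Fin n → Fin k) (T J : ℕ) (ρ x : ℝ) (B : Fin k → ℝ) (hk : 0 < k)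
    (hB : ∀ a, 0 ≤ B a) (hx : 0 ≤ x)
    (hrest : ∀ q i, q i.1 ≠ some i.2 → Wt c T J q i ≤ Real.exp ρ)
    (hnear : ∀ q i, q i.1 = some i.2 → Wt c T J q i ≤ B i.1) (hρ : 0 ≤ ρ)
    (hZ : ∀ Z : Finset (Fin k), Real.exp ((Z.card * J : ℝ)^2/n) * ∏ a ∈ Z, (k * B a) ≤ x ^ Z.card) :
    ∑ q : Fin k → Option (Fin k), (Real.exp ((ell q * J : ℝ)^2/n) * ∏ i, Wt c T J q i)
      ≤ Real.exp ((k:ℝ)^2 * ρ + k * x) := by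
  classical
  have hk0 : (0:ℝ) < k := by exact_mod_cast hk
  have hW0 : ∀ q i, 0 ≤ Wt c T J q i := by
    intro q i
    unfold Wt
    refine Finset.sum_nonneg fun o _ => ?_
    split_ifs <;> positivity
  have key : ∀ q : Fin k → Option (Fin k), Real.exp ((ell q * J : ℝ)^2/n) * ∏ i, Wt c T J q i ≤
      Real.exp ((k:ℝ)^2 * ρ) * ∏ a, (if q a = none then 1 else x / k) := by
    intro q
    set Z := Finset.univ.filter (fun a => q a ≠ none) with hZd
    have h1 : ∏ i, Wt c T J q i ≤ Real.exp ((k:ℝ)^2 * ρ) * ∏ a ∈ Z, B a := by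
      calc ∏ i, Wt c T J q i ≤ ∏ i : Fin k × Fin k, (Real.exp ρ * (if q i.1 = some i.2 then B i.1 else 1)) := by
            refine Finset.prod_le_prod (fun i _ => hW0 q i) fun i _ => ?_
            split_ifs with h
            · refine (hnear q i h).trans ?_
              exact le_mul_of_one_le_left (hB _) (Real.one_le_exp hρ)
            · rw [mul_one]; exact hrest q i h
        _ = Real.exp ((k:ℝ)^2 * ρ) * ∏ i : Fin k × Fin k, (if q i.1 = some i.2 then B i.1 else 1) := by
            rw [Finset.prod_mul_distrib]
            congr 1
            rw [Finset.prod_const, ← Real.exp_nat_mul]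
            congr 1
            rw [Finset.card_univ, Fintype.card_prod, Fintype.card_fin]
            push_cast
            ring
        _ = _ := by
            congr 1
            rw [Fintype.prod_prod_type, hZd, Finset.prod_filter]
            refine Finset.prod_congr rfl fun a _ => ?_
            simp only
            rcases hqa : q a with _ | b
            · simp
            · simp [Finset.prod_ite_eq]
    have h2 : ∏ a, (if q a = none then 1 else x / k) = (x/k) ^ Z.card := by
      rw [hZd, ← Finset.prod_const, Finset.prod_filter]
      refine Finset.prod_congr rfl fun a _ => ?_
      by_cases h : q a = none <;> simp [h]
    have h3 := hZ Z
    rw [Finset.prod_mul_distrib, Finset.prod_const] at h3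
    rw [h2]
    have hkp : (0:ℝ) < (k:ℝ) ^ Z.card := by positivity
    calc Real.exp ((ell q * J : ℝ)^2/n) * ∏ i, Wt c T J q i 
        ≤ Real.exp ((Z.card * J : ℝ)^2/n) * (Real.exp ((k:ℝ)^2 * ρ) * ∏ a ∈ Z, B a) := by
          exact mul_le_mul_of_nonneg_left h1 (Real.exp_pos _).le
      _ = Real.exp ((k:ℝ)^2 * ρ) * ((Real.exp ((Z.card * J : ℝ)^2/n) * ((k:ℝ) ^ Z.card * ∏ a ∈ Z, B a)) / (k:ℝ) ^ Z.card) := by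
          field_simp
      _ ≤ Real.exp ((k:ℝ)^2 * ρ) * (x ^ Z.card / (k:ℝ) ^ Z.card) := by gcongr
      _ = _ := by rw [div_pow]
  refine (Finset.sum_le_sum fun q _ => key q).trans ?_
  rw [← Finset.mul_sum, Real.exp_add]
  gcongr
  have : ∑ q : Fin k → Option (Fin k), ∏ a, (if q a = none then (1:ℝ) else x / k) = 
      ∏ a : Fin k, ∑ z : Option (Fin k), (if z = none then (1:ℝ) else x / k) := by
    rw [Finset.prod_univ_sum (fun _ => Finset.univ) (fun _ z => if z = none then (1:ℝ) else x / k)]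
    simp
  rw [this]
  simp only [Fintype.sum_option, Finset.prod_const]
  simp only [reduceCtorEq, if_true, if_false, Finset.sum_const, Finset.card_univ, Fintype.card_fin, nsmul_eq_mul]
  rw [mul_div_cancel₀ _ hk0.ne', Real.exp_nat_mul]
  have := Real.add_one_le_exp x
  gcongr
  linarith

def cmod (n k : ℕ) (hk : 0 < k) : Fin n → Fin k := fun i => ⟨i.1 % k, Nat.mod_lt _ hk⟩

lemma cmod_card (hk : 0 < k) (a : Fin k) :
    (cls (cmod n k hk) a).card = n / k + if a.1 < n % k then 1 else 0 := by
  have h := Nat.count_modEq_card n hk a.1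
  rw [Nat.mod_eq_of_lt a.2] at h
  rw [← h, Nat.count_eq_card_filter_range]
  refine Finset.card_bij (fun i _ => i.1) ?_ ?_ ?_
  · intro i hi
    have := (Finset.mem_filter.1 hi).2
    simp only [Finset.mem_filter, Finset.mem_range]
    refine ⟨i.2, ?_⟩
    rw [Nat.ModEq, Nat.mod_eq_of_lt a.2]
    exact congrArg Fin.val this
  · intro i _ j _ hij; exact Fin.ext hij
  · intro i hi
    rw [Finset.mem_filter, Finset.mem_range] at hi
    refine ⟨⟨i, hi.1⟩, ?_, rfl⟩
    refine Finset.mem_filter.2 ⟨Finset.mem_univ _, Fin.ext ?_⟩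
    have := hi.2
    rw [Nat.ModEq, Nat.mod_eq_of_lt a.2] at this
    exact this

lemma near_term (m s o T J : ℕ) (hn : 0 < n) (ho : T ≤ o) (hs : s ≤ m + 1) (hm : m ≤ J) (h2 : J * n ≤ 2 ^ T) :
    ((m.choose o : ℕ) : ℝ) * (s.descFactorial o : ℝ) * (2 ^ (o.choose 2) * (1 / (n:ℝ)) ^ o) ≤ 
      (m+1).factorial * 2 ^ (m.choose 2) * (1 / (n:ℝ)) ^ m := by
  rcases lt_or_ge m o with h | h
  · rw [Nat.choose_eq_zero_of_lt h]
    simp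
    positivity
  · obtain ⟨t, rfl⟩ := Nat.exists_eq_add_of_le h
    have hn0 : (0:ℝ) < n := by exact_mod_cast hn
    have e1 : (((o + t).choose o : ℕ) : ℝ) ≤ (J:ℝ)^t := by
      have : (o+t).choose o ≤ J ^ t := by
        rw [Nat.choose_symm_add]
        exact (Nat.choose_le_pow _ _).trans (Nat.pow_le_pow_left hm t)
      exact_mod_cast this
    have e2 : (s.descFactorial o : ℝ) ≤ (o + t + 1).factorial := by
      have : s.descFactorial o ≤ (o + t + 1).factorial := by
        calc s.descFactorial o ≤ (o+t+1).descFactorial o := Nat.descFactorial_le o hs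
          _ ≤ _ := by
            rw [Nat.descFactorial_eq_div (by omega)]
            exact Nat.div_le_self _ _
      exact_mod_cast this
    have e3 : (o + t).choose 2 = o.choose 2 + (o * t + t.choose 2) := by
      rw [Nat.add_choose_eq]
      simp [Finset.Nat.antidiagonal_succ]
      ring
    have e4 : (J * n : ℝ)^t ≤ 2 ^ (o * t + t.choose 2) := by
      have h5 : (J * n : ℝ) ≤ 2 ^ T := by exact_mod_cast h2
      calc (J * n : ℝ)^t ≤ (2 ^ T)^t := by gcongr
        _ = 2 ^ (T * t) := by rw [pow_mul]
        _ ≤ _ := by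
          gcongr
          · norm_num
          · have : T * t ≤ o * t := Nat.mul_le_mul_right t ho
            omega
    calc _ ≤ (J:ℝ)^t * (o + t + 1).factorial * (2 ^ (o.choose 2) * (1 / (n:ℝ)) ^ o) := by gcongr
      _ = (o + t + 1).factorial * 2 ^ (o.choose 2) * (J * n : ℝ)^t * (1 / (n:ℝ)) ^ (o+t) := by
          rw [pow_add, mul_pow, one_div, inv_pow, inv_pow]; field_simp
      _ ≤ (o + t + 1).factorial * 2 ^ (o.choose 2) * 2 ^ (o * t + t.choose 2) * (1 / (n:ℝ)) ^ (o+t) := by gcongr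
      _ = _ := by rw [e3, pow_add]; ring

lemma rows_calc (ℓ ℓ1 k θ j A D y : ℝ) (hk : 0 < k) (hℓ0 : 0 ≤ ℓ) (hℓ : ℓ ≤ k) (h1 : ℓ1 ≤ ℓ) (h2 : ℓ1 ≤ θ * k)
    (hθ0 : 0 ≤ θ) (hθ : θ ≤ 1) (hj : 1 ≤ j) (hD0 : 0 ≤ D) (hDj : D ≤ j) (hA : j + y + 3 ≤ A - θ * D) :
    (ℓ * (j+1))^2 / (k * (j+θ)) + (ℓ1 * D - ℓ * A) ≤ - (ℓ * y) := by
  have e1 : (ℓ * (j+1))^2 / (k * (j+θ)) ≤ ℓ * (ℓ/k) * (j + 3) := by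
    rw [div_le_iff₀ (by positivity)]
    have : ℓ * (ℓ/k) * (j + 3) * (k * (j+θ)) = ℓ^2 * ((j+3) * (j + θ)) := by field_simp
    rw [this, mul_pow]
    gcongr
    nlinarith
  have e2 : ℓ1 - ℓ * θ ≤ ℓ * (1 - ℓ/k) := by
    rcases le_total (ℓ/k) θ with h | h
    · nlinarith
    · have h3 : ℓ * (ℓ/k) = (ℓ/k)^2 * k := by field_simp
      have h4 : ℓ = (ℓ/k) * k := by field_simp
      have h5 : ℓ/k ≤ 1 := by rw [div_le_one hk]; exact hℓ
      have h6 : θ * (1 - ℓ/k) ≤ (ℓ/k) * (1 - ℓ/k) := by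
        apply mul_le_mul_of_nonneg_right h; linarith
      set lam := ℓ/k
      rw [h4] 
      nlinarith [mul_le_mul_of_nonneg_right h6 hk.le]
  have h5 : ℓ/k ≤ 1 := by rw [div_le_one hk]; exact hℓ
  have h6 : 0 ≤ ℓ/k := by positivity
  have e3 : (ℓ1 - ℓ * θ) * D ≤ ℓ * (1 - ℓ/k) * j := by
    calc (ℓ1 - ℓ * θ) * D ≤ ℓ * (1 - ℓ/k) * D := by gcongr
      _ ≤ _ := by
        have : 0 ≤ ℓ * (1 - ℓ/k) := mul_nonneg hℓ0 (by linarith)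
        gcongr
  have e4 : ℓ * (j + y + 3) ≤ ℓ * (A - θ * D) := by gcongr
  have e5 : ℓ * (ℓ/k) * 3 ≤ ℓ * 1 * 3 := by gcongr
  nlinarith

/-- deterministic lower bound for the probability of being `k`-colourable -/
lemma lower_det (hk : 0 < k) (hkn : k ≤ n) (T : ℕ) (A y δ : ℝ)
    (h1 : n / k + 1 < 2 * T) (h2 : (n / k + 1) * n ≤ 2 ^ T)
    (h3 : ∀ o, 2 ≤ o → o < T → (((n / k + 1 : ℕ):ℝ) ^ 2 * Real.exp 2 / n) ^ o * 2 ^ (o.choose 2) ≤ δ)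
    (hδ : 0 ≤ δ)
    (hA : (k:ℝ) * ((n / k + 1 : ℕ) * ((n/k + 1).factorial * 2 ^ ((n/k).choose 2) * (1 / (n:ℝ)) ^ (n/k))) ≤ Real.exp (-A))
    (D : ℝ) (hD : Real.exp D = ((n/k : ℕ) + 2) * 2 ^ (n/k) / n) (hD0 : 0 ≤ D) (hDj : D ≤ (n/k : ℕ))
    (hAy : (n/k : ℕ) + y + 3 ≤ A - ((n % k : ℕ) / k : ℝ) * D) :
    Real.exp (-(1 + Real.log n + ((k:ℝ)^2 * (T * δ) + k * Real.exp (-y)))) ≤ Pr n (fun G => G.Colorable k) := by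
  classical
  have hn : 0 < n := by omega
  have hn0 : (0:ℝ) < n := by exact_mod_cast hn
  have hk0 : (0:ℝ) < k := by exact_mod_cast hk
  set j := n / k with hj
  have hj1 : 1 ≤ j := (Nat.one_le_div_iff hk).2 hkn
  set c := cmod n k hk with hc
  have hcard : ∀ a, (cls c a).card = j + if a.1 < n % k then 1 else 0 := fun a => cmod_card hk a
  have hcJ : ∀ a, (cls c a).card ≤ j + 1 := by
    intro a; rw [hcard]; split_ifs <;> omega
  have hcj : ∀ a, j ≤ (cls c a).card := by
    intro a; rw [hcard]; omega
  let B : Fin k → ℝ := fun a => (j + 1 : ℕ) * (((cls c a).card + 1).factorial * 2 ^ ((cls c a).card.choose 2) * (1 / (n:ℝ)) ^ (cls c a).card)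
  have hrest : ∀ q i, q i.1 ≠ some i.2 → Wt c T (j+1) q i ≤ Real.exp (T * δ) := by
    intro q i hq
    unfold Wt Allowed
    rw [if_neg hq, Finset.sum_insert (by simp), if_neg hq]
    have e1 : ∑ o ∈ Finset.Ico 2 T, ((cls c i.1).card.choose o : ℝ) * ((cls c i.2).card.descFactorial o : ℝ) *
        (2 ^ (o.choose 2) * (Real.exp 2 / n) ^ o) ≤ ∑ o ∈ Finset.Ico 2 T, δ := by
      refine Finset.sum_le_sum fun o ho => ?_
      rw [Finset.mem_Ico] at ho
      refine le_trans ?_ (h3 o ho.1 ho.2)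
      have f1 : ((cls c i.1).card.choose o : ℝ) ≤ ((j+1:ℕ):ℝ)^o := by
        exact_mod_cast (Nat.choose_le_pow _ _).trans (Nat.pow_le_pow_left (hcJ _) o)
      have f2 : ((cls c i.2).card.descFactorial o : ℝ) ≤ ((j+1:ℕ):ℝ)^o := by
        exact_mod_cast (Nat.descFactorial_le_pow _ _).trans (Nat.pow_le_pow_left (hcJ _) o)
      calc _ ≤ ((j+1:ℕ):ℝ)^o * ((j+1:ℕ):ℝ)^o * (2 ^ (o.choose 2) * (Real.exp 2 / n) ^ o) := by gcongr
        _ = _ := by rw [div_pow, div_pow, mul_pow, ← pow_mul, mul_comm 2 o, pow_mul, sq]; ring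
    have e2 : ∑ o ∈ Finset.Ico 2 T, δ ≤ T * δ := by
      rw [Finset.sum_const, nsmul_eq_mul, Nat.card_Ico]
      gcongr
      omega
    have e3 := Real.add_one_le_exp (T * δ)
    simp only [Nat.choose_zero_right, Nat.descFactorial_zero, Nat.cast_one, pow_zero]
    have : Nat.choose 0 2 = 0 := rfl
    rw [this, pow_zero]
    linarith
  have hnear : ∀ q i, q i.1 = some i.2 → Wt c T (j+1) q i ≤ B i.1 := by
    intro q i hq
    unfold Wt Allowed
    rw [if_pos hq, if_pos hq]
    simp only [B]
    set m := (cls c i.1).card with hm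
    calc _ ≤ ∑ o ∈ Finset.Icc T (j+1), ((m+1).factorial * 2 ^ (m.choose 2) * (1 / (n:ℝ)) ^ m) := by
          refine Finset.sum_le_sum fun o ho => ?_
          rw [Finset.mem_Icc] at ho
          refine near_term m _ o T (j+1) hn ho.1 ?_ (hcJ _) h2
          have := hcJ i.2
          have := hcj i.1
          omega
      _ ≤ _ := by
          rw [Finset.sum_const, nsmul_eq_mul, Nat.card_Icc]
          gcongr
          omega
  have hBexp : ∀ a, (k:ℝ) * B a ≤ Real.exp (-A + if a.1 < n % k then D else 0) := by
    intro a
    simp only [B]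
    rw [hcard]
    split_ifs with h
    · rw [Real.exp_add, hD]
      refine le_trans (le_of_eq ?_) (mul_le_mul_of_nonneg_right hA (by positivity))
      have e1 : (j+1).choose 2 = j.choose 2 + j := by
        rw [Nat.choose_succ_succ' j 1]; simp; ring
      rw [e1, Nat.factorial_succ (j+1), pow_add, pow_add]
      push_cast
      field_simp
      ring
    · simpa using hA
  have hnk : (n:ℝ) = k * (j + (n % k : ℕ) / k) := by
    have := Nat.div_add_mod n k
    rw [mul_add, mul_div_cancel₀ _ hk0.ne']
    exact_mod_cast this.symm
  have hZ : ∀ Z : Finset (Fin k), Real.exp ((Z.card * (j+1:ℕ) : ℝ)^2/n) * ∏ a ∈ Z, (k * B a) ≤ (Real.exp (-y)) ^ Z.card := by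
    intro Z
    have e1 : ∏ a ∈ Z, (k * B a) ≤ Real.exp (∑ a ∈ Z, (-A + if a.1 < n % k then D else 0)) := by
      rw [Real.exp_sum]
      refine Finset.prod_le_prod (fun a _ => ?_) (fun a _ => hBexp a)
      simp only [B]; positivity
    refine (mul_le_mul_of_nonneg_left e1 (Real.exp_pos _).le).trans ?_
    rw [← Real.exp_add, ← Real.exp_nat_mul]
    apply Real.exp_le_exp.2
    rw [Finset.sum_add_distrib, Finset.sum_const, ← Finset.sum_filter, Finset.sum_const, nsmul_eq_mul, nsmul_eq_mul]
    have g1 : (Z.filter (fun a => a.1 < n % k)).card ≤ Z.card := Finset.card_filter_le _ _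
    have g2 : (Z.filter (fun a => a.1 < n % k)).card ≤ n % k := by
      calc (Z.filter (fun a => a.1 < n % k)).card ≤ (Finset.range (n % k)).card := by
            refine Finset.card_le_card_of_injOn Fin.val ?_ (fun a _ b _ h => Fin.ext h)
            intro a ha
            simpa using (Finset.mem_filter.1 ha).2
        _ = _ := Finset.card_range _
    have g3 : Z.card ≤ k := by simpa using Finset.card_le_univ Z
    have hmk : n % k ≤ k := (Nat.mod_lt _ hk).le
    have := rows_calc Z.card (Z.filter (fun a => a.1 < n % k)).card k ((n % k : ℕ) / k) j A D y hk0 (by positivity)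
      (by exact_mod_cast g3) (by exact_mod_cast g1) (by rw [div_mul_cancel₀ _ hk0.ne']; exact_mod_cast g2)
      (by positivity) (by rw [div_le_one hk0]; exact_mod_cast hmk) (by exact_mod_cast hj1) hD0 hDj hAy
    rw [← hnk] at this
    push_cast
    linarith
  have hq := qsum c T (j+1) (T * δ) (Real.exp (-y)) B hk (fun a => by simp only [B]; positivity) (Real.exp_pos _).le
    hrest hnear (by positivity) hZ
  have ht := overlap_total c hn T (j+1) h1 hcJ
  have hs := second_moment c
  set P := Pr n (fun G => G.Colorable k) with hP
  have hP0 : 0 ≤ P := by rw [hP]; unfold Pr; positivity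
  have hf : (0:ℝ) < n.factorial := by positivity
  have h5 : (n.factorial:ℝ) * 1 ≤ n.factorial * (P * (Real.exp 1 * n * Real.exp ((k:ℝ)^2 * (T * δ) + k * Real.exp (-y)))) := by
    calc (n.factorial:ℝ) * 1 ≤ P * _ := by rw [mul_one]; exact hs
      _ ≤ P * _ := mul_le_mul_of_nonneg_left ht hP0
      _ ≤ P * (n.factorial * (Real.exp 1 * n) * Real.exp ((k:ℝ)^2 * (T * δ) + k * Real.exp (-y))) := by gcongr
      _ = _ := by ring
  have h6 := le_of_mul_le_mul_left h5 hf
  rw [Real.exp_neg, Real.exp_add, Real.exp_add, Real.exp_log hn0]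
  rw [inv_le_iff_one_le_mul₀ (by positivity)]
  exact h6

end assemble

open Filter

section asym

lemma keyA (L l j θ η lam a1 a2 a3 : ℝ) (hη : 0 < η) (hlam : 0.69 < lam)
    (hθ0 : 0 ≤ θ) (hθ1 : θ ≤ 1) (hl : 0 ≤ l)
    (hup : j + θ ≤ 2 * L - 2 * l - 2 - η) (hlow : 2 * L - 2 * l - 4 - η ≤ j) (hjL : L ≤ j) (hj0 : 0 ≤ j)
    (hK : (24 + η) * (l + 1) ≤ η * L)
    (h1 : a1 ≤ lam * (1 + l)) (h2 : a2 ≤ lam * (1 + l)) (h3 : a3 ≤ lam * (1 + l)) :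
    j + 6 * (lam * l) + 3 ≤ (j * (L * lam) - j * a1 - j * (j - 1) / 2 * lam + j - 2 * a2 - 1 - a1 - L * lam)
      - θ * (a3 + j * lam - L * lam) := by
  have hlam0 : 0 < lam := by linarith
  have e1 : j * a1 ≤ j * (lam * (1 + l)) := by gcongr
  have e3 : θ * a3 ≤ 1 * (lam * (1+l)) := by
    calc θ * a3 ≤ θ * (lam * (1+l)) := by gcongr
      _ ≤ _ := by gcongr
  have i1 : j * ((j + θ) / 2 + l + 1 + η / 2) ≤ j * L := by
    gcongr; linarith
  have i2 : (1 - θ) * (L - j / 2) ≤ l + 2 + η / 2 := by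
    have : L - j/2 ≤ l + 2 + η / 2 := by linarith
    have h0 : 0 ≤ l + 2 + η/2 := by positivity
    nlinarith
  have i3 : η * L ≤ η * j := by gcongr
  have inner : 11 * l + 6 + 6 * l - 6 * l + 0 ≤ j * L - j * (j - 1) / 2 - (1 - θ) * L - θ * j - j * (1 + l) - 4 * (1 + l) - 6 * l + (5 * l + 4) + 6 * l := by
    nlinarith
  have inner2 : 6 * l + 6 ≤ j * L - j * (j - 1) / 2 - (1 - θ) * L - θ * j - j * (1 + l) - 4 * (1 + l) := by
    nlinarith
  have := mul_le_mul_of_nonneg_left inner2 hlam0.le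
  nlinarith

/-- largeness of `L` -/
def Big (K L : ℝ) : Prop := K ≤ L ∧ K * (Real.logb 2 L + 1) ≤ L ∧ K * L ^ 8 ≤ (2:ℝ) ^ (L / 20)

lemma big_event (K : ℝ) (hK : 0 < K) : ∀ᶠ L : ℝ in atTop, Big K L := by
  have h1 : ∀ᶠ L : ℝ in atTop, K ≤ L := eventually_ge_atTop K
  have h2 : ∀ᶠ L : ℝ in atTop, K * (Real.logb 2 L + 1) ≤ L := by
    have := Real.isLittleO_log_id_atTop.bound (c := Real.log 2 / (2 * K)) (by have := Real.log_pos one_lt_two; positivity)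
    filter_upwards [this, eventually_ge_atTop (2*K), eventually_ge_atTop 1] with L h h3 h4
    have hl2 := Real.log_pos one_lt_two
    simp only [id, Real.norm_eq_abs] at h
    rw [abs_of_nonneg (Real.log_nonneg h4), abs_of_nonneg (by linarith)] at h
    have h5 : Real.logb 2 L ≤ L / (2 * K) := by
      rw [Real.logb, div_le_iff₀ hl2]
      calc _ ≤ _ := h
        _ = _ := by ring
    have h6 : K * Real.logb 2 L ≤ L / 2 := by
      calc _ ≤ K * (L / (2 * K)) := by gcongr
        _ = _ := by field_simp
    linarith
  have h3 : ∀ᶠ L : ℝ in atTop, K * L ^ 8 ≤ (2:ℝ) ^ (L / 20) := by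
    have hb : 0 < Real.log 2 / 20 := by have := Real.log_pos one_lt_two; positivity
    have := (isLittleO_pow_exp_pos_mul_atTop 8 hb).bound (c := 1 / K) (by positivity)
    filter_upwards [this, eventually_ge_atTop 0] with L h h4
    rw [Real.norm_of_nonneg (by positivity), Real.norm_of_nonneg (by positivity)] at h
    rw [Real.rpow_def_of_pos two_pos]
    calc K * L^8 ≤ K * (1 / K * Real.exp (Real.log 2 / 20 * L)) := by gcongr
      _ = Real.exp (Real.log 2 / 20 * L) := by field_simp
      _ = _ := by congr 1; ring
  filter_upwards [h1, h2, h3] with L a b c using ⟨a, b, c⟩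

lemma tendsto_L : Tendsto (fun n : ℕ => Real.logb 2 n) atTop atTop :=
  (Real.tendsto_logb_atTop one_lt_two).comp tendsto_natCast_atTop_atTop

lemma rest_bound (L x : ℝ) (n o : ℕ) (hn : (n:ℝ) = 2 ^ L) (hL : 10 ≤ L) (hx0 : 0 ≤ x) (hx : x ≤ (2:ℝ) ^ (L / 20))
    (ho : 2 ≤ o) (hoT : (o:ℝ) ≤ 5 * L / 4) : (x / n) ^ o * 2 ^ (o.choose 2) ≤ (2:ℝ) ^ (-(3/2 * L)) := by
  have h2 : (0:ℝ) < 2 := two_pos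
  have ho' : (2:ℝ) ≤ o := by exact_mod_cast ho
  calc (x / n) ^ o * 2 ^ (o.choose 2) ≤ ((2:ℝ) ^ (L / 20) / 2 ^ L) ^ o * 2 ^ (o.choose 2) := by
        rw [hn]; gcongr
    _ = (2:ℝ) ^ ((L/20 - L) * o + o * (o - 1) / 2) := by
        rw [← Real.rpow_sub h2, ← Real.rpow_natCast, ← Real.rpow_natCast, ← Real.rpow_mul h2.le, ← Real.rpow_add h2,
          Nat.cast_choose_two]
    _ ≤ _ := by
        apply Real.rpow_le_rpow_of_exponent_le one_le_two
        nlinarith [mul_nonneg (sub_nonneg.2 ho') (sub_nonneg.2 hoT), mul_nonneg (sub_nonneg.2 ho') (sub_nonneg.2 hL)]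

lemma hA_bound (n k j : ℕ) (L : ℝ) (hn : 0 < n) (hnL : Real.log n = L * Real.log 2) (hk : 0 < k) (hkn : k ≤ n) (hj : 0 < j) :
    (k:ℝ) * ((j + 1 : ℕ) * ((j + 1).factorial * 2 ^ (j.choose 2) * (1 / (n:ℝ)) ^ j)) ≤ 
     Real.exp (-((j:ℝ) * (L * Real.log 2) - j * Real.log j - j * (j - 1) / 2 * Real.log 2 + j - 2 * Real.log (j+1) - 1 - Real.log j - L * Real.log 2)) := by
  have hn0 : (0:ℝ) < n := by exact_mod_cast hn
  have hj0 : (0:ℝ) < j := by exact_mod_cast hj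
  have e1 : (k:ℝ) ≤ Real.exp (L * Real.log 2) := by
    rw [← hnL, Real.exp_log hn0]; exact_mod_cast hkn
  have e2 : ((j + 1 : ℕ):ℝ) = Real.exp (Real.log (j+1)) := by
    rw [Real.exp_log (by positivity)]; push_cast; ring
  have e3 : ((j + 1).factorial : ℝ) ≤ Real.exp (Real.log (j+1) + 1 + Real.log j + j * Real.log j - j) := by
    rw [Nat.factorial_succ]
    push_cast
    have := fact_upper j hj
    have h4 : Real.exp (Real.log (j+1) + 1 + Real.log j + j * Real.log j - j) = (j+1) * (Real.exp 1 * j * (j / Real.exp 1) ^ j) := by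
      rw [Real.exp_sub, Real.exp_add, Real.exp_add, Real.exp_add, Real.exp_log (by positivity), Real.exp_log hj0,
        Real.exp_nat_mul, Real.exp_log hj0, div_pow, ← Real.exp_nat_mul, mul_one]
      field_simp
    rw [h4]
    gcongr
  have e4 : (2:ℝ) ^ (j.choose 2) = Real.exp (j * (j - 1) / 2 * Real.log 2) := by
    rw [← Nat.cast_choose_two ℝ j, Real.exp_nat_mul, Real.exp_log two_pos]
  have e5 : (1 / (n:ℝ)) ^ j = Real.exp (-(j * (L * Real.log 2))) := by
    rw [← hnL, ← mul_neg, Real.exp_nat_mul, Real.exp_neg, Real.exp_log hn0, one_div]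
  rw [e2, e4, e5]
  calc _ ≤ Real.exp (L * Real.log 2) * (Real.exp (Real.log (j+1)) * (Real.exp (Real.log (j+1) + 1 + Real.log j + j * Real.log j - j) *
        Real.exp (j * (j - 1) / 2 * Real.log 2) * Real.exp (-(j * (L * Real.log 2))))) := by gcongr
    _ = _ := by
      rw [← Real.exp_add, ← Real.exp_add, ← Real.exp_add, ← Real.exp_add]
      congr 1; ring

end asym

open Filter

section upper

noncomputable def Dd (n : ℕ) : ℝ := 2 * Real.logb 2 n - 2 * Real.logb 2 (Real.logb 2 n) - 2

lemma big_facts (K : ℝ) (n : ℕ) (hK : 100 ≤ K) (hn : 0 < n) (hB : Big K (Real.logb 2 n)) :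
    (n:ℝ) = 2 ^ (Real.logb 2 n) ∧ 0 ≤ Real.logb 2 (Real.logb 2 n) ∧ Real.log n = Real.logb 2 n * Real.log 2 ∧
    Real.log (Real.logb 2 n) = Real.log 2 * Real.logb 2 (Real.logb 2 n) ∧
    (100 * Real.logb 2 n ^ 8) ^ 20 ≤ n ∧ 100 * Real.logb 2 n ^ 8 ≤ n ∧ 
    (2:ℝ) ^ (Real.logb 2 n / 4) = ((2:ℝ) ^ (Real.logb 2 n / 20))^5 ∧ 
    (n:ℝ) = ((2:ℝ) ^ (Real.logb 2 n / 20))^20 ∧ 100 * Real.logb 2 n ^ 8 ≤ (2:ℝ) ^ (Real.logb 2 n / 20) := by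
  obtain ⟨h1, h2, h3⟩ := hB
  have hn0 : (0:ℝ) < n := by exact_mod_cast hn
  have hl2 := Real.log_pos one_lt_two
  set L := Real.logb 2 n with hL
  have hnL : (n:ℝ) = 2 ^ L := (Real.rpow_logb two_pos (by norm_num) hn0).symm
  have hE : 100 * L ^ 8 ≤ (2:ℝ) ^ (L / 20) := by
    refine le_trans ?_ h3
    gcongr
  have hpow : ∀ m : ℕ, ((2:ℝ) ^ (L / 20))^m = 2 ^ (L / 20 * m) := by
    intro m
    rw [← Real.rpow_natCast, ← Real.rpow_mul two_pos.le]
  have hn20 : (n:ℝ) = ((2:ℝ) ^ (L / 20))^20 := by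
    rw [hpow, hnL]; congr 1; push_cast; ring
  have hL1 : 1 ≤ L := by linarith
  have hge1 : 1 ≤ 100 * L ^ 8 := by
    have : 1 ≤ L ^ 8 := one_le_pow₀ hL1
    linarith
  have h20 : (100 * L ^ 8) ^ 20 ≤ n := by
    rw [hn20]; gcongr
  refine ⟨hnL, Real.logb_nonneg one_lt_two hL1, ?_, ?_, h20, ?_, ?_, hn20, hE⟩
  · rw [hL, Real.logb, div_mul_cancel₀ _ hl2.ne']
  · rw [Real.logb, mul_div_cancel₀ _ hl2.ne']
  · exact (le_self_pow₀ hge1 (by norm_num)).trans h20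
  · rw [hpow]; congr 1; push_cast; ring

set_option maxHeartbeats 1000000 in
lemma lower_asym (η : ℝ) (hη : 0 < η) (n : ℕ) (hn : 0 < n) 
    (hB : Big (100 + 24 / η + η) (Real.logb 2 n)) :
    0 < ⌈(n:ℝ) / (Dd n - η)⌉₊ ∧ Real.logb 2 n + 2 ≤ Dd n - η ∧
    Real.exp (-(n * ((Real.logb 2 n)⁻¹ ^ 3) ^ 2)) ≤ Pr n (fun G => G.Colorable ⌈(n:ℝ) / (Dd n - η)⌉₊) := by
  have hK : 100 ≤ 100 + 24 / η + η := by have : 0 < 24 / η := by positivity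
                                         linarith
  obtain ⟨hnL, hl0, hlogn, hlogL, hn20, hn1, hq, hnE, hE⟩ := big_facts _ n hK hn hB
  clear hn20
  obtain ⟨hb1, hb2, hb3⟩ := hB
  have hn0 : (0:ℝ) < n := by exact_mod_cast hn
  unfold Dd
  set L := Real.logb 2 n with hL
  set l := Real.logb 2 L with hl
  set lam := Real.log 2 with hlam
  have hlam0 : 0.69 < lam := by have := Real.log_two_gt_d9; rw [hlam]; linarith
  have hlam1 : lam < 0.7 := by have := Real.log_two_lt_d9; rw [hlam]; linarith
  have hL100 : 100 ≤ L := hK.trans hb1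
  have hLp : 0 < L := by linarith
  have hKL : (100 + η) * (l + 1) ≤ L := by
    refine le_trans ?_ hb2
    gcongr
    have : 0 < 24 / η := by positivity
    linarith
  have hKη : (24 + η) * (l + 1) ≤ η * L := by
    calc (24 + η) * (l + 1) = η * ((24/η + 1) * (l+1)) := by field_simp
      _ ≤ η * ((100 + 24 / η + η) * (l + 1)) :=
          mul_le_mul_of_nonneg_left (mul_le_mul_of_nonneg_right (by linarith) (by linarith)) hη.le
      _ ≤ _ := by gcongr
  have hL8 : L^2 ≤ L^8 := pow_le_pow_right₀ (by linarith) (by norm_num)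
  set d := 2 * L - 2 * l - 2 - η with hd
  have hηl : 0 ≤ η * l := by positivity
  have hdL : L + 2 ≤ d := by
    have : (100 + η) * (l + 1) = 100 * l + 100 + η * l + η := by ring
    rw [this] at hKL
    rw [hd]; linarith
  have hLL8 : L ≤ L^8 := le_self_pow₀ (by linarith) (by norm_num)
  have hL7 : L^7 ≤ L^8 := pow_le_pow_right₀ (by linarith) (by norm_num)
  have hL68 : L^6 ≤ L^8 := pow_le_pow_right₀ (by linarith) (by norm_num)
  have hnlam : 0 ≤ (lam : ℝ) := by linarith
  have hd2 : d ≤ 2 * L - 2 := by linarith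
  have hd0 : 0 < d := by linarith
  set k := ⌈(n:ℝ) / d⌉₊ with hk
  have hk0 : 0 < k := Nat.ceil_pos.2 (by positivity)
  refine ⟨hk0, hdL, ?_⟩
  have hk0' : (0:ℝ) < k := by exact_mod_cast hk0
  have hk1 : (n:ℝ) / d ≤ k := Nat.le_ceil _
  have hk2 : (k:ℝ) < n / d + 1 := Nat.ceil_lt_add_one (by positivity)
  have hdn : d * d ≤ n := by
    calc d * d ≤ (2 * L) * (2 * L) := by gcongr <;> linarith
      _ = 4 * L^2 := by ring
      _ ≤ n := by linarith [sq_nonneg L]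
  have hnkd : (n:ℝ) ≤ k * d := by rwa [div_le_iff₀ hd0] at hk1
  set j := n / k with hj
  set θ : ℝ := ((n % k : ℕ) : ℝ) / k with hθ
  have hθ0 : 0 ≤ θ := by positivity
  have hθ1 : θ ≤ 1 := by
    rw [hθ, div_le_one hk0']; exact_mod_cast (Nat.mod_lt _ hk0).le
  have hnk : (n:ℝ) = k * (j + θ) := by
    have := Nat.div_add_mod n k
    rw [mul_add, mul_div_cancel₀ _ hk0'.ne']
    exact_mod_cast this.symm
  have hup : j + θ ≤ d := by
    rw [hnk] at hnkd
    exact le_of_mul_le_mul_left hnkd hk0'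
  have hlow : d - 1 ≤ j + θ := by
    have h1 : k * (d - 1) ≤ k * (j + θ) := by
      rw [← hnk]
      have h2 : d ≤ n / d := by rw [le_div_iff₀ hd0]; exact hdn
      have h3 : (n:ℝ) / d * d = n := by field_simp
      calc (k:ℝ) * (d - 1) ≤ (n / d + 1) * (d - 1) := mul_le_mul_of_nonneg_right hk2.le (by linarith)
        _ = (n:ℝ) / d * d - n / d + d - 1 := by ring
        _ ≤ n := by rw [h3]; linarith
    exact le_of_mul_le_mul_left h1 hk0'
  have hjL : L ≤ j := by linarith
  have hj0 : 0 < j := by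
    have : (0:ℝ) < j := by linarith
    exact_mod_cast this
  have hkn : k ≤ n := by
    by_contra h
    rw [hj, Nat.div_eq_of_lt (by omega)] at hj0
    omega
  have hkL : (k:ℝ) * L ≤ n := by
    rw [hnk]; gcongr; linarith
  have hJ2 : ((j + 1 : ℕ):ℝ) ≤ 2 * L := by push_cast; linarith
  set T := ⌈5 * L / 4⌉₊ with hT
  have hT1 : 5 * L / 4 ≤ T := Nat.le_ceil _
  have hT2 : (T:ℝ) < 5 * L / 4 + 1 := Nat.ceil_lt_add_one (by positivity)
  have c1 : n / k + 1 < 2 * T := by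
    have : ((j + 1 : ℕ):ℝ) < 2 * T := by linarith
    exact_mod_cast this
  have c2 : (n / k + 1) * n ≤ 2 ^ T := by
    have h1 : ((j + 1 : ℕ):ℝ) * n ≤ 2 ^ T := by
      have hE1 : 2 * L ≤ ((2:ℝ) ^ (L / 20))^5 := by
        have : 2 * L ≤ (2:ℝ) ^ (L / 20) := by linarith
        exact this.trans (le_self_pow₀ (by linarith) (by norm_num))
      calc ((j + 1 : ℕ):ℝ) * n ≤ (2:ℝ) ^ (L/4) * 2 ^ L := by
            rw [← hnL]; gcongr
            rw [hq]; linarith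
        _ = (2:ℝ) ^ (5 * L / 4) := by rw [← Real.rpow_add two_pos]; congr 1; ring
        _ ≤ (2:ℝ) ^ (T:ℝ) := Real.rpow_le_rpow_of_exponent_le one_le_two hT1
        _ = _ := Real.rpow_natCast _ _
    exact_mod_cast h1
  have c3 : ∀ o, 2 ≤ o → o < T → (((n / k + 1 : ℕ):ℝ) ^ 2 * Real.exp 2 / n) ^ o * 2 ^ (o.choose 2) ≤ (2:ℝ) ^ (-(3/2 * L)) := by
    intro o ho1 ho2
    refine rest_bound L _ n o hnL (by linarith) (by positivity) ?_ ho1 ?_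
    · have he : Real.exp 2 ≤ 9 := by
        have h1 : Real.exp 2 = Real.exp 1 ^ 2 := by rw [← Real.exp_nat_mul]; norm_num
        rw [h1]
        have h3 : Real.exp 1 ≤ 3 := Real.exp_one_lt_three.le
        calc Real.exp 1 ^ 2 ≤ 3 ^ 2 := by gcongr
          _ = 9 := by norm_num
      calc ((n / k + 1 : ℕ):ℝ) ^ 2 * Real.exp 2 ≤ (2 * L)^2 * 9 := by gcongr
        _ = 36 * L^2 := by ring
        _ ≤ 100 * L^8 := by linarith [sq_nonneg L]
        _ ≤ _ := hE
    · have : (o:ℝ) + 1 ≤ T := by exact_mod_cast ho2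
      linarith
  have hlog2L : Real.log (2 * L) = lam * (1 + l) := by
    rw [Real.log_mul two_ne_zero hLp.ne', hlogL]; ring
  have hjr : (0:ℝ) < j := by exact_mod_cast hj0
  have a1 : Real.log j ≤ lam * (1 + l) := by
    rw [← hlog2L]; apply Real.log_le_log hjr; push_cast at hJ2; linarith
  have a2 : Real.log (j+1) ≤ lam * (1 + l) := by
    rw [← hlog2L]; apply Real.log_le_log (by positivity); push_cast at hJ2; linarith
  have a3 : Real.log (j+2) ≤ lam * (1 + l) := by
    rw [← hlog2L]; apply Real.log_le_log (by positivity); linarith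
  have hkey := keyA L l j θ η lam (Real.log j) (Real.log (j+1)) (Real.log (j+2)) hη hlam0 hθ0 hθ1 hl0 hup (by linarith) hjL hjr.le hKη a1 a2 a3
  have hAb := hA_bound n k j L hn hlogn hk0 hkn hj0
  have hD : Real.exp (Real.log (j+2) + j * lam - L * lam) = ((n/k : ℕ) + 2) * 2 ^ (n/k) / n := by
    rw [Real.exp_sub, Real.exp_add, Real.exp_log (by positivity), Real.exp_nat_mul, hlam, Real.exp_log two_pos,
      ← hlogn, Real.exp_log hn0]
  have hlj2 : 0 ≤ Real.log ((j:ℝ)+2) := Real.log_nonneg (by linarith)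
  have hD0 : 0 ≤ Real.log ((j:ℝ)+2) + j * lam - L * lam := by
    have := mul_le_mul_of_nonneg_right hjL hnlam
    linarith
  have hDj : Real.log ((j:ℝ)+2) + j * lam - L * lam ≤ j := by
    have h1 : lam * (1 + l) ≤ lam * L := by
      gcongr
      linarith
    have h2 : j * lam ≤ j * 1 := by gcongr; linarith
    linarith
  have hmain := lower_det hk0 hkn T _ (6 * (lam * l)) _ c1 c2 c3 (by positivity) hAb _ hD
    hD0 hDj hkey
  refine le_trans ?_ hmain
  apply Real.exp_le_exp.2
  apply neg_le_neg
  have hy : Real.exp (-(6 * (lam * l))) = (L ^ 6)⁻¹ := by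
    rw [← hlogL, Real.exp_neg]
    congr 1
    have := Real.exp_nat_mul (Real.log L) 6
    rw [Real.exp_log hLp] at this
    exact_mod_cast this
  rw [hy]
  have hL6 : 0 < L ^ 6 := by positivity
  have hrhs : (n:ℝ) * (L⁻¹ ^ 3) ^ 2 = n / L^6 := by field_simp
  rw [hrhs, le_div_iff₀ hL6]
  have t1 : (1 + Real.log n) * L^6 ≤ n / 3 := by
    rw [hlogn]
    have : (1 + L * lam) * L^6 ≤ (1 + L * 1) * L^6 := by gcongr; linarith
    have h9 : (1 + L * 1) * L^6 = L^6 + L^7 := by ring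
    rw [h9] at this
    linarith
  have t3 : k * (L^6)⁻¹ * L^6 ≤ (n:ℝ)/3 := by
    rw [mul_assoc, inv_mul_cancel₀ hL6.ne', mul_one]
    have : (k:ℝ) * 3 ≤ k * L := by gcongr; linarith
    linarith
  have t2 : (k:ℝ)^2 * (T * (2:ℝ) ^ (-(3/2 * L))) * L^6 ≤ n / 3 := by
    set E := (2:ℝ) ^ (L/20) with hEd
    have hE0 : 0 < E := by positivity
    have h30 : (2:ℝ) ^ (-(3/2 * L)) = (E^30)⁻¹ := by
      rw [Real.rpow_neg two_pos.le, hEd, ← Real.rpow_natCast ((2:ℝ) ^ (L/20)), ← Real.rpow_mul two_pos.le]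
      congr 2; push_cast; ring
    have hT3 : (T:ℝ) ≤ 2 * L := by linarith
    have hk' : (k:ℝ) ≤ E^20 := by rw [← hnE]; exact_mod_cast hkn
    have hEE : E ≤ E^10 := le_self_pow₀ (by linarith) (by norm_num)
    rw [h30]
    calc (k:ℝ)^2 * (T * (E^30)⁻¹) * L^6 ≤ (E^20)^2 * ((2 * L) * (E^30)⁻¹) * L^6 := by gcongr
      _ = E^10 * (2 * L^7) := by field_simp
      _ ≤ E^10 * (E^10 / 3) := by
          gcongr
          linarith
      _ = E^20/3 := by ring
      _ = n/3 := by rw [hnE]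
  rw [add_mul, add_mul]
  linarith

end upper

open Filter

section lowerb

set_option maxHeartbeats 1000000 in
lemma first_asym (ε : ℝ) (hε : 0 < ε) (hε1 : ε ≤ 1) (n : ℕ) (hn : 0 < n) 
    (hB : Big (100 + 64 / ε) (Real.logb 2 n)) :
    Pr n (fun G => G.Colorable ⌊(n:ℝ) / (Dd n + ε)⌋₊) ≤ Real.exp (-(ε / 8 * n)) := by
  have hK : 100 ≤ 100 + 64 / ε := by have : 0 < 64 / ε := by positivity
                                     linarith
  obtain ⟨hnL, hl0, hlogn, hlogL, hn20, hn1, hq, hnE, hE⟩ := big_facts _ n hK hn hB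
  clear hn20 hq hnE hE
  obtain ⟨hb1, hb2, hb3⟩ := hB
  clear hb3
  have hn0 : (0:ℝ) < n := by exact_mod_cast hn
  unfold Dd
  set L := Real.logb 2 n with hL
  set l := Real.logb 2 L with hl
  set lam := Real.log 2 with hlam
  have hlam0 : 0.69 < lam := by have := Real.log_two_gt_d9; rw [hlam]; linarith
  have hlam1 : lam < 0.7 := by have := Real.log_two_lt_d9; rw [hlam]; linarith
  have hL100 : 100 ≤ L := hK.trans hb1
  have hLp : 0 < L := by linarith
  have hKL : 100 * (l + 1) ≤ L := by
    refine le_trans ?_ hb2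
    exact mul_le_mul_of_nonneg_right hK (by linarith)
  have hKε : 4 * (l + 1) ≤ ε / 16 * L := by
    calc 4 * (l + 1) = ε / 16 * (64/ε * (l+1)) := by field_simp; ring
      _ ≤ ε / 16 * ((100 + 64 / ε) * (l + 1)) :=
          mul_le_mul_of_nonneg_left (mul_le_mul_of_nonneg_right (by linarith) (by linarith)) (by positivity)
      _ ≤ _ := mul_le_mul_of_nonneg_left hb2 (by positivity)
  have hL8 : L^2 ≤ L^8 := pow_le_pow_right₀ (by linarith) (by norm_num)
  have hn4 : 4 * L^2 ≤ n := by linarith [sq_nonneg L]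
  set e := 2 * L - 2 * l - 2 + ε with he
  have heL : L ≤ e := by linarith
  have he2 : e + 1 ≤ 2 * L := by linarith
  have he0 : 0 < e := by linarith
  set k := ⌊(n:ℝ) / e⌋₊ with hk
  have hk1 : (k:ℝ) ≤ n / e := Nat.floor_le (by positivity)
  have hk2 : (n:ℝ) / e < k + 1 := Nat.lt_floor_add_one _
  have hne : 2 * L ≤ n / e := by
    rw [le_div_iff₀ he0]
    have : 2 * L * e ≤ 2 * L * (2 * L) := by gcongr; linarith
    linarith [sq L]
  have hnee : (n:ℝ) / e * e = n := by field_simp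
  have hk0' : (0:ℝ) < k := by linarith
  have hk0 : 0 < k := by exact_mod_cast hk0'
  have hkL2 : (n:ℝ) ≤ k * (2 * L) := by
    have h1 : (n / e) * (e + 1) ≤ (n / e) * (2 * L) := by gcongr
    have h2 : ((n:ℝ) / e - 1) * (2 * L) ≤ k * (2 * L) := by gcongr; linarith
    linarith
  have hke : (k:ℝ) * e ≤ n := by rwa [le_div_iff₀ he0] at hk1
  have hkL : (k:ℝ) * L ≤ n := le_trans (by gcongr) hke
  have hkn : k ≤ n := by
    have : (k:ℝ) ≤ n := by
      have : (k:ℝ) * 1 ≤ k * L := by gcongr; linarith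
      linarith
    exact_mod_cast this
  refine (first_moment hk0 hkn).trans ?_
  set α : ℝ := n / k with hα
  have hαk : α * k = n := by rw [hα]; field_simp
  have hα0 : 0 < α := by positivity
  have hαe : e ≤ α := by rw [hα, le_div_iff₀ hk0']; linarith
  have hα2 : α ≤ 2 * L := by rw [hα, div_le_iff₀ hk0']; linarith
  have hlogk : Real.log k = L * lam - Real.log α := by
    rw [hα, Real.log_div hn0.ne' hk0'.ne', hlogn]; ring
  have hlog2L : Real.log (2 * L) = lam * (1 + l) := by
    rw [Real.log_mul two_ne_zero hLp.ne', hlogL]; ring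
  have ha1 : Real.log α ≤ lam * (1 + l) := by
    rw [← hlog2L]; exact Real.log_le_log hα0 hα2
  have ha2 : lam * (1 + l) - ε / 16 ≤ Real.log α := by
    have h1 : Real.log e ≤ Real.log α := Real.log_le_log he0 hαe
    have h2 : Real.log (2 * L / e) ≤ 2 * L / e - 1 := Real.log_le_sub_one_of_pos (by positivity)
    rw [Real.log_div (by positivity) he0.ne', hlog2L] at h2
    have h3 : 2 * L / e ≤ 1 + ε / 16 := by
      rw [div_le_iff₀ he0]
      have : ε / 16 * L ≤ ε / 16 * e := by gcongr
      rw [add_mul]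
      linarith
    linarith
  have hbound : (k:ℝ)^n / k.factorial * (2:ℝ)^(-(((n:ℝ)^2/k - n)/2)) ≤ 
      Real.exp (n * Real.log k - (k * Real.log k - k) - lam * ((n * α - n) / 2)) := by
    have h1 := fact_lower k
    have e1 : (k:ℝ)^n = Real.exp (n * Real.log k) := by
      rw [Real.exp_nat_mul, Real.exp_log hk0']
    have e2 : Real.exp (k * Real.log k - k) ≤ k.factorial := by
      refine le_trans (le_of_eq ?_) h1
      rw [Real.exp_sub, Real.exp_nat_mul, Real.exp_log hk0', div_pow, ← Real.exp_nat_mul, mul_one]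
    have e3 : (2:ℝ)^(-(((n:ℝ)^2/k - n)/2)) = Real.exp (- (lam * ((n * α - n) / 2))) := by
      rw [Real.rpow_def_of_pos two_pos, hα]; congr 1; rw [← hlam]; field_simp
    rw [e1, e3, sub_eq_add_neg _ (lam * _), Real.exp_add, Real.exp_sub]
    gcongr
  refine hbound.trans (Real.exp_le_exp.2 ?_)
  rw [hlogk]
  have g1 : (n:ℝ) * (lam * (1 + l) - ε / 16) ≤ n * Real.log α := by gcongr
  have g2 : n * lam ≤ k * (2 * L) * lam := by gcongr
  have g3 : k * (Real.log α + 1) ≤ ε / 16 * n := by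
    calc k * (Real.log α + 1) ≤ k * (ε / 16 * L) := by
          gcongr
          have : lam * (1 + l) ≤ 1 * (1 + l) := by gcongr; linarith
          linarith
      _ = ε / 16 * (k * L) := by ring
      _ ≤ _ := by gcongr
  have g4 : (n:ℝ) * lam * e ≤ n * lam * α := by gcongr
  have g5 : n * ε * 0.69 ≤ n * ε * lam := by gcongr
  rw [he] at g4
  have g6 : 0 < n * ε := by positivity
  nlinarith

end lowerb

open Filter

section final

lemma Pr_le_one (n : ℕ) (B : SimpleGraph (Fin n) → Prop) : Pr n B ≤ 1 := by
  unfold Pr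
  refine div_le_one_of_le₀ ?_ (by positivity)
  exact_mod_cast Nat.card_le_card_of_injective _ (Subtype.val_injective (p := B))

lemma Pr_three (n : ℕ) (A B C : SimpleGraph (Fin n) → Prop) (h : ∀ G, A G ∨ B G ∨ C G) :
    1 ≤ Pr n A + Pr n B + Pr n C := by
  classical
  have hM : (0 : ℝ) < Fintype.card (Mat n) := by
    have : 0 < Fintype.card (Mat n) := Fintype.card_pos
    exact_mod_cast this
  rw [Pr_eq', Pr_eq', Pr_eq', ← add_div, ← add_div, le_div_iff₀ hM, one_mul]
  have h1 : (Finset.univ : Finset (Mat n)) ⊆ (Finset.univ.filter fun x : Mat n => A (gr x)) ∪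
      (Finset.univ.filter fun x : Mat n => B (gr x)) ∪
      (Finset.univ.filter fun x : Mat n => C (gr x)) := by
    intro x _
    simp only [Finset.mem_union, Finset.mem_filter, Finset.mem_univ, true_and]
    have := h (gr x)
    tauto
  have h2 := Finset.card_le_card h1
  have h3 := Finset.card_union_le ((Finset.univ.filter fun x : Mat n => A (gr x)) ∪
      (Finset.univ.filter fun x : Mat n => B (gr x))) (Finset.univ.filter fun x : Mat n => C (gr x))
  have h4 := Finset.card_union_le (Finset.univ.filter fun x : Mat n => A (gr x))
      (Finset.univ.filter fun x : Mat n => B (gr x))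
  rw [Finset.card_univ] at h2
  have h5 := h2.trans (h3.trans (Nat.add_le_add_right h4 _))
  exact_mod_cast h5

lemma det_upper (N L D ε : ℝ) (hε : 0 < ε) (hL : 1 ≤ L) (hL2 : 16 ≤ ε * L) (hD : L ≤ D - ε / 2)
    (hN : 100 * L ^ 8 ≤ N) :
    N / (D - ε / 2) + 1 + 4 * N * L⁻¹ ^ 3 ≤ N / D + ε * N / L ^ 2 := by
  have hL0 : 0 < L := by linarith
  have hN0 : 0 < N := lt_of_lt_of_le (by positivity) hN
  have hD1 : 0 < D - ε / 2 := by linarith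
  have hD0 : 0 < D := by linarith
  have e1 : N / (D - ε / 2) ≤ N / D + (ε / 2) * N / L ^ 2 := by
    have : N / (D - ε / 2) - N / D = (ε / 2) * N / (D * (D - ε / 2)) := by
      rw [div_sub_div _ _ hD1.ne' hD0.ne', mul_comm D]
      congr 1
      ring
    have h2 : (ε / 2) * N / (D * (D - ε / 2)) ≤ (ε / 2) * N / L ^ 2 := by
      apply div_le_div_of_nonneg_left (by positivity) (by positivity)
      nlinarith
    linarith
  have e2 : 4 * N * L⁻¹ ^ 3 ≤ (ε / 4) * N / L ^ 2 := by
    have : 4 * N * L⁻¹ ^ 3 = (4 * N / L) / L ^ 2 := by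
      field_simp
    rw [this]
    apply div_le_div_of_nonneg_right _ (by positivity)
    rw [div_le_iff₀ hL0]
    nlinarith
  have e3 : 1 ≤ (ε / 4) * N / L ^ 2 := by
    rw [le_div_iff₀ (by positivity)]
    have h7 : (1:ℝ) ≤ L ^ 5 := one_le_pow₀ hL
    have h1 : (ε / 4) * (100 * L ^ 8) ≤ (ε / 4) * N := by gcongr
    have h2 : (ε / 4) * (100 * L ^ 8) = 25 * (ε * L) * L ^ 5 * L ^ 2 := by ring
    have h3 : 1 ≤ 25 * (ε * L) * L ^ 5 := by nlinarith
    have h4 : 1 * L ^ 2 ≤ 25 * (ε * L) * L ^ 5 * L ^ 2 := by gcongr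
    linarith
  have : ε * N / L ^ 2 = (ε / 2) * N / L ^ 2 + (ε / 4) * N / L ^ 2 + (ε / 4) * N / L ^ 2 := by ring
  linarith

lemma det_lower (N L D ε : ℝ) (hε : 0 < ε) (hL : 1 ≤ L) (hD : L ≤ D) (hN : 0 < N) :
    N / D - ε * N / L ^ 2 ≤ N / (D + ε) := by
  have hL0 : 0 < L := by linarith
  have hD0 : 0 < D := by linarith
  have : N / D - N / (D + ε) = ε * N / (D * (D + ε)) := by
    field_simp
    ring
  have h2 : ε * N / (D * (D + ε)) ≤ ε * N / L ^ 2 := by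
    apply div_le_div_of_nonneg_left (by positivity) (by positivity)
    nlinarith
  linarith

lemma colorable_of_chi_le {n k : ℕ} (G : SimpleGraph (Fin n)) (h : chi n G ≤ k) : G.Colorable k := by
  have h1 : G.Colorable (Fintype.card (Fin n)) := G.colorable_of_fintype
  have h2 : G.chromaticNumber ≠ ⊤ := SimpleGraph.chromaticNumber_ne_top_iff_exists.2 ⟨_, h1⟩
  have h3 : G.chromaticNumber = (chi n G : ℕ∞) := (ENat.natCast_toNat h2).symm
  apply SimpleGraph.chromaticNumber_le_iff_colorable.1
  rw [h3]
  exact_mod_cast h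

lemma main_bound (ε δ : ℝ) (hε : 0 < ε) (hδ : 0 < δ) (hδε : δ ≤ ε) (hδ1 : δ ≤ 1) (n : ℕ) (hn : 0 < n)
    (h1 : Big (100 + 24 / (ε / 2) + ε / 2) (Real.logb 2 n)) (h2 : Big (100 + 64 / δ) (Real.logb 2 n)) :
    1 - Real.exp (- Real.logb 2 n) - Real.exp (-(δ / 8 * n)) ≤
      Pr n (fun G => |(chi n G : ℝ) - f n| ≤ ε * n / (Real.log n) ^ 2) := by
  obtain ⟨hk, hDL, hlow⟩ := lower_asym (ε / 2) (by positivity) n hn h1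
  have hfirst := first_asym δ hδ hδ1 n hn h2
  have hε' : 0 < 24 / (ε / 2) := by positivity
  obtain ⟨-, -, hlog, -, -, hN, -⟩ := big_facts _ n (by linarith) hn h1
  have hL := h1.1
  have hf : f n = n / Dd n := rfl
  rw [hf]
  generalize hLe : Real.logb 2 (n:ℝ) = L at *
  have hn0 : (0:ℝ) < n := by exact_mod_cast hn
  have hL1 : 1 ≤ L := by linarith
  have hL0 : 0 < L := by linarith
  have hεL : 16 ≤ ε * L := by
    have : 24 / (ε / 2) ≤ L := by linarith
    rw [div_le_iff₀ (by positivity)] at this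
    nlinarith
  have hlogn : ε * n / L ^ 2 ≤ ε * n / (Real.log n) ^ 2 := by
    have l2 : 0 < Real.log 2 := Real.log_pos (by norm_num)
    have l3 : Real.log 2 ≤ 1 := by linarith [Real.log_two_lt_d9]
    rw [hlog]
    apply div_le_div_of_nonneg_left (by positivity) (by positivity)
    have : L * Real.log 2 ≤ L := by nlinarith
    gcongr
  have ht0 : 0 < L⁻¹ ^ 3 := by positivity
  have ht1 : L⁻¹ ^ 3 ≤ 1 := pow_le_one₀ (by positivity) (inv_le_one_of_one_le₀ hL1)
  have hb := boost hk (L⁻¹ ^ 3) ht0 ht1 hlow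
  have hexp : Real.exp (-(n * (L⁻¹ ^ 3) ^ 2)) ≤ Real.exp (-L) := by
    apply Real.exp_le_exp.2
    have : L ≤ n * (L⁻¹ ^ 3) ^ 2 := by
      have e : (n:ℝ) * (L⁻¹ ^ 3) ^ 2 = n / L ^ 6 := by
        field_simp
      rw [e, le_div_iff₀ (by positivity)]
      have : L * L ^ 6 * 1 ≤ L * L ^ 6 * L := by gcongr
      have h8 : 0 < L ^ 8 := by positivity
      nlinarith
    linarith
  have hd := det_upper n L (Dd n) ε hε hL1 hεL (by linarith) hN
  have hdl := det_lower n L (Dd n) δ hδ hL1 (by linarith) hn0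
  have hδn : δ * n / L ^ 2 ≤ ε * n / L ^ 2 := by gcongr
  have hceil := Nat.ceil_lt_add_one (a := (n:ℝ) / (Dd n - ε / 2)) (div_nonneg hn0.le (by linarith))
  have h3 := Pr_three n (fun G => |(chi n G : ℝ) - n / Dd n| ≤ ε * n / (Real.log n) ^ 2)
    (fun G => ¬ ((chi n G : ℝ) ≤ ⌈(n:ℝ) / (Dd n - ε / 2)⌉₊ + 4 * n * L⁻¹ ^ 3))
    (fun G => G.Colorable ⌊(n:ℝ) / (Dd n + δ)⌋₊) (by
      intro G
      by_cases hA : (chi n G : ℝ) ≤ ⌈(n:ℝ) / (Dd n - ε / 2)⌉₊ + 4 * n * L⁻¹ ^ 3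
      · by_cases hC : (chi n G : ℝ) ≤ n / (Dd n + δ)
        · right; right
          exact colorable_of_chi_le G (Nat.le_floor hC)
        · left
          push Not at hC
          rw [abs_le]
          constructor <;> linarith
      · right; left; exact hA)
  linarith

end final

/-- Whp, `χ(G(n,1/2)) = f(n) + o(n / log² n)`. -/
theorem stmt3 (ε : ℝ) (hε : 0 < ε) :
    Tendsto (fun n : ℕ =>
        Pr n (fun G => |(chi n G : ℝ) - f n| ≤ ε * n / (Real.log n) ^ 2))
      atTop (nhds 1) := by
  have hδ : 0 < min ε 1 := lt_min hε one_pos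
  have hlow : Tendsto (fun n : ℕ => 1 - Real.exp (- Real.logb 2 n) - Real.exp (-(min ε 1 / 8 * (n:ℝ))))
      atTop (nhds 1) := by
    have t1 : Tendsto (fun n : ℕ => Real.exp (- Real.logb 2 n)) atTop (nhds 0) :=
      Real.tendsto_exp_neg_atTop_nhds_zero.comp tendsto_L
    have t2 : Tendsto (fun n : ℕ => Real.exp (-(min ε 1 / 8 * (n:ℝ)))) atTop (nhds 0) :=
      Real.tendsto_exp_neg_atTop_nhds_zero.comp
        (tendsto_natCast_atTop_atTop.const_mul_atTop (by positivity))
    have := (tendsto_const_nhds (x := (1:ℝ)).sub t1).sub t2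
    simpa using this
  refine tendsto_of_tendsto_of_tendsto_of_le_of_le' hlow tendsto_const_nhds ?_
    (Eventually.of_forall fun n => Pr_le_one n _)
  filter_upwards [eventually_gt_atTop 0,
    tendsto_L.eventually (big_event (100 + 24 / (ε / 2) + ε / 2) (by positivity)),
    tendsto_L.eventually (big_event (100 + 64 / min ε 1) (by positivity))] with n hn h1 h2
  exact main_bound ε (min ε 1) hε hδ (min_le_left _ _) (min_le_right _ _) n hn h1 h2
end

section
/- Let 0 ≤ c₁ < c₂ ≤ 1 and N > 0. Then there exists an integer n ≥ N such that c₁ < x(n) < c₂. -/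
open Filter

/-- `α₀(n) = 2 log₂ n − 2 log₂ log₂ n + 2 log₂ (e/2) + 1`. -/
noncomputable def alpha0 (n : ℕ) : ℝ :=
  2 * Real.logb 2 n - 2 * Real.logb 2 (Real.logb 2 n)
    + 2 * Real.logb 2 (Real.exp 1 / 2) + 1

/-- `a(n) = ⌊α₀(n)⌋`. -/
noncomputable def aa (n : ℕ) : ℕ := ⌊alpha0 n⌋₊

/-- `μ(n) = C(n, a(n)) · 2^{−a(n)(a(n)−1)/2}`. -/
noncomputable def mu (n : ℕ) : ℝ :=
  (n.choose (aa n) : ℝ) * (2 : ℝ)⁻¹ ^ ((aa n).choose 2)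

/-- `x(n) = log μ(n) / log n`, so that `μ(n) = n^{x(n)}`. -/
noncomputable def xx (n : ℕ) : ℝ := Real.log (mu n) / Real.log n


open Topology

lemma fr_nonneg_bd : ∀ᶠ n : ℕ in atTop, 0 ≤ alpha0 n →
    0 ≤ alpha0 n - aa n ∧ alpha0 n - aa n < 1 := by
  refine Eventually.of_forall fun n h => ⟨?_, ?_⟩
  · have := Nat.floor_le h
    unfold aa; linarith
  · have := Nat.lt_floor_add_one (alpha0 n)
    unfold aa; linarith

lemma alpha0_eq (n : ℕ) (hn : 2 ≤ n) : alpha0 n = 2 / Real.log 2 *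
    (Real.log n - Real.log (Real.log n) + Real.log (Real.log 2) + 1 - Real.log 2) + 1 := by
  have h2 : 0 < Real.log 2 := Real.log_pos (by norm_num)
  have hL : 0 < Real.log n := Real.log_pos (by exact_mod_cast hn)
  unfold alpha0 Real.logb
  rw [Real.log_div hL.ne' h2.ne', Real.log_div (Real.exp_pos 1).ne' (by norm_num), Real.log_exp]
  field_simp
  ring

lemma tL : Tendsto (fun n : ℕ => Real.log n) atTop atTop :=
  Real.tendsto_log_atTop.comp tendsto_natCast_atTop_atTop

lemma tcL (c : ℝ) : Tendsto (fun n : ℕ => c / Real.log n) atTop (𝓝 0) :=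
  tL.const_div_atTop c

lemma alpha0_div : Tendsto (fun n : ℕ => alpha0 n / (2 / Real.log 2 * Real.log n)) atTop (𝓝 1) := by
  have h2 : 0 < Real.log 2 := Real.log_pos (by norm_num)
  have hll : Tendsto (fun n : ℕ => Real.log (Real.log n) / Real.log n) atTop (𝓝 0) :=
    (Real.isLittleO_log_id_atTop.tendsto_div_nhds_zero).comp tL
  have h := ((tcL (Real.log (Real.log 2) + 1 - Real.log 2 + Real.log 2 / 2)).const_add 1).sub hll
  simp only [add_zero, sub_zero] at h
  refine h.congr' ?_
  filter_upwards [eventually_ge_atTop 2] with n hn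
  have hL : 0 < Real.log n := Real.log_pos (by exact_mod_cast hn)
  rw [alpha0_eq n hn]
  field_simp
  ring

lemma alpha0_top : Tendsto alpha0 atTop atTop := by
  have h2 : 0 < Real.log 2 := Real.log_pos (by norm_num)
  have h := (tL.const_mul_atTop (by positivity : 0 < 2 / Real.log 2)).atTop_mul_pos one_pos alpha0_div
  refine h.congr' ?_
  filter_upwards [eventually_ge_atTop 2] with n hn
  have hL : 0 < Real.log n := Real.log_pos (by exact_mod_cast hn)
  field_simp

lemma th_bd : ∀ᶠ n : ℕ in atTop, 0 ≤ alpha0 n - aa n ∧ alpha0 n - aa n < 1 := by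
  filter_upwards [fr_nonneg_bd, alpha0_top.eventually_ge_atTop 0] with n h h'
  exact h h'

lemma aa_top : Tendsto aa atTop atTop := tendsto_nat_floor_atTop.comp alpha0_top

lemma aa_div : Tendsto (fun n : ℕ => (aa n : ℝ) / (2 / Real.log 2 * Real.log n)) atTop (𝓝 1) := by
  have h2 : 0 < Real.log 2 := Real.log_pos (by norm_num)
  have h := (tendsto_nat_floor_div_atTop (R := ℝ)).comp alpha0_top
  have h := h.mul alpha0_div
  rw [one_mul] at h
  refine h.congr' ?_
  filter_upwards [alpha0_top.eventually_gt_atTop 0] with n h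
  simp only [Function.comp, aa]
  field_simp

lemma aa_div_n : Tendsto (fun n : ℕ => (aa n : ℝ) / n) atTop (𝓝 0) := by
  have h2 : 0 < Real.log 2 := Real.log_pos (by norm_num)
  have hl : Tendsto (fun n : ℕ => Real.log n / n) atTop (𝓝 0) :=
    (Real.isLittleO_log_id_atTop.tendsto_div_nhds_zero).comp tendsto_natCast_atTop_atTop
  have h := aa_div.mul (hl.const_mul (2 / Real.log 2))
  simp only [mul_zero] at h
  refine h.congr' ?_
  filter_upwards [eventually_ge_atTop 2] with n hn
  have hL : 0 < Real.log n := Real.log_pos (by exact_mod_cast hn)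
  field_simp

lemma stir : Tendsto (fun a : ℕ => Real.log a.factorial / a - Real.log a + 1) atTop (𝓝 0) := by
  have h1 : Tendsto (fun a : ℕ => Real.log (Stirling.stirlingSeq a)) atTop (𝓝 (Real.log (√Real.pi))) :=
    (Real.continuousAt_log (by positivity)).tendsto.comp Stirling.tendsto_stirlingSeq_sqrt_pi
  have h2 := h1.div_atTop (tendsto_natCast_atTop_atTop (R := ℝ))
  have hl : Tendsto (fun n : ℕ => Real.log n / n) atTop (𝓝 0) :=
    (Real.isLittleO_log_id_atTop.tendsto_div_nhds_zero).comp tendsto_natCast_atTop_atTop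
  have hc : Tendsto (fun n : ℕ => (Real.log 2 / 2) / n) atTop (𝓝 0) :=
    (tendsto_natCast_atTop_atTop (R := ℝ)).const_div_atTop _
  have h := (h2.add (hl.const_mul (1/2))).add hc
  simp only [mul_zero, add_zero] at h
  refine h.congr' ?_
  filter_upwards [eventually_gt_atTop 0] with a ha
  have ha' : (0:ℝ) < a := by exact_mod_cast ha
  rw [Stirling.log_stirlingSeq_formula, Real.log_div ha'.ne' (Real.exp_pos 1).ne', Real.log_exp,
    Real.log_mul (by norm_num) ha'.ne']
  field_simp
  ring

lemma E_lim : Tendsto (fun n : ℕ => (Real.log (n.choose (aa n)) + Real.log (aa n).factorial) / aa n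
    - Real.log n) atTop (𝓝 0) := by
  have hlow : Tendsto (fun n : ℕ => Real.log (1 - (aa n : ℝ) / n)) atTop (𝓝 0) := by
    have h : Tendsto (fun n : ℕ => 1 - (aa n : ℝ) / n) atTop (𝓝 1) := by
      simpa using aa_div_n.const_sub 1
    simpa [Function.comp_def] using (Real.continuousAt_log one_ne_zero).tendsto.comp h
  have key : ∀ᶠ n : ℕ in atTop, 0 < aa n ∧ 0 < n ∧ aa n < n := by
    filter_upwards [aa_top.eventually_gt_atTop 0, eventually_gt_atTop 0,
      aa_div_n.eventually_lt_const one_pos] with n h1 h2 h3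
    refine ⟨h1, h2, ?_⟩
    rw [div_lt_one (by exact_mod_cast h2)] at h3
    exact_mod_cast h3
  have comb : ∀ n : ℕ, aa n < n → Real.log (n.choose (aa n)) + Real.log (aa n).factorial
      = Real.log (n.descFactorial (aa n)) := by
    intro n h
    have := Nat.choose_pos h.le
    rw [← Real.log_mul (by positivity) (by positivity), Nat.descFactorial_eq_factorial_mul_choose]
    push_cast
    rw [mul_comm]
  refine tendsto_of_tendsto_of_tendsto_of_le_of_le' hlow tendsto_const_nhds ?_ ?_
  · filter_upwards [key] with n ⟨h1, h2, h3⟩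
    rw [comb n h3]
    have h2' : (0:ℝ) < n := by exact_mod_cast h2
    have h1' : (0:ℝ) < aa n := by exact_mod_cast h1
    have h3' : (0:ℝ) < n - aa n := by have : (aa n : ℝ) < n := by exact_mod_cast h3
                                      linarith
    have e : 1 - (aa n : ℝ) / n = (n - aa n) / n := by field_simp
    rw [e, Real.log_div h3'.ne' h2'.ne']
    have : (aa n : ℝ) * Real.log (n - aa n) ≤ Real.log (n.descFactorial (aa n)) := by
      rw [← Real.log_pow]
      apply Real.log_le_log (by positivity)
      have := Nat.pow_sub_le_descFactorial n (aa n)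
      have h4 : (n - aa n) ^ aa n ≤ n.descFactorial (aa n) :=
        (Nat.pow_le_pow_left (by omega) _).trans this
      have h5 : (((n - aa n : ℕ) : ℝ)) ^ aa n ≤ n.descFactorial (aa n) := by exact_mod_cast h4
      rwa [Nat.cast_sub h3.le] at h5
    have : Real.log (n - aa n) ≤ Real.log (n.descFactorial (aa n)) / aa n := by
      rw [le_div_iff₀ h1']; linarith
    linarith
  · filter_upwards [key] with n ⟨h1, h2, h3⟩
    rw [comb n h3]
    have h1' : (0:ℝ) < aa n := by exact_mod_cast h1
    have : Real.log (n.descFactorial (aa n)) ≤ (aa n : ℝ) * Real.log n := by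
      rw [← Real.log_pow]
      apply Real.log_le_log
      · have := Nat.descFactorial_pos.2 h3.le
        exact_mod_cast this
      · exact_mod_cast Nat.descFactorial_le_pow n (aa n)
    have : Real.log (n.descFactorial (aa n)) / aa n ≤ Real.log n := by
      rw [div_le_iff₀ h1']; linarith
    linarith

lemma xx_lim : Tendsto (fun n : ℕ => xx n - (alpha0 n - aa n)) atTop (𝓝 0) := by
  have h2 : 0 < Real.log 2 := Real.log_pos (by norm_num)
  have hr := stir.comp aa_top
  have hlog : Tendsto (fun n : ℕ => Real.log ((aa n : ℝ) / (2 / Real.log 2 * Real.log n)))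
      atTop (𝓝 0) := by
    simpa [Function.comp_def] using (Real.continuousAt_log one_ne_zero).tendsto.comp aa_div
  have hA := (aa_div.mul ((E_lim.sub hr).sub hlog)).const_mul (2 / Real.log 2)
  have hB : Tendsto (fun n : ℕ => (alpha0 n - aa n) *
      ((aa n : ℝ) / (2 / Real.log 2 * Real.log n) - 1)) atTop (𝓝 0) := by
    have h0 : Tendsto (fun n : ℕ => (aa n : ℝ) / (2 / Real.log 2 * Real.log n) - 1) atTop (𝓝 0) := by
      simpa using aa_div.sub_const 1
    rw [tendsto_zero_iff_norm_tendsto_zero] at h0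
    refine squeeze_zero_norm' ?_ h0
    filter_upwards [th_bd] with n ⟨p, q⟩
    rw [norm_mul]
    refine mul_le_of_le_one_left (norm_nonneg _) ?_
    rw [Real.norm_eq_abs, abs_of_nonneg p]
    exact q.le
  have h := hA.add hB
  simp only [sub_zero, mul_zero, add_zero] at h
  refine h.congr' ?_
  filter_upwards [eventually_ge_atTop 2, aa_top.eventually_gt_atTop 0,
    aa_div_n.eventually_lt_const one_pos] with n hn ha h3
  have hn0 : (0:ℝ) < n := by positivity
  rw [div_lt_one hn0] at h3
  have hc : 0 < n.choose (aa n) := Nat.choose_pos (by exact_mod_cast h3.le)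
  have hL : 0 < Real.log n := Real.log_pos (by exact_mod_cast hn)
  have ha' : (0:ℝ) < aa n := by exact_mod_cast ha
  have hmu : Real.log (mu n) = Real.log (n.choose (aa n)) -
      (aa n * (aa n - 1) / 2) * Real.log 2 := by
    unfold mu
    rw [Real.log_mul (by positivity) (by positivity), Real.log_pow, Real.log_inv,
      Nat.cast_choose_two]
    ring
  simp only [Function.comp]
  unfold xx
  rw [hmu, alpha0_eq n hn, Real.log_div ha'.ne' (by positivity),
    Real.log_mul (by positivity) hL.ne', Real.log_div (by norm_num) h2.ne']
  field_simp
  ring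

lemma step : ∀ ε > 0, ∀ᶠ n : ℕ in atTop, alpha0 (n + 1) - alpha0 n < ε := by
  intro ε hε
  have h2 : 0 < Real.log 2 := Real.log_pos (by norm_num)
  have h : Tendsto (fun n : ℕ => (2 / Real.log 2) / (n:ℝ)) atTop (𝓝 0) :=
    (tendsto_natCast_atTop_atTop (R := ℝ)).const_div_atTop _
  filter_upwards [h.eventually_lt_const hε, eventually_ge_atTop 2] with n h1 hn
  refine lt_of_le_of_lt ?_ h1
  rw [alpha0_eq n hn, alpha0_eq (n+1) (by omega)]
  have hn0 : (0:ℝ) < n := by positivity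
  have hL : 0 < Real.log n := Real.log_pos (by exact_mod_cast hn)
  have hm : Real.log n ≤ Real.log ((n+1 : ℕ) : ℝ) :=
    Real.log_le_log hn0 (by push_cast; linarith)
  have hmm := Real.log_le_log hL hm
  have hs : Real.log ((n+1 : ℕ) : ℝ) - Real.log n ≤ 1 / n := by
    rw [← Real.log_div (by positivity) hn0.ne']
    refine (Real.log_le_sub_one_of_pos (by positivity)).trans (le_of_eq ?_)
    push_cast
    field_simp
    ring
  have : 2 / Real.log 2 / (n:ℝ) = 2 / Real.log 2 * (1 / n) := by ring
  rw [this]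
  have hp : 0 < 2 / Real.log 2 := by positivity
  have := mul_le_mul_of_nonneg_left (show Real.log ((n+1 : ℕ) : ℝ) - Real.log n
    - (Real.log (Real.log ((n+1 : ℕ) : ℝ)) - Real.log (Real.log n)) ≤ 1 / n by linarith) hp.le
  linarith

/-- For all `0 ≤ c₁ < c₂ ≤ 1` and `N > 0`, there is an `n ≥ N` with `c₁ < x(n) < c₂`. -/
theorem stmt4 (c₁ c₂ : ℝ) (h1 : 0 ≤ c₁) (h12 : c₁ < c₂) (h2 : c₂ ≤ 1)
    (N : ℕ) (hN : 0 < N) :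
    ∃ n : ℕ, N ≤ n ∧ c₁ < xx n ∧ xx n < c₂ := by
  set δ := (c₂ - c₁) / 4 with hδ
  have hδ0 : 0 < δ := by rw [hδ]; linarith
  obtain ⟨M, hM⟩ := eventually_atTop.1 ((step δ hδ0).and
    (xx_lim.eventually (Metric.ball_mem_nhds (0:ℝ) hδ0)))
  set K := max M N with hK
  obtain ⟨k, hk⟩ := exists_nat_gt (alpha0 K)
  have hex : ∃ n : ℕ, (k : ℝ) + (c₁ + c₂) / 2 ≤ alpha0 (K + n) := by
    obtain ⟨n, hn, hn'⟩ := ((alpha0_top.eventually_ge_atTop ((k : ℝ) + (c₁ + c₂) / 2)).and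
      (eventually_ge_atTop K)).exists
    exact ⟨n - K, by rwa [Nat.add_sub_cancel' hn']⟩
  classical
  have hs := Nat.find_spec hex
  have hm := fun m => Nat.find_min (m := m) hex
  generalize Nat.find hex = j at hs hm
  rcases j with _ | j
  · simp only [Nat.add_zero] at hs
    linarith
  have hj := hm j (Nat.lt_succ_self j)
  push Not at hj
  have hst := (hM (K + j) (by omega)).1
  have hx := (hM (K + (j + 1)) (by omega)).2
  rw [add_assoc] at hst
  have hfl : aa (K + (j + 1)) = k := by
    unfold aa
    rw [Nat.floor_eq_iff (by have : (0:ℝ) ≤ k := k.cast_nonneg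
                             linarith)]
    constructor <;> linarith
  refine ⟨K + (j + 1), by omega, ?_⟩
  rw [hfl] at hx
  simp only [Metric.mem_ball, dist_zero_right, Real.norm_eq_abs] at hx
  obtain ⟨p, q⟩ := abs_lt.1 hx
  constructor <;> linarith
end

section
/- There exist constants C > 0 and n₀ such that for all n ≥ n₀ with μ(n) ≥ 1, if X_a is the number of independent a(n)-sets in G(n,1/2) and Z ∼ Poi_{μ(n)}, then d_TV(X_a, Z) ≤ C·( μ(n)·(log n)⁴/n² + (log n)³/n ). In particular d_TV(X_a, Z) = o(1) along any sequence of n with μ(n) ≥ 1. -/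
open Filter

/-- A vertex set is independent if it spans no edges of the graph. -/
def IndepSet {n : ℕ} (G : SimpleGraph (Fin n)) (T : Finset (Fin n)) : Prop :=
  ∀ u ∈ T, ∀ v ∈ T, ¬ G.Adj u v

/-- The number of independent `k`-sets of a graph. -/
noncomputable def numIndep (n k : ℕ) (G : SimpleGraph (Fin n)) : ℕ :=
  Nat.card {T : Finset (Fin n) // T.card = k ∧ IndepSet G T}

/-- The probability mass function of the Poisson distribution with mean `lam` at `k`. -/
noncomputable def poiPMF (lam : ℝ) (k : ℕ) : ℝ :=
  Real.exp (-lam) * lam ^ k / (Nat.factorial k)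

/-- Total variation distance between the distribution (under `G(n,1/2)`) of an
`ℕ`-valued graph functional `X` and the Poisson distribution with mean `lam`:
`sup_{A ⊆ ℕ} |P(X ∈ A) − Poi_lam(A)|`. -/
noncomputable def dTVPoi (n : ℕ) (X : SimpleGraph (Fin n) → ℕ) (lam : ℝ) : ℝ :=
  ⨆ A : Set ℕ, |Pr n (fun G => X G ∈ A) - ∑' k : A, poiPMF lam k|

lemma poi_pos {lam : ℝ} (h : 0 < lam) (k : ℕ) : 0 < poiPMF lam k := by
  unfold poiPMF; positivity

lemma poi_succ (lam : ℝ) (k : ℕ) :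
    ((k : ℝ) + 1) * poiPMF lam (k + 1) = lam * poiPMF lam k := by
  unfold poiPMF
  rw [Nat.factorial_succ]
  push_cast
  have : (Nat.factorial k : ℝ) ≠ 0 := by positivity
  field_simp
  ring

lemma poi_hasSum (lam : ℝ) : HasSum (poiPMF lam) 1 := by
  have h := (NormedSpace.expSeries_div_hasSum_exp lam).mul_left (Real.exp (-lam))
  rw [← Real.exp_eq_exp_ℝ, ← Real.exp_add, neg_add_cancel, Real.exp_zero] at h
  have e : poiPMF lam = fun k => Real.exp (-lam) * (lam ^ k / (Nat.factorial k : ℝ)) := by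
    funext k
    unfold poiPMF
    rw [mul_div_assoc]
  rw [e]
  exact h

lemma poi_logconc {lam : ℝ} (h : 0 < lam) {j k : ℕ} (hjk : j ≤ k) :
    poiPMF lam j * poiPMF lam (k + 1) ≤ poiPMF lam (j + 1) * poiPMF lam k := by
  have h1 := poi_succ lam j
  have h2 := poi_succ lam k
  have p1 := poi_pos h j
  have p2 := poi_pos h k
  have p3 := poi_pos h (j+1)
  have p4 := poi_pos h (k+1)
  have hc : (j : ℝ) ≤ k := by exact_mod_cast hjk
  have e : lam * (poiPMF lam j * poiPMF lam (k + 1)) * ((k:ℝ)+1)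
      = lam * ((j:ℝ)+1) * (poiPMF lam (j+1) * poiPMF lam k) := by
    calc _ = (lam * poiPMF lam j) * (((k:ℝ)+1) * poiPMF lam (k+1)) := by ring
      _ = _ := by rw [← h1, h2]; ring
  have e2 : lam * ((j:ℝ)+1) * (poiPMF lam (j+1) * poiPMF lam k) ≤
     lam * ((k:ℝ)+1) * (poiPMF lam (j+1) * poiPMF lam k) := by gcongr
  have : (lam * ((k:ℝ)+1)) * (poiPMF lam j * poiPMF lam (k + 1)) ≤
     (lam * ((k:ℝ)+1)) * (poiPMF lam (j+1) * poiPMF lam k) := by linarith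
  exact le_of_mul_le_mul_left this (by positivity)

lemma stein_aux {lam : ℝ} (h : 0 < lam) (w : ℕ → ℝ) (h0 : ∀ k, 0 ≤ w k) (h1 : ∀ k, w k ≤ 1)
    (k : ℕ) :
    (∑ j ∈ Finset.range (k+2), poiPMF lam j * w j
        - (∑' j, poiPMF lam j * w j) * ∑ j ∈ Finset.range (k+2), poiPMF lam j) / poiPMF lam (k+1)
    - (∑ j ∈ Finset.range (k+1), poiPMF lam j * w j
        - (∑' j, poiPMF lam j * w j) * ∑ j ∈ Finset.range (k+1), poiPMF lam j) / poiPMF lam k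
     ≤ 1 := by
  have hs := poi_hasSum lam
  have hpos := poi_pos h
  have hsw : Summable (fun j => poiPMF lam j * w j) := by
    refine Summable.of_nonneg_of_le (fun j => mul_nonneg (hpos j).le (h0 j)) (fun j => ?_) hs.summable
    exact mul_le_of_le_one_right (hpos j).le (h1 j)
  have t1 := hsw.sum_add_tsum_nat_add (k+2)
  have t2 := hs.summable.sum_add_tsum_nat_add (k+2)
  have t3 := hs.summable.sum_add_tsum_nat_add (k+1)
  rw [hs.tsum_eq] at t2 t3
  have r1 := Finset.sum_range_succ (fun j => poiPMF lam j * w j) (k+1)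
  have r2 := Finset.sum_range_succ (fun j => poiPMF lam j) (k+1)
  have hb : 0 ≤ ∑' j, poiPMF lam (j+(k+2)) * w (j+(k+2)) :=
    tsum_nonneg fun j => mul_nonneg (hpos _).le (h0 _)
  have ha : 0 ≤ ∑ j ∈ Finset.range (k+1), poiPMF lam j * w j :=
    Finset.sum_nonneg fun j _ => mul_nonneg (hpos _).le (h0 _)
  have H1 : (∑' j, poiPMF lam (j+(k+2))) * poiPMF lam k
      ≤ (∑' j, poiPMF lam (j+(k+1))) * poiPMF lam (k+1) := by
    rw [← tsum_mul_right, ← tsum_mul_right]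
    refine Summable.tsum_le_tsum (fun j => ?_) ?_ ?_
    · have := poi_logconc h (j := k) (k := j+(k+1)) (by omega)
      rw [show j + (k+2) = j + (k+1) + 1 by ring]
      linarith
    · exact ((summable_nat_add_iff _).2 hs.summable).mul_right _
    · exact ((summable_nat_add_iff _).2 hs.summable).mul_right _
  have H2 : (∑ j ∈ Finset.range (k+1), poiPMF lam j) * poiPMF lam (k+1) ≤
      (∑ j ∈ Finset.range (k+2), poiPMF lam j) * poiPMF lam k := by
    rw [Finset.sum_range_succ' _ (k+1), add_mul, Finset.sum_mul, Finset.sum_mul]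
    have : ∑ i ∈ Finset.range (k+1), poiPMF lam i * poiPMF lam (k+1) ≤
       ∑ i ∈ Finset.range (k+1), poiPMF lam (i+1) * poiPMF lam k :=
      Finset.sum_le_sum fun i hi => poi_logconc h (by simp at hi; omega)
    have := mul_pos (hpos 0) (hpos k)
    linarith
  set M := ∑' j, poiPMF lam j * w j
  set b := ∑' j, poiPMF lam (j+(k+2)) * w (j+(k+2))
  set a := ∑ j ∈ Finset.range (k+1), poiPMF lam j * w j
  set u := ∑ j ∈ Finset.range (k+1), poiPMF lam j
  set ub := ∑' j, poiPMF lam (j+(k+2))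
  set ub' := ∑' j, poiPMF lam (j+(k+1))
  have hP := hpos k
  have hQ := hpos (k+1)
  have hub : 0 ≤ ub := tsum_nonneg fun j => (hpos _).le
  have hu : 0 ≤ u := Finset.sum_nonneg fun j _ => (hpos _).le
  rw [show k+2 = k+1+1 by ring, r1, r2]
  rw [show k+2 = k+1+1 by ring, r2] at t2 H2
  rw [show k+2 = k+1+1 by ring, r1] at t1
  have hw0 := h0 (k+1)
  have hw1 := h1 (k+1)
  set P := poiPMF lam k
  set Q := poiPMF lam (k+1)
  set o := w (k+1)
  have eM : M = a + Q*o + b := t1.symm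
  have eub' : ub' = ub + Q := by linarith
  have eub : ub = 1 - u - Q := by linarith
  rw [div_sub_div _ _ hQ.ne' hP.ne', div_le_one (mul_pos hQ hP)]
  have key : (a + Q * o - M * (u + Q)) * P - Q * (a - M * u)
     = a * (ub*P - ub'*Q) + o * Q * (ub*P + u*Q) - b * ((u+Q)*P - u*Q) := by
    rw [eub', eub, eM]; ring
  rw [key]
  have z1 : a * (ub*P - ub'*Q) ≤ 0 := mul_nonpos_of_nonneg_of_nonpos ha (by linarith)
  have z2 : 0 ≤ b * ((u+Q)*P - u*Q) := mul_nonneg hb (by linarith)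
  have z3 : o * Q * (ub*P + u*Q) ≤ Q * (ub*P + u*Q) := by
    have : 0 ≤ Q * (ub*P + u*Q) := by positivity
    nlinarith
  have z4 : Q * (ub*P + u*Q) ≤ Q * (ub * P + (u+Q)*P) := by gcongr
  have z5 : Q * (ub * P + (u+Q)*P) = Q * P := by rw [eub]; ring
  linarith

lemma stein_exists {lam : ℝ} (h : 0 < lam) (w : ℕ → ℝ) (h0 : ∀ k, 0 ≤ w k) (h1 : ∀ k, w k ≤ 1) :
    ∃ g : ℕ → ℝ, (∀ k : ℕ, lam * g (k+1) - k * g k = w k - ∑' j, poiPMF lam j * w j) ∧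
      ∀ x y : ℕ, |g (x+1) - g (y+1)| ≤ 1 / lam * |(x:ℝ) - y| := by
  set M := ∑' j, poiPMF lam j * w j with hM
  have hs := poi_hasSum lam
  have hpos := poi_pos h
  have hsw : Summable (fun j => poiPMF lam j * w j) := by
    refine Summable.of_nonneg_of_le (fun j => mul_nonneg (hpos j).le (h0 j)) (fun j => ?_) hs.summable
    exact mul_le_of_le_one_right (hpos j).le (h1 j)
  let f : ℕ → ℝ := fun k => (∑ j ∈ Finset.range (k+1), poiPMF lam j * w j
        - M * ∑ j ∈ Finset.range (k+1), poiPMF lam j) / poiPMF lam k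
  have hf : ∀ k, |f (k+1) - f k| ≤ 1 := by
    intro k
    rw [abs_le]
    constructor
    · have := stein_aux h (fun k => 1 - w k) (fun k => by linarith [h1 k]) (fun k => by linarith [h0 k]) k
      have e : ∑' j, poiPMF lam j * (1 - w j) = 1 - M := by
        simp_rw [mul_sub, mul_one]
        rw [hs.summable.tsum_sub hsw, hs.tsum_eq]
      rw [e] at this
      simp_rw [mul_sub, mul_one, Finset.sum_sub_distrib] at this
      have : - f (k+1) - (- f k) ≤ 1 := by
        convert this using 2
        · simp only [f]; rw [← neg_div]; congr 1; ring
        · simp only [f]; rw [← neg_div]; congr 1; ring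
      linarith
    · exact stein_aux h w h0 h1 k
  refine ⟨fun k => match k with | 0 => 0 | k+1 => f k / lam, ?_, ?_⟩
  · intro k
    cases k with
    | zero =>
      have := hpos 0
      simp [f]
      field_simp
    | succ k =>
      simp only [f]
      have e := poi_succ lam k
      have p1 := hpos k
      have p2 := hpos (k+1)
      rw [Finset.sum_range_succ _ (k+1), Finset.sum_range_succ _ (k+1)]
      have e' : poiPMF lam k = ((k:ℝ)+1) * poiPMF lam (k+1) / lam := by
        rw [e]; field_simp
      rw [e']
      push_cast
      have : (k:ℝ)+1 ≠ 0 := by positivity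
      field_simp
      ring
  · have aux : ∀ d x : ℕ, |f (x+d) - f x| ≤ d := by
      intro d
      induction d with
      | zero => intro x; simp
      | succ d ih =>
        intro x
        have := ih x
        have h2 := hf (x+d)
        push_cast
        rw [← add_assoc]
        calc _ = |(f (x+d+1) - f (x+d)) + (f (x+d) - f x)| := by ring_nf
          _ ≤ _ := (abs_add_le _ _).trans (by linarith)
    intro x y
    show |f x / lam - f y / lam| ≤ _
    rw [← sub_div, abs_div, abs_of_pos h, div_eq_inv_mul, one_div]
    refine mul_le_mul_of_nonneg_left ?_ (by positivity)
    rcases le_total x y with hxy | hxy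
    · obtain ⟨d, rfl⟩ := Nat.exists_eq_add_of_le hxy
      rw [abs_sub_comm, abs_sub_comm (x:ℝ)]
      push_cast
      simpa using aux d x
    · obtain ⟨d, rfl⟩ := Nat.exists_eq_add_of_le hxy
      push_cast
      simpa using aux d y

lemma sum_disj {E : Type*} [DecidableEq E] (D : Finset E) (f : Finset E → ℝ) (S : Finset E)
    (hS : S ⊆ D) :
    ∑ T ∈ D.powerset, f (T \ S) = 2 ^ S.card * ∑ T ∈ D.powerset with Disjoint T S, f T := by
  have hfib : ∑ T ∈ D.powerset, f (T \ S) =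
      ∑ U ∈ D.powerset with Disjoint U S, ∑ T ∈ D.powerset with T \ S = U, f (T \ S) := by
    refine (Finset.sum_fiberwise_of_maps_to (fun T hT => ?_) _).symm
    rw [Finset.mem_filter, Finset.mem_powerset]
    exact ⟨Finset.sdiff_subset.trans (Finset.mem_powerset.1 hT), Finset.sdiff_disjoint⟩
  rw [hfib, Finset.mul_sum]
  refine Finset.sum_congr rfl fun U hU => ?_
  rw [Finset.mem_filter, Finset.mem_powerset] at hU
  have : ∑ T ∈ D.powerset with T \ S = U, f (T \ S) = ∑ T ∈ D.powerset with T \ S = U, f U :=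
    Finset.sum_congr rfl fun T hT => by rw [(Finset.mem_filter.1 hT).2]
  rw [this, Finset.sum_const, nsmul_eq_mul]
  congr 1
  have hc : (D.powerset.filter (fun T => T \ S = U)).card = S.powerset.card := by
    refine Finset.card_bij' (fun T _ => T ∩ S) (fun V _ => U ∪ V) ?_ ?_ ?_ ?_
    · intro T hT; simp
    · intro V hV
      rw [Finset.mem_powerset] at hV
      rw [Finset.mem_filter, Finset.mem_powerset]
      refine ⟨Finset.union_subset hU.1 (hV.trans hS), ?_⟩
      rw [Finset.union_sdiff_distrib, Finset.sdiff_eq_self_of_disjoint hU.2,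
        Finset.sdiff_eq_empty_iff_subset.2 hV, Finset.union_empty]
    · intro T hT
      rw [← (Finset.mem_filter.1 hT).2]
      exact Finset.sdiff_union_inter T S
    · intro V hV
      rw [Finset.mem_powerset] at hV
      rw [Finset.union_inter_distrib_right, Finset.disjoint_iff_inter_eq_empty.1 hU.2,
        Finset.empty_union, Finset.inter_eq_left.2 hV]
  rw [hc, Finset.card_powerset]
  push_cast; rfl

lemma card_disj {E : Type*} [DecidableEq E] (D : Finset E) (S : Finset E)
    (hS : S ⊆ D) :
    ∑ T ∈ D.powerset, (if Disjoint T S then (1:ℝ) else 0) = 2 ^ D.card * (2⁻¹) ^ S.card := by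
  have := sum_disj D (fun _ => 1) S hS
  rw [Finset.sum_const, nsmul_eq_mul, Finset.card_powerset] at this
  push_cast at this
  rw [← Finset.sum_filter, inv_pow]
  have h2 : (2:ℝ) ^ S.card ≠ 0 := by positivity
  field_simp
  linarith

theorem chen_stein {E ι : Type*} [DecidableEq E] [DecidableEq ι] (D : Finset E) (I : Finset ι)
    (S : ι → Finset E) (m : ℕ) (hS : ∀ i ∈ I, S i ⊆ D) (hm : ∀ i ∈ I, (S i).card = m)
    (hne : 0 < I.card) (lam : ℝ) (hlam : lam = I.card * (2:ℝ)⁻¹ ^ m)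
    (B : ℝ) (hB : ∀ i ∈ I, ∑ j ∈ I with j ≠ i ∧ ¬ Disjoint (S j) (S i),
      (2:ℝ)⁻¹ ^ (S j \ S i).card ≤ B)
    (w : ℕ → ℝ) (h0 : ∀ k, 0 ≤ w k) (h1 : ∀ k, w k ≤ 1) :
    |(∑ T ∈ D.powerset, w ((I.filter fun i => Disjoint T (S i)).card)) / 2 ^ D.card
      - ∑' j, poiPMF lam j * w j| ≤ (2:ℝ)⁻¹ ^ m + B := by
  have hl : 0 < lam := by rw [hlam]; positivity
  obtain ⟨g, hg, hgl⟩ := stein_exists hl w h0 h1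
  set M := ∑' j, poiPMF lam j * w j
  set W : Finset E → ℕ := fun T => (I.filter fun i => Disjoint T (S i)).card with hW
  set p : ℝ := (2:ℝ)⁻¹ ^ m with hp
  have hp0 : 0 < p := by positivity
  have hWr : ∀ T, (W T : ℝ) = ∑ i ∈ I, if Disjoint T (S i) then (1:ℝ) else 0 := by
    intro T; simp [hW]
  have hN : (0:ℝ) < 2 ^ D.card := by positivity
  -- the Stein identity
  have e1 : ∑ T ∈ D.powerset, w (W T) - 2 ^ D.card * M
      = ∑ T ∈ D.powerset, (lam * g (W T + 1) - W T * g (W T)) := by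
    simp_rw [hg, Finset.sum_sub_distrib, Finset.sum_const, nsmul_eq_mul, Finset.card_powerset]
    push_cast; rfl
  have e2 : ∑ T ∈ D.powerset, (W T : ℝ) * g (W T)
      = ∑ i ∈ I, p * ∑ T ∈ D.powerset, g (W (T \ S i)) := by
    simp_rw [hWr, Finset.sum_mul]
    rw [Finset.sum_comm]
    refine Finset.sum_congr rfl fun i hi => ?_
    have := sum_disj D (fun T => g (W T)) (S i) (hS i hi)
    rw [this, hm i hi, ← mul_assoc, hp, inv_pow, inv_mul_cancel₀ (by positivity), one_mul,
      Finset.sum_filter]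
    refine Finset.sum_congr rfl fun T _ => ?_
    split_ifs <;> simp
  have e3 : ∑ T ∈ D.powerset, lam * g (W T + 1)
      = ∑ i ∈ I, p * ∑ T ∈ D.powerset, g (W T + 1) := by
    rw [Finset.sum_const, nsmul_eq_mul, ← mul_assoc, ← hlam, Finset.mul_sum]
  have e4 : ∑ T ∈ D.powerset, w (W T) - 2 ^ D.card * M
      = ∑ i ∈ I, p * ∑ T ∈ D.powerset, (g (W T + 1) - g (W (T \ S i))) := by
    rw [e1, Finset.sum_sub_distrib, e2, e3, ← Finset.sum_sub_distrib]
    refine Finset.sum_congr rfl fun i _ => ?_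
    rw [Finset.sum_sub_distrib]; ring
  have pt : ∀ i ∈ I, ∀ T, |g (W T + 1) - g (W (T \ S i))| ≤ 1 / lam *
      ((if Disjoint T (S i) then (1:ℝ) else 0) + ∑ j ∈ I with j ≠ i ∧ ¬ Disjoint (S j) (S i),
        if Disjoint T (S j \ S i) then (1:ℝ) else 0) := by
    intro i hi T
    have hd : ∀ j, Disjoint (T \ S i) (S j) ↔ Disjoint T (S j \ S i) := by
      intro j
      simp only [Finset.disjoint_left, Finset.mem_sdiff]
      tauto
    have hW1 : 1 ≤ W (T \ S i) := by
      refine Finset.card_pos.2 ⟨i, Finset.mem_filter.2 ⟨hi, Finset.sdiff_disjoint⟩⟩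
    obtain ⟨y, hy⟩ := Nat.exists_eq_add_of_le' hW1
    rw [hy]
    refine (hgl _ _).trans ?_
    refine mul_le_mul_of_nonneg_left ?_ (by positivity)
    have hy' : (y:ℝ) = W (T \ S i) - 1 := by rw [hy]; push_cast; ring
    rw [hy', hWr, hWr]
    rw [← Finset.add_sum_erase I _ hi, ← Finset.add_sum_erase I (fun j => if Disjoint (T \ S i) (S j) then (1:ℝ) else 0) hi]
    rw [if_pos (Finset.sdiff_disjoint : Disjoint (T \ S i) (S i))]
    have hfe : (I.filter fun j => j ≠ i ∧ ¬ Disjoint (S j) (S i)) =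
        (I.erase i).filter fun j => ¬ Disjoint (S j) (S i) := by
      ext j; simp only [Finset.mem_filter, Finset.mem_erase]; tauto
    rw [hfe, Finset.sum_filter]
    have hsum : |∑ j ∈ I.erase i, (if Disjoint T (S j) then (1:ℝ) else 0) -
        ∑ j ∈ I.erase i, (if Disjoint (T \ S i) (S j) then (1:ℝ) else 0)| ≤
        ∑ j ∈ I.erase i, (if ¬ Disjoint (S j) (S i) then
          (if Disjoint T (S j \ S i) then (1:ℝ) else 0) else 0) := by
      rw [← Finset.sum_sub_distrib]
      refine (Finset.abs_sum_le_sum_abs _ _).trans (Finset.sum_le_sum fun j _ => ?_)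
      simp only [hd]
      by_cases hji : Disjoint (S j) (S i)
      · rw [Finset.sdiff_eq_self_of_disjoint hji]; simp [hji]
      · have : Disjoint T (S j) → Disjoint T (S j \ S i) :=
          fun h => h.mono_right Finset.sdiff_subset
        by_cases h1 : Disjoint T (S j)
        · simp [hji, h1, this h1]
        · by_cases h2 : Disjoint T (S j \ S i) <;> simp [hji, h1, h2]
    have hI : (0:ℝ) ≤ (if Disjoint T (S i) then (1:ℝ) else 0) := by split_ifs <;> norm_num
    rw [abs_le] at hsum ⊢
    constructor <;> linarith [hsum.1, hsum.2]
  have per : ∀ i ∈ I, |p * ∑ T ∈ D.powerset, (g (W T + 1) - g (W (T \ S i)))| ≤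
      p * (1 / lam * (2 ^ D.card * (p + B))) := by
    intro i hi
    rw [abs_mul, abs_of_pos hp0]
    refine mul_le_mul_of_nonneg_left ?_ hp0.le
    refine (Finset.abs_sum_le_sum_abs _ _).trans ?_
    refine (Finset.sum_le_sum fun T _ => pt i hi T).trans ?_
    rw [← Finset.mul_sum]
    refine mul_le_mul_of_nonneg_left ?_ (by positivity)
    rw [Finset.sum_add_distrib, card_disj D _ (hS i hi), hm i hi, Finset.sum_comm, mul_add]
    refine add_le_add le_rfl ?_
    have : ∀ j ∈ I.filter (fun j => j ≠ i ∧ ¬ Disjoint (S j) (S i)),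
        ∑ T ∈ D.powerset, (if Disjoint T (S j \ S i) then (1:ℝ) else 0) =
        2 ^ D.card * (2⁻¹) ^ (S j \ S i).card := fun j hj =>
      card_disj D _ (Finset.sdiff_subset.trans (hS j (Finset.mem_filter.1 hj).1))
    rw [Finset.sum_congr rfl this, ← Finset.mul_sum]
    exact mul_le_mul_of_nonneg_left (hB i hi) hN.le
  have tot : |∑ T ∈ D.powerset, w (W T) - 2 ^ D.card * M| ≤ 2 ^ D.card * (p + B) := by
    rw [e4]
    refine (Finset.abs_sum_le_sum_abs _ _).trans ((Finset.sum_le_sum per).trans ?_)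
    rw [Finset.sum_const, nsmul_eq_mul, ← mul_assoc, ← hlam, ← mul_assoc, mul_one_div_cancel hl.ne',
      one_mul]
  rw [div_sub' hN.ne', abs_div, abs_of_pos hN, div_le_iff₀ hN]
  linarith

/-- The set of pairs inside a vertex set. -/
def edS {n : ℕ} (T : Finset (Fin n)) : Finset (Sym2 (Fin n)) := T.offDiag.image Sym2.mk.uncurry

lemma mem_edS {n : ℕ} (T : Finset (Fin n)) (u v : Fin n) :
    s(u, v) ∈ edS T ↔ u ∈ T ∧ v ∈ T ∧ u ≠ v := by
  unfold edS
  simp only [Finset.mem_image, Finset.mem_offDiag, Prod.exists, Function.uncurry_apply_pair,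
    Sym2.eq_iff]
  constructor
  · rintro ⟨x, y, ⟨hx, hy, hxy⟩, (⟨rfl, rfl⟩ | ⟨rfl, rfl⟩)⟩
    · exact ⟨hx, hy, hxy⟩
    · exact ⟨hy, hx, hxy.symm⟩
  · rintro ⟨hu, hv, huv⟩
    exact ⟨u, v, ⟨hu, hv, huv⟩, Or.inl ⟨rfl, rfl⟩⟩

lemma card_edS {n : ℕ} (T : Finset (Fin n)) : (edS T).card = T.card.choose 2 :=
  Sym2.card_image_offDiag T

lemma edS_inter {n : ℕ} (T U : Finset (Fin n)) : edS T ∩ edS U = edS (T ∩ U) := by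
  ext e
  induction e using Sym2.ind with
  | _ u v =>
    simp only [Finset.mem_inter, mem_edS]; tauto

lemma edS_sub {n : ℕ} (T : Finset (Fin n)) : edS T ⊆ edS (Finset.univ : Finset (Fin n)) := by
  intro e
  induction e using Sym2.ind with
  | _ u v =>
    simp only [mem_edS, Finset.mem_univ]; tauto

open Classical in
lemma indep_iff {n : ℕ} (G : SimpleGraph (Fin n)) (T : Finset (Fin n)) :
    IndepSet G T ↔ Disjoint G.edgeFinset (edS T) := by
  rw [Finset.disjoint_left]
  constructor
  · intro h e
    induction e using Sym2.ind with
    | _ u v =>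
      rw [SimpleGraph.mem_edgeFinset, SimpleGraph.mem_edgeSet, mem_edS]
      intro huv hh
      exact h u hh.1 v hh.2.1 huv
  · intro h u hu v hv huv
    refine h (a := s(u, v)) ?_ ((mem_edS _ _ _).2 ⟨hu, hv, huv.ne⟩)
    rw [SimpleGraph.mem_edgeFinset, SimpleGraph.mem_edgeSet]; exact huv

open Classical in
lemma sum_graph (n : ℕ) (F : Finset (Sym2 (Fin n)) → ℝ) :
    ∑ G : SimpleGraph (Fin n), F G.edgeFinset
      = ∑ T ∈ (edS (Finset.univ : Finset (Fin n))).powerset, F T := by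
  refine Finset.sum_bij' (fun G _ => G.edgeFinset) (fun T _ => SimpleGraph.fromEdgeSet (T : Set (Sym2 (Fin n))))
    ?_ ?_ ?_ ?_ ?_
  · intro G _
    rw [Finset.mem_powerset]
    intro e
    induction e using Sym2.ind with
    | _ u v =>
      rw [SimpleGraph.mem_edgeFinset, SimpleGraph.mem_edgeSet, mem_edS]
      intro h; exact ⟨Finset.mem_univ _, Finset.mem_univ _, h.ne⟩
  · intro T _; exact Finset.mem_univ _
  · intro G _
    simp
  · intro T hT
    rw [Finset.mem_powerset] at hT
    ext e
    induction e using Sym2.ind with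
    | _ u v =>
      refine (@Set.mem_toFinset _ (SimpleGraph.fromEdgeSet (T : Set (Sym2 (Fin n)))).edgeSet (_) _).trans ?_
      rw [SimpleGraph.mem_edgeSet, SimpleGraph.fromEdgeSet_adj]
      constructor
      · intro h; exact_mod_cast h.1
      · intro h; exact ⟨by exact_mod_cast h, ((mem_edS _ _ _).1 (hT h)).2.2⟩
  · intro G _; rfl

open Classical in
lemma numIndep_eq (n k : ℕ) (G : SimpleGraph (Fin n)) :
    numIndep n k G = ((Finset.powersetCard k Finset.univ).filter
      fun i => Disjoint G.edgeFinset (edS i)).card := by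
  unfold numIndep
  rw [Nat.card_eq_fintype_card, Fintype.card_subtype]
  congr 1
  ext T
  simp [Finset.mem_powersetCard, indep_iff]

open Classical in
lemma Pr_eq_s6 (n k : ℕ) (A : Set ℕ) :
    Pr n (fun G => numIndep n k G ∈ A) =
    (∑ T ∈ (edS (Finset.univ : Finset (Fin n))).powerset,
      (A.indicator (fun _ => (1:ℝ))) (((Finset.powersetCard k Finset.univ).filter
        fun i => Disjoint T (edS i)).card)) / 2 ^ (edS (Finset.univ : Finset (Fin n))).card := by
  unfold Pr
  congr 1
  · rw [← sum_graph n (fun T => (A.indicator (fun _ => (1:ℝ))) (((Finset.powersetCard k Finset.univ).filter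
        fun i => Disjoint T (edS i)).card))]
    rw [Nat.card_eq_fintype_card, Fintype.card_subtype, Finset.card_filter]
    push_cast
    refine Finset.sum_congr rfl fun G _ => ?_
    rw [numIndep_eq]
    simp [Set.indicator_apply]
  · have := sum_graph n (fun _ => 1)
    simp at this
    rw [Nat.card_eq_fintype_card]
    exact_mod_cast this

/-- The weighted number of sets overlapping in `l` vertices. -/
noncomputable def Fl (n a l : ℕ) : ℝ :=
  (a.choose l : ℝ) * ((n - a).choose (a - l) : ℝ) * (2:ℝ)⁻¹ ^ (a.choose 2 - l.choose 2)

lemma overlap_count {n a l : ℕ} (α : Finset (Fin n)) (hα : α.card = a) :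
    ((Finset.powersetCard a (Finset.univ : Finset (Fin n))).filter
      fun β => (β ∩ α).card = l).card ≤ a.choose l * (n - a).choose (a - l) := by
  have : ((Finset.powersetCard l α) ×ˢ (Finset.powersetCard (a-l) αᶜ)).card
      = a.choose l * (n - a).choose (a - l) := by
    rw [Finset.card_product, Finset.card_powersetCard, Finset.card_powersetCard,
      Finset.card_compl, hα, Fintype.card_fin]
  rw [← this]
  refine Finset.card_le_card_of_injOn (fun β => (β ∩ α, β \ α)) ?_ ?_
  · intro β hβ
    simp only [Finset.coe_filter, Finset.mem_powersetCard, Finset.subset_univ, true_and,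
      Set.mem_ofPred_eq] at hβ
    simp only [Finset.coe_product, Set.mem_prod, Finset.mem_coe, Finset.mem_powersetCard]
    refine ⟨⟨Finset.inter_subset_right, hβ.2⟩, ?_, ?_⟩
    · intro x hx; simp only [Finset.mem_sdiff, Finset.mem_compl] at hx ⊢; exact hx.2
    · have := Finset.card_sdiff_add_card_inter β α
      omega
  · intro β _ γ _ h
    simp only [Prod.mk.injEq] at h
    rw [← Finset.sdiff_union_inter β α, ← Finset.sdiff_union_inter γ α, h.1, h.2]

lemma overlap_sum {n a : ℕ} (α : Finset (Fin n)) (hα : α.card = a) :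
    ∑ β ∈ Finset.powersetCard a (Finset.univ : Finset (Fin n)) with
      β ≠ α ∧ ¬ Disjoint (edS β) (edS α), (2:ℝ)⁻¹ ^ (edS β \ edS α).card
    ≤ ∑ l ∈ Finset.Ico 2 a, Fl n a l := by
  rw [← Finset.sum_fiberwise_of_maps_to (t := Finset.Ico 2 a) (g := fun β => (β ∩ α).card)]
  · refine Finset.sum_le_sum fun l hl => ?_
    have hle : ((Finset.powersetCard a (Finset.univ : Finset (Fin n))).filter
        (fun β => β ≠ α ∧ ¬ Disjoint (edS β) (edS α))).filter (fun β => (β ∩ α).card = l)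
        ⊆ (Finset.powersetCard a (Finset.univ : Finset (Fin n))).filter
      fun β => (β ∩ α).card = l := by
      intro β; simp only [Finset.mem_filter]; tauto
    refine (Finset.sum_le_sum_of_subset_of_nonneg hle fun _ _ _ => by positivity).trans ?_
    have : ∀ β ∈ (Finset.powersetCard a (Finset.univ : Finset (Fin n))).filter
      (fun β => (β ∩ α).card = l), (2:ℝ)⁻¹ ^ (edS β \ edS α).card
        = (2:ℝ)⁻¹ ^ (a.choose 2 - l.choose 2) := by
      intro β hβ
      simp only [Finset.mem_filter, Finset.mem_powersetCard, Finset.subset_univ, true_and] at hβ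
      congr 1
      have := Finset.card_sdiff_add_card_inter (edS β) (edS α)
      rw [edS_inter, card_edS, card_edS, hβ.1, hβ.2] at this
      omega
    rw [Finset.sum_congr rfl this, Finset.sum_const, nsmul_eq_mul]
    unfold Fl
    refine mul_le_mul_of_nonneg_right ?_ (by positivity)
    exact_mod_cast overlap_count α hα
  · intro β hβ
    simp only [Finset.mem_filter, Finset.mem_powersetCard, Finset.subset_univ, true_and] at hβ
    rw [Finset.mem_Ico]
    obtain ⟨hc, hne, hd⟩ := hβ
    constructor
    · rw [Finset.disjoint_iff_inter_eq_empty, edS_inter, ← Finset.card_eq_zero, card_edS,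
        Nat.choose_eq_zero_iff] at hd
      omega
    · by_contra hlt
      push Not at hlt
      have h1 : β ∩ α = β := Finset.eq_of_subset_of_card_le Finset.inter_subset_left (by omega)
      have h2 : β ∩ α = α := Finset.eq_of_subset_of_card_le Finset.inter_subset_right (by omega)
      exact hne (h1.symm.trans h2)

theorem dTV_bound (n a : ℕ) (ha : a ≤ n) :
    dTVPoi n (fun G => numIndep n a G) ((n.choose a : ℝ) * (2 : ℝ)⁻¹ ^ (a.choose 2)) ≤
      (2 : ℝ)⁻¹ ^ (a.choose 2) + ∑ l ∈ Finset.Ico 2 a, Fl n a l := by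
  unfold dTVPoi
  refine ciSup_le fun A => ?_
  have hc : (Finset.powersetCard a (Finset.univ : Finset (Fin n))).card = n.choose a := by
    rw [Finset.card_powersetCard, Finset.card_univ, Fintype.card_fin]
  have := chen_stein (edS (Finset.univ : Finset (Fin n)))
    (Finset.powersetCard a (Finset.univ : Finset (Fin n))) edS (a.choose 2)
    (fun i _ => edS_sub i) (fun i hi => by rw [card_edS, (Finset.mem_powersetCard.1 hi).2])
    (by rw [hc]; exact Nat.choose_pos ha)
    ((n.choose a : ℝ) * (2 : ℝ)⁻¹ ^ (a.choose 2)) (by rw [hc])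
    (∑ l ∈ Finset.Ico 2 a, Fl n a l) (fun i hi => overlap_sum i (Finset.mem_powersetCard.1 hi).2)
    (A.indicator fun _ => 1) (fun k => Set.indicator_nonneg (fun _ _ => zero_le_one) _)
    (fun k => Set.indicator_le_self' (fun _ _ => zero_le_one) _)
  have e : ∑' k : A, poiPMF ((n.choose a : ℝ) * (2 : ℝ)⁻¹ ^ (a.choose 2)) k =
      ∑' j, poiPMF ((n.choose a : ℝ) * (2 : ℝ)⁻¹ ^ (a.choose 2)) j * A.indicator (fun _ => 1) j := by
    rw [tsum_subtype A (fun k => poiPMF ((n.choose a : ℝ) * (2 : ℝ)⁻¹ ^ (a.choose 2)) k)]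
    refine tsum_congr fun k => ?_
    by_cases hk : k ∈ A <;> simp [hk]
  rw [Pr_eq_s6, e]
  convert this

lemma Fl_low {n a l : ℕ} (hla : l ≤ a) (han : 2 * a ≤ n) (ha : 0 < a) :
    Fl n a l ≤ ((n.choose a : ℝ) * (2 : ℝ)⁻¹ ^ (a.choose 2)) *
      ((2 * (a:ℝ)^2 / n) ^ l * 2 ^ (l.choose 2)) := by
  unfold Fl
  have hn : (0:ℝ) < n := by exact_mod_cast (by omega : 0 < n)
  have h1 : ((n - a).choose (a - l) : ℝ) ≤ ((n-l).choose (a-l) : ℝ) := by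
    exact_mod_cast Nat.choose_le_choose _ (by omega)
  have h2 : (n.choose a : ℝ) * (a.choose l : ℝ) = (n.choose l : ℝ) * ((n-l).choose (a-l) : ℝ) := by
    exact_mod_cast Nat.choose_mul hla
  have hf : (1:ℝ) ≤ (Nat.factorial l : ℝ) := by exact_mod_cast Nat.one_le_iff_ne_zero.2 (Nat.factorial_ne_zero l)
  have h3 : (a.choose l : ℝ) ≤ (a:ℝ)^l / (Nat.factorial l) := Nat.choose_le_pow_div l a
  have h4 : ((n:ℝ)/2)^l / (Nat.factorial l) ≤ (n.choose l : ℝ) := by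
    refine le_trans ?_ (Nat.pow_le_choose l n)
    gcongr
    have : n ≤ 2 * (n + 1 - l) := by omega
    have : (n:ℝ) ≤ 2 * ((n + 1 - l : ℕ) : ℝ) := by exact_mod_cast this
    linarith
  have hcn : (0:ℝ) < (n.choose l : ℝ) := by exact_mod_cast Nat.choose_pos (by omega)
  have h5 : (2:ℝ)⁻¹ ^ (a.choose 2 - l.choose 2) = (2:ℝ)⁻¹ ^ (a.choose 2) * 2 ^ (l.choose 2) := by
    have : l.choose 2 ≤ a.choose 2 := Nat.choose_le_choose _ hla
    obtain ⟨d, hd⟩ := Nat.exists_eq_add_of_le this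
    rw [hd, Nat.add_sub_cancel_left, pow_add]
    have : (2:ℝ)⁻¹ ^ (l.choose 2) * 2 ^ (l.choose 2) = 1 := by rw [← mul_pow]; norm_num
    linear_combination (-(2:ℝ)⁻¹ ^ d) * this
  have h6 : (a.choose l : ℝ) * (a.choose l : ℝ) ≤ (2 * (a:ℝ)^2 / n) ^ l * (n.choose l : ℝ) := by
    calc (a.choose l : ℝ) * (a.choose l : ℝ) ≤ ((a:ℝ)^l / (Nat.factorial l)) * ((a:ℝ)^l / (Nat.factorial l)) := by gcongr
      _ ≤ ((a:ℝ)^l / (Nat.factorial l)) * ((a:ℝ)^l) := by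
          gcongr
          exact div_le_self (by positivity) hf
      _ = (2 * (a:ℝ)^2 / n) ^ l * (((n:ℝ)/2)^l / (Nat.factorial l)) := by
          rw [div_pow, div_pow, mul_pow, ← pow_mul]
          field_simp
          ring
      _ ≤ _ := by gcongr
  have h7 : (a.choose l : ℝ) * ((n-l).choose (a-l) : ℝ) ≤ (n.choose a : ℝ) * (2 * (a:ℝ)^2 / n) ^ l := by
    refine le_of_mul_le_mul_left ?_ hcn
    calc (n.choose l : ℝ) * ((a.choose l : ℝ) * ((n-l).choose (a-l) : ℝ))
        = (n.choose a : ℝ) * ((a.choose l : ℝ) * (a.choose l : ℝ)) := by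
          linear_combination (-(a.choose l : ℝ)) * h2
      _ ≤ (n.choose a : ℝ) * ((2 * (a:ℝ)^2 / n) ^ l * (n.choose l : ℝ)) := by gcongr
      _ = _ := by ring
  rw [h5]
  calc _ ≤ ((a.choose l : ℝ) * ((n-l).choose (a-l) : ℝ)) * ((2:ℝ)⁻¹ ^ (a.choose 2) * 2 ^ (l.choose 2)) := by gcongr
    _ ≤ ((n.choose a : ℝ) * (2 * (a:ℝ)^2 / n) ^ l) * ((2:ℝ)⁻¹ ^ (a.choose 2) * 2 ^ (l.choose 2)) := by gcongr
    _ = _ := by ring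

lemma choose_two_add (k l : ℕ) : (k+l).choose 2 = k.choose 2 + l.choose 2 + k * l := by
  induction l with
  | zero => simp
  | succ l ih =>
    rw [← add_assoc, Nat.choose_succ_succ' (k+l) 1, ih, Nat.choose_succ_succ' l 1]
    simp; ring

lemma two_choose (m : ℕ) : 2 * (m+1).choose 2 = m * (m+1) := by
  induction m with
  | zero => simp
  | succ m ih =>
    rw [Nat.choose_succ_succ' (m+1) 1, mul_add, ih]; simp; ring

lemma Fl_high {n l m : ℕ} :
    Fl n (l+(m+1)) l ≤ (((l+(m+1) : ℕ):ℝ) * n * (2:ℝ)⁻¹ ^ (l+m)) ^ (m+1) * 2 ^ ((m+1).choose 2) := by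
  unfold Fl
  set a := l + (m+1) with ha
  have h1 : (a.choose l : ℝ) ≤ (a:ℝ)^(m+1) := by
    rw [ha, Nat.choose_symm_add]
    exact_mod_cast Nat.choose_le_pow _ _
  have h2 : ((n - a).choose (a - l) : ℝ) ≤ (n:ℝ)^(m+1) := by
    rw [show a - l = m+1 by omega]
    exact_mod_cast (Nat.choose_le_pow _ _).trans (Nat.pow_le_pow_left (Nat.sub_le _ _) _)
  have h3 : (2:ℝ)⁻¹ ^ (a.choose 2 - l.choose 2) = ((2:ℝ)⁻¹ ^ (l+m)) ^ (m+1) * 2 ^ ((m+1).choose 2) := by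
    have e : a.choose 2 - l.choose 2 = (m+1).choose 2 + l * (m+1) := by
      rw [ha, choose_two_add]; omega
    have e2 : (l+m)*(m+1) = (m+1).choose 2 + l * (m+1) + (m+1).choose 2 := by
      have := two_choose m
      nlinarith
    rw [e, ← pow_mul, e2, pow_add _ _ ((m+1).choose 2), mul_assoc, ← mul_pow _ _ ((m+1).choose 2)]
    norm_num
  rw [h3]
  calc _ ≤ ((a:ℝ)^(m+1) * (n:ℝ)^(m+1)) * (((2:ℝ)⁻¹ ^ (l+m)) ^ (m+1) * 2 ^ ((m+1).choose 2)) := by gcongr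
    _ = _ := by rw [mul_pow, mul_pow]; ring

lemma pow_aux {y : ℝ} (hy : 0 ≤ y) {m : ℕ} (h : y^2 * 2^(m+1) ≤ 1/4) :
    y^m * 2 ^ ((m+1).choose 2) ≤ (1/2)^m := by
  refine (sq_le_sq₀ (by positivity) (by positivity)).1 ?_
  have e : (y^m * 2 ^ ((m+1).choose 2))^2 = (y^2 * 2^(m+1))^m := by
    rw [mul_pow, mul_pow, ← pow_mul, ← pow_mul, ← pow_mul, ← pow_mul,
      mul_comm ((m+1).choose 2) 2, two_choose, mul_comm m 2, mul_comm m (m+1)]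
  rw [e, ← pow_mul, mul_comm m 2, pow_mul]
  refine pow_le_pow_left₀ (by positivity) (h.trans (by norm_num)) _

lemma sum_Fl {n a : ℕ} (q : ℝ) (hq : q = a * n * (2:ℝ)⁻¹ ^ (a-1)) (ha : 2 ≤ a)
    (h1 : 64 * (a:ℝ)^4 ≤ n) (h2 : (2:ℝ)^a ≤ (n:ℝ)^2) (h3 : q^2 * n ≤ 1/4) :
    ∑ l ∈ Finset.Ico 2 a, Fl n a l ≤
      16 * ((n.choose a : ℝ) * (2 : ℝ)⁻¹ ^ (a.choose 2)) * (a:ℝ)^4 / (n:ℝ)^2 + 2 * q := by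
  set μ := (n.choose a : ℝ) * (2 : ℝ)⁻¹ ^ (a.choose 2) with hμ
  have hμ0 : 0 ≤ μ := by positivity
  have hq0 : 0 ≤ q := by rw [hq]; positivity
  have hn1 : 64 * a^4 ≤ n := by exact_mod_cast h1
  have han : 2 * a ≤ n := by nlinarith [Nat.pow_le_pow_right (show 0 < a by omega) (show 1 ≤ 4 by norm_num)]
  have hn : (0:ℝ) < n := by exact_mod_cast (by omega : 0 < n)
  have hhalf : ∀ l : ℕ, 2 * l ≤ a → (2:ℝ)^l ≤ n := by
    intro l hl
    refine (sq_le_sq₀ (by positivity) hn.le).1 ?_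
    rw [← pow_mul]
    exact (pow_le_pow_right₀ (by norm_num) (by omega)).trans h2
  have key : ∀ l ∈ Finset.Ico 2 a, Fl n a l ≤
      (8 * μ * (a:ℝ)^4 / (n:ℝ)^2) * (1/2)^(l-2) + q * (1/2)^(a-1-l) := by
    intro l hl
    rw [Finset.mem_Ico] at hl
    rcases le_or_gt (2*l) a with hla | hla
    · obtain ⟨m, rfl⟩ := Nat.exists_eq_add_of_le' hl.1
      have f := Fl_low (n := n) (a := a) (l := m+2) hl.2.le han (by omega)
      set x : ℝ := 2 * (a:ℝ)^2 / n with hx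
      have hx0 : 0 ≤ x := by positivity
      have hp : (2*x)^m * 2^((m+1).choose 2) ≤ (1/2)^m := by
        refine pow_aux (by positivity) ?_
        have : (2:ℝ)^(m+1) ≤ n :=
          (pow_le_pow_right₀ (by norm_num) (by omega)).trans (hhalf _ hla)
        calc (2*x)^2 * 2^(m+1) ≤ (2*x)^2 * n := by gcongr
          _ = 16 * (a:ℝ)^4 / n := by rw [hx]; field_simp; ring
          _ ≤ 1/4 := by rw [div_le_iff₀ hn]; linarith
      have e : x^(m+2) * 2 ^ ((m+2).choose 2) = 2 * x^2 * ((2*x)^m * 2^((m+1).choose 2)) := by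
        rw [Nat.choose_succ_succ' (m+1) 1, mul_pow]; simp only [Nat.choose_one_right]; ring
      rw [e] at f
      have e2 : 8 * μ * (a:ℝ)^4 / (n:ℝ)^2 = μ * (2 * x^2) := by rw [hx]; field_simp; ring
      have : 0 ≤ q * (1/2)^(a-1-(m+2)) := by positivity
      rw [e2, Nat.add_sub_cancel]
      calc _ ≤ μ * (2 * x^2 * ((2*x)^m * 2^((m+1).choose 2))) := f
        _ ≤ μ * (2 * x^2 * (1/2)^m) := by gcongr
        _ ≤ _ := by linarith
    · obtain ⟨m, hm⟩ := Nat.exists_eq_add_of_le (show l + 1 ≤ a by omega)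
      have ham : a = l + (m+1) := by omega
      have f : Fl n a l ≤ q ^ (m+1) * 2 ^ ((m+1).choose 2) := by
        have := Fl_high (n := n) (l := l) (m := m)
        rw [← ham] at this
        rw [hq, show a - 1 = l + m by omega]; exact this
      have hp : q^m * 2^((m+1).choose 2) ≤ (1/2)^m := by
        refine pow_aux hq0 ?_
        have : (2:ℝ)^(m+1) ≤ n := hhalf _ (by omega)
        calc _ ≤ q^2 * n := by gcongr
          _ ≤ _ := h3
      have : 0 ≤ (8 * μ * (a:ℝ)^4 / (n:ℝ)^2) * (1/2)^(l-2) := by positivity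
      rw [show a - 1 - l = m by omega]
      calc _ ≤ q ^ (m+1) * 2 ^ ((m+1).choose 2) := f
        _ = q * (q^m * 2^((m+1).choose 2)) := by ring
        _ ≤ q * (1/2)^m := by gcongr
        _ ≤ _ := by linarith
  refine (Finset.sum_le_sum key).trans ?_
  rw [Finset.sum_add_distrib, ← Finset.mul_sum, ← Finset.mul_sum,
    Finset.sum_Ico_eq_sum_range, Finset.sum_Ico_eq_sum_range]
  have s1 : ∑ k ∈ Finset.range (a-2), ((1:ℝ)/2)^(2+k-2) ≤ 2 := by
    simp_rw [Nat.add_sub_cancel_left]; exact sum_geometric_two_le _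
  have s2 : ∑ k ∈ Finset.range (a-2), ((1:ℝ)/2)^(a-1-(2+k)) ≤ 2 := by
    have : ∀ k, a - 1 - (2+k) = a - 2 - 1 - k := by intro k; omega
    simp_rw [this]
    rw [Finset.sum_range_reflect (fun k => ((1:ℝ)/2)^k)]
    exact sum_geometric_two_le _
  calc _ ≤ (8 * μ * (a:ℝ)^4 / (n:ℝ)^2) * 2 + q * 2 := by gcongr
    _ = _ := by ring

lemma p_le_q {n a : ℕ} (ha : 2 ≤ a) (hn : 1 ≤ n) :
    (2:ℝ)⁻¹ ^ (a.choose 2) ≤ a * n * (2:ℝ)⁻¹ ^ (a-1) := by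
  have h : (2:ℝ)⁻¹ ^ (a.choose 2) ≤ (2:ℝ)⁻¹ ^ (a-1) := by
    refine pow_le_pow_of_le_one (by norm_num) (by norm_num) ?_
    obtain ⟨m, rfl⟩ := Nat.exists_eq_add_of_le' ha
    rw [Nat.choose_succ_succ' (m+1) 1]; simp
  have h1 : (1:ℝ) ≤ a := by exact_mod_cast (by omega : 1 ≤ a)
  have h2 : (1:ℝ) ≤ n := by exact_mod_cast hn
  have : (1:ℝ) ≤ a * n := by nlinarith
  have h3 : (0:ℝ) ≤ (2:ℝ)⁻¹ ^ (a-1) := by positivity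
  nlinarith

lemma two_rpow_alpha0 {n : ℕ} (hn : 1 ≤ n) (hx : 0 < Real.logb 2 n) :
    (2:ℝ) ^ (alpha0 n) = (Real.exp 1)^2 * (n:ℝ)^2 / (2 * (Real.logb 2 n)^2) := by
  have hn0 : (0:ℝ) < n := by exact_mod_cast hn
  have e1 : alpha0 n = Real.logb 2 ((Real.exp 1)^2 * (n:ℝ)^2 / (2 * (Real.logb 2 n)^2)) := by
    have he : (0:ℝ) < Real.exp 1 := Real.exp_pos 1
    unfold alpha0
    rw [Real.logb_div he.ne' (by norm_num), Real.logb_div (by positivity) (by positivity), Real.logb_mul (by positivity) (by positivity),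
      Real.logb_mul (by positivity) (by positivity), Real.logb_pow, Real.logb_pow, Real.logb_pow,
      Real.logb_self_eq_one (by norm_num)]
    push_cast
    ring
  rw [e1, Real.rpow_logb (by norm_num) (by norm_num) (by positivity)]

lemma tendsto_pow_log_div (k : ℕ) :
    Tendsto (fun n : ℕ => Real.log n ^ k / (n:ℝ)) atTop (nhds 0) := by
  have h := (Real.isLittleO_pow_log_id_atTop (n := k)).tendsto_div_nhds_zero
  exact h.comp tendsto_natCast_atTop_atTop

lemma tendsto_x : Tendsto (fun n : ℕ => Real.logb 2 (n:ℝ)) atTop atTop :=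
  (Real.tendsto_logb_atTop (by norm_num)).comp tendsto_natCast_atTop_atTop

lemma alpha_lower : ∀ᶠ n : ℕ in atTop, 1.7 * Real.logb 2 n + 1 ≤ alpha0 n := by
  have hl : ∀ᶠ x : ℝ in atTop, 2 * Real.logb 2 x - 2 * Real.logb 2 (Real.exp 1 / 2) ≤ 0.3 * x := by
    have h1 := (Real.isLittleO_log_id_atTop).def (show (0:ℝ) < 0.06 by norm_num)
    filter_upwards [h1, eventually_gt_atTop (1:ℝ),
      eventually_gt_atTop (20 * |Real.logb 2 (Real.exp 1 / 2)|)] with x hx hx1 hx2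
    have hlog2 : (0.69:ℝ) < Real.log 2 := by linarith [Real.log_two_gt_d9]
    have h0 : 0 ≤ Real.log x := Real.log_nonneg hx1.le
    simp only [id, Real.norm_eq_abs] at hx
    rw [abs_of_nonneg h0, abs_of_pos (by linarith)] at hx
    have : Real.logb 2 x ≤ 0.1 * x := by
      unfold Real.logb
      rw [div_le_iff₀ (by linarith)]
      nlinarith
    have := neg_abs_le (Real.logb 2 (Real.exp 1 / 2))
    linarith
  filter_upwards [tendsto_x.eventually hl] with n hn
  unfold alpha0
  linarith

lemma core : ∀ᶠ n : ℕ in atTop, 2 ≤ Real.logb 2 n ∧ 1.7 * Real.logb 2 n ≤ aa n ∧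
    (2:ℝ) ^ (aa n) ≤ (n:ℝ)^2 ∧ (aa n : ℝ) ≤ 2 * Real.logb 2 n ∧
    (2:ℝ)⁻¹ ^ (aa n - 1) ≤ 8 * (Real.logb 2 n)^2 / ((Real.exp 1)^2 * (n:ℝ)^2) := by
  filter_upwards [alpha_lower, tendsto_x.eventually (eventually_ge_atTop 2),
    eventually_ge_atTop 1] with n h1 h2 h3
  have hn0 : (0:ℝ) < n := by exact_mod_cast h3
  have he : (0:ℝ) < Real.exp 1 := Real.exp_pos 1
  have he' : Real.exp 1 < 2.8 := by linarith [Real.exp_one_lt_d9]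
  have e := two_rpow_alpha0 h3 (by linarith)
  have hle : (aa n : ℝ) ≤ alpha0 n := Nat.floor_le (by linarith)
  have hlt : alpha0 n < aa n + 1 := Nat.lt_floor_add_one _
  set x := Real.logb 2 n with hx
  have hpow : (2:ℝ) ^ (aa n) = (2:ℝ) ^ ((aa n : ℕ) : ℝ) := (Real.rpow_natCast _ _).symm
  have hup : (2:ℝ) ^ (alpha0 n) ≤ (n:ℝ)^2 := by
    rw [e, div_le_iff₀ (by positivity), mul_comm]
    have : (Real.exp 1)^2 ≤ 2 * x^2 := by nlinarith
    gcongr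
  refine ⟨h2, by linarith, ?_, ?_, ?_⟩
  · rw [hpow]
    exact (Real.rpow_le_rpow_of_exponent_le (by norm_num) hle).trans hup
  · refine hle.trans ?_
    have h4 : (n:ℝ)^2 = (2:ℝ) ^ (2 * x) := by
      rw [mul_comm, Real.rpow_mul (by norm_num), hx, Real.rpow_logb (by norm_num) (by norm_num) hn0]
      norm_cast
    rw [h4] at hup
    exact (Real.rpow_le_rpow_left_iff (by norm_num)).1 hup
  · have ha1 : 1 ≤ aa n := by
      have : (0:ℝ) < aa n := by linarith
      exact_mod_cast this
    have h5 : (2:ℝ) ^ (alpha0 n) ≤ 4 * (2:ℝ) ^ (aa n - 1) := by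
      refine (Real.rpow_le_rpow_of_exponent_le (by norm_num) hlt.le).trans (le_of_eq ?_)
      rw [show ((aa n : ℝ) + 1) = ((aa n - 1 + 2 : ℕ) : ℝ) by
        rw [show aa n - 1 + 2 = aa n + 1 by omega]; push_cast; ring, Real.rpow_natCast, pow_add]
      ring
    rw [e] at h5
    rw [inv_pow, inv_le_comm₀ (by positivity) (by positivity), inv_div]
    rw [div_le_iff₀ (by positivity)] at h5 ⊢
    linarith

lemma mu_sq {n : ℕ} (hn : 1 ≤ n) (hx : 2 ≤ Real.logb 2 n) (h1 : 1.7 * Real.logb 2 n ≤ aa n)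
    (h2 : (2:ℝ) ^ (aa n) ≤ (n:ℝ)^2)
    (h3 : (2:ℝ)⁻¹ ^ (aa n - 1) ≤ 8 * (Real.logb 2 n)^2 / ((Real.exp 1)^2 * (n:ℝ)^2)) :
    (mu n)^2 ≤ (n:ℝ)^3 := by
  unfold mu
  set a := aa n
  set x := Real.logb 2 n
  have hn0 : (0:ℝ) < n := by exact_mod_cast hn
  have he : (0:ℝ) < Real.exp 1 := Real.exp_pos 1
  have ha0 : (0:ℝ) < a := by linarith
  have ha1 : 0 < a := by exact_mod_cast ha0
  have c1 : (n.choose a : ℝ) ≤ (n:ℝ)^a / (Nat.factorial a) := Nat.choose_le_pow_div a n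
  have c2 : (a:ℝ)^a / (Nat.factorial a) ≤ (Real.exp 1)^a := by
    refine (Real.pow_div_factorial_le_exp _ ha0.le a).trans (le_of_eq ?_)
    rw [← Real.exp_nat_mul, mul_one]
  have c3 : (n.choose a : ℝ) ≤ (n * Real.exp 1 / a)^a := by
    refine c1.trans ?_
    have hf : (0:ℝ) < Nat.factorial a := by positivity
    rw [div_le_iff₀ hf] at c2 ⊢
    rw [div_pow, mul_pow, div_mul_eq_mul_div, le_div_iff₀ (by positivity)]
    rw [mul_assoc]
    gcongr
  have e1 : ((2:ℝ)⁻¹ ^ (a.choose 2))^2 = ((2:ℝ)⁻¹ ^ (a-1))^a := by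
    obtain ⟨m, hm⟩ := Nat.exists_eq_add_of_le' ha1
    have := two_choose m
    rw [hm, ← pow_mul, ← pow_mul, mul_comm _ 2, this, Nat.add_sub_cancel]
  have c4 : ((n.choose a : ℝ) * (2 : ℝ)⁻¹ ^ (a.choose 2))^2 ≤ (8 * x^2 / (a:ℝ)^2)^a := by
    rw [mul_pow, e1]
    calc _ ≤ ((n * Real.exp 1 / a)^a)^2 * (8 * x^2 / ((Real.exp 1)^2 * (n:ℝ)^2))^a := by gcongr
      _ = ((n * Real.exp 1 / a)^2 * (8 * x^2 / ((Real.exp 1)^2 * (n:ℝ)^2)))^a := by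
        rw [mul_pow _ _ a, ← pow_mul, ← pow_mul, mul_comm a 2]
      _ = _ := by congr 1; field_simp
  have c5 : ((8 * x^2 / (a:ℝ)^2)^a)^2 ≤ ((n:ℝ)^3)^2 := by
    calc ((8 * x^2 / (a:ℝ)^2)^a)^2 = ((8 * x^2 / (a:ℝ)^2)^2)^a := by
          rw [← pow_mul, ← pow_mul, mul_comm a 2]
      _ ≤ 8^a := by
          refine pow_le_pow_left₀ (by positivity) ?_ _
          rw [div_pow, div_le_iff₀ (by positivity)]
          have q1 : (1.7 * x)^4 ≤ (a:ℝ)^4 := by gcongr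
          have q2 : 0 ≤ x^4 := by positivity
          nlinarith
      _ = ((2:ℝ)^a)^3 := by rw [← pow_mul, mul_comm, pow_mul]; norm_num
      _ ≤ ((n:ℝ)^2)^3 := by gcongr
      _ = _ := by ring
  exact c4.trans ((sq_le_sq₀ (by positivity) (by positivity)).1 c5)

lemma part1 : ∃ n₀ : ℕ, ∀ n ≥ n₀,
      dTVPoi n (fun G => numIndep n (aa n) G) (mu n) ≤
        1296 * (mu n * (Real.log n) ^ 4 / (n : ℝ) ^ 2 + (Real.log n) ^ 3 / n) := by
  rw [← eventually_atTop]
  filter_upwards [core, eventually_ge_atTop 1,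
    (tendsto_pow_log_div 4).eventually_le_const (show (0:ℝ) < 1 / 5184 by norm_num),
    (tendsto_pow_log_div 6).eventually_le_const (show (0:ℝ) < 1 / 256 by norm_num)]
    with n hc hn h4 h6
  obtain ⟨hx, h1, h2, h3, h5⟩ := hc
  have hn0 : (0:ℝ) < n := by exact_mod_cast hn
  have he : (2.7:ℝ) < Real.exp 1 := by linarith [Real.exp_one_gt_d9]
  have hlog2 : (0.69:ℝ) < Real.log 2 := by linarith [Real.log_two_gt_d9]
  have hL : Real.log n = Real.logb 2 n * Real.log 2 := by
    unfold Real.logb; field_simp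
  have hdef : mu n = (n.choose (aa n) : ℝ) * (2 : ℝ)⁻¹ ^ ((aa n).choose 2) := rfl
  set a := aa n
  set x := Real.logb 2 n
  set L := Real.log n
  have hxL : x ≤ 1.5 * L := by rw [hL]; nlinarith
  have haL : (a:ℝ) ≤ 3 * L := by linarith
  have hL0 : 0 < L := by linarith
  have ha2 : 2 ≤ a := by
    have : (2:ℝ) ≤ a := by linarith
    exact_mod_cast this
  set q : ℝ := a * n * (2:ℝ)⁻¹ ^ (a-1) with hq
  have hq0 : 0 ≤ q := by positivity
  have hqL : q ≤ 8 * L^3 / n := by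
    calc q ≤ (3*L) * n * (8 * (1.5*L)^2 / (2.7^2 * (n:ℝ)^2)) := by
          rw [hq]
          have : 8 * x^2 / ((Real.exp 1)^2 * (n:ℝ)^2) ≤ 8 * (1.5*L)^2 / (2.7^2 * (n:ℝ)^2) := by gcongr
          have := h5.trans this
          gcongr
      _ = (54 / 7.29) * L^3 / n := by field_simp; norm_num
      _ ≤ 8 * L^3 / n := by gcongr; norm_num
  rw [div_le_iff₀ hn0] at h4 h6
  have ha4 : (a:ℝ)^4 ≤ 81 * L^4 := by
    calc (a:ℝ)^4 ≤ (3*L)^4 := by gcongr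
      _ = _ := by ring
  have g1 : 64 * (a:ℝ)^4 ≤ n := by linarith
  have g3 : q^2 * n ≤ 1/4 := by
    calc q^2 * n ≤ (8 * L^3 / n)^2 * n := by gcongr
      _ = 64 * L^6 / n := by field_simp; norm_num
      _ ≤ 1/4 := by rw [div_le_iff₀ hn0]; linarith
  have han : a ≤ n := by
    have : (64 * a^4 : ℕ) ≤ n := by exact_mod_cast g1
    nlinarith [Nat.pow_le_pow_right (show 0 < a by omega) (show 1 ≤ 4 by norm_num)]
  have b1 := dTV_bound n a han
  have b2 := sum_Fl q hq ha2 g1 h2 g3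
  have b3 := p_le_q ha2 hn
  rw [← hdef] at b1 b2
  have hmu : 0 ≤ mu n := by rw [hdef]; positivity
  have b4 : 16 * mu n * (a:ℝ)^4 / (n:ℝ)^2 ≤ 1296 * (mu n * L^4 / (n:ℝ)^2) := by
    calc _ ≤ 16 * mu n * (81 * L^4) / (n:ℝ)^2 := by gcongr
      _ = _ := by ring
  have b5 : 3 * q ≤ 1296 * (L^3 / n) := by
    have : 0 ≤ L^3 / n := by positivity
    have : 8 * L^3 / n = 8 * (L^3 / n) := by ring
    linarith
  rw [← hq] at b3
  linarith

theorem stmt6 :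
    (∃ C > (0:ℝ), ∃ n₀ : ℕ, ∀ n ≥ n₀, 1 ≤ mu n →
      dTVPoi n (fun G => numIndep n (aa n) G) (mu n) ≤
        C * (mu n * (Real.log n) ^ 4 / (n : ℝ) ^ 2 + (Real.log n) ^ 3 / n)) ∧
    (∀ δ > (0:ℝ), ∃ N : ℕ, ∀ n ≥ N, 1 ≤ mu n →
      dTVPoi n (fun G => numIndep n (aa n) G) (mu n) ≤ δ) := by
  constructor
  · obtain ⟨n₀, h⟩ := part1
    exact ⟨1296, by norm_num, n₀, fun n hn _ => h n hn⟩
  · intro δ hδ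
    have hp := part1
    rw [← eventually_atTop] at hp ⊢
    have hd : (0:ℝ) < δ / 2592 := by positivity
    filter_upwards [hp, core, eventually_ge_atTop 1,
      (tendsto_pow_log_div 3).eventually_le_const hd,
      (tendsto_pow_log_div 8).eventually_le_const (show (0:ℝ) < (δ/2592)^2 by positivity)]
      with n h1 hc hn h3 h8 _
    have hn0 : (0:ℝ) < n := by exact_mod_cast hn
    have hm := mu_sq hn hc.1 hc.2.1 hc.2.2.1 hc.2.2.2.2
    have hmu : 0 ≤ mu n := by unfold mu; positivity
    have : mu n * (Real.log n) ^ 4 / (n : ℝ) ^ 2 ≤ δ / 2592 := by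
      refine (sq_le_sq₀ (by positivity) hd.le).1 (le_trans ?_ h8)
      calc (mu n * (Real.log n) ^ 4 / (n : ℝ) ^ 2)^2
          = (mu n)^2 * ((Real.log n) ^ 8 / (n : ℝ) ^ 4) := by ring
        _ ≤ (n:ℝ)^3 * ((Real.log n) ^ 8 / (n : ℝ) ^ 4) := by gcongr
        _ = _ := by field_simp
    linarith
end
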